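/- arXiv:2408.07572 — 2 statements merged into one kernel-verified Lean document; each statement's English description precedes it below -/
import Mathlib

section
/- Let (Ω₂,ℙ₂) be a probability space, let (W_n) be a tight sequence of P-variables W_n : [0,1] × [0,1] × Ω₂ → ℝ ([0,1] with Lebesgue measure), and let (W̃_n) be the sequence of associated probability graphons. Then (W_n) is a Cauchy sequence with respect to the P-variables metric d_M if and only if (W̃_n) is a Cauchy sequence with respect to the unlabelled cut distance δ_□. -/
set_option autoImplicit false

open MeasureTheory Set
open scoped ENNReal NNReal

noncomputable section

/-- `ℝ^n` with the Euclidean metric. -/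
abbrev RE (n : ℕ) : Type := EuclideanSpace ℝ (Fin n)

/-- The random vector `(f₁(x₁), f₁(x₂), …, f_k(x₁), f_k(x₂), W(x₁,x₂,x₁₂))`. -/
def sVec {Ω₁ Ω₂ : Type*} (k : ℕ) (f : Fin k → Ω₁ → ℝ)
    (W : Ω₁ × Ω₁ × Ω₂ → ℝ) (x : Ω₁ × Ω₁ × Ω₂) : RE (2 * k + 1) :=
  (WithLp.equiv 2 (Fin (2 * k + 1) → ℝ)).symm fun i =>
    if _ : (i : ℕ) < 2 * k then
      if (i : ℕ) % 2 = 0 then f ⟨(i : ℕ) / 2, by omega⟩ x.1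
      else f ⟨(i : ℕ) / 2, by omega⟩ x.2.1
    else W x

/-- `S(f₁,…,f_k,W)`: the pushforward of the product measure `P₁ ⊗ P₁ ⊗ P₂` under `sVec`. -/
def Smeasure {Ω₁ Ω₂ : Type*} [MeasurableSpace Ω₁] [MeasurableSpace Ω₂]
    (P₁ : Measure Ω₁) (P₂ : Measure Ω₂) {k : ℕ} (f : Fin k → Ω₁ → ℝ)
    (W : Ω₁ × Ω₁ × Ω₂ → ℝ) : Measure (RE (2 * k + 1)) :=
  (P₁.prod (P₁.prod P₂)).map (sVec k f W)

/-- The `k`-profile `S_k(W)`. -/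
def SkSet {Ω₁ Ω₂ : Type*} [MeasurableSpace Ω₁] [MeasurableSpace Ω₂]
    (P₁ : Measure Ω₁) (P₂ : Measure Ω₂) (k : ℕ)
    (W : Ω₁ × Ω₁ × Ω₂ → ℝ) : Set (Measure (RE (2 * k + 1))) :=
  {μ | ∃ f : Fin k → Ω₁ → ℝ, (∀ i, Measurable (f i)) ∧
    (∀ i x, f i x ∈ Icc (-1 : ℝ) 1) ∧ μ = Smeasure P₁ P₂ f W}

/-- A function partition: `{0,1}`-valued measurable functions summing to `1`. -/
def IsFunctionPartition {Ω₁ : Type*} [MeasurableSpace Ω₁] {k : ℕ}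
    (f : Fin k → Ω₁ → ℝ) : Prop :=
  (∀ i, Measurable (f i)) ∧ (∀ i x, f i x = 0 ∨ f i x = 1) ∧ ∀ x, ∑ i, f i x = 1

/-- The restricted `k`-profile `S'_k(W)`. -/
def SkSet' {Ω₁ Ω₂ : Type*} [MeasurableSpace Ω₁] [MeasurableSpace Ω₂]
    (P₁ : Measure Ω₁) (P₂ : Measure Ω₂) (k : ℕ)
    (W : Ω₁ × Ω₁ × Ω₂ → ℝ) : Set (Measure (RE (2 * k + 1))) :=
  {μ | ∃ f : Fin k → Ω₁ → ℝ, IsFunctionPartition f ∧ μ = Smeasure P₁ P₂ f W}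

/-- Hausdorff edistance (w.r.t. the Lévy–Prokhorov distance) between sets of measures. -/
def eHausLP {X : Type*} [MeasurableSpace X] [PseudoEMetricSpace X]
    (A B : Set (Measure X)) : ℝ≥0∞ :=
  max (⨆ μ ∈ A, ⨅ ν ∈ B, levyProkhorovEDist μ ν)
      (⨆ ν ∈ B, ⨅ μ ∈ A, levyProkhorovEDist μ ν)

/-- Hausdorff distance (w.r.t. the Lévy–Prokhorov distance) between sets of measures. -/
def dHLP {X : Type*} [MeasurableSpace X] [PseudoEMetricSpace X]
    (A B : Set (Measure X)) : ℝ := (eHausLP A B).toReal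

/-- A `P`-variable: a measurable real-valued function on a product `Ω₁ × Ω₁ × Ω₂`
of probability spaces. -/
structure PVar where
  (Ω₁ : Type*)
  (Ω₂ : Type*)
  [m₁ : MeasurableSpace Ω₁]
  [m₂ : MeasurableSpace Ω₂]
  (P₁ : Measure Ω₁)
  (P₂ : Measure Ω₂)
  (prob₁ : IsProbabilityMeasure P₁)
  (prob₂ : IsProbabilityMeasure P₂)
  (W : Ω₁ × Ω₁ × Ω₂ → ℝ)
  (meas : Measurable W)

attribute [instance] PVar.m₁ PVar.m₂

/-- The underlying product probability measure of a `P`-variable. -/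
def PVar.vol (V : PVar) : Measure (V.Ω₁ × V.Ω₁ × V.Ω₂) := V.P₁.prod (V.P₁.prod V.P₂)

/-- The `k`-profile of a `P`-variable. -/
def PVar.Sk (V : PVar) (k : ℕ) : Set (Measure (RE (2 * k + 1))) := SkSet V.P₁ V.P₂ k V.W

/-- The restricted `k`-profile of a `P`-variable. -/
def PVar.Sk' (V : PVar) (k : ℕ) : Set (Measure (RE (2 * k + 1))) := SkSet' V.P₁ V.P₂ k V.W

/-- The `P`-variables metric `d_M`. -/
def dM (V U : PVar) : ℝ :=
  ∑' k : ℕ, (2 : ℝ)⁻¹ ^ (k + 1) * dHLP (V.Sk (k + 1)) (U.Sk (k + 1))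


/-- The probability graphon (Markov kernel `[0,1]² → 𝒫(ℝ)`) associated to a
P-variable on `[0,1] × [0,1] × Ω₂`: `W̃(x₁,x₂;·)` is the law of `W(x₁,x₂,·)`. -/
def assocGraphon {Ω₂ : Type*} [MeasurableSpace Ω₂] (P₂ : Measure Ω₂)
    (W : unitInterval × unitInterval × Ω₂ → ℝ)
    (x : unitInterval × unitInterval) : Measure ℝ :=
  P₂.map fun ω => W (x.1, x.2, ω)

/-- `W̃(A;·) = ∫_A W̃(x,y;·) dx dy` for measurable `A ⊆ [0,1]²`. -/
def graphonInt (K : unitInterval × unitInterval → Measure ℝ)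
    (A : Set (unitInterval × unitInterval)) : Measure ℝ :=
  (((volume : Measure unitInterval).prod volume).restrict A).bind K

/-- The cut semidistance `d_□` between two probability graphons on `[0,1]`:
`sup_{S,T} d_LP(K(S×T;·), L(S×T;·))` over measurable `S, T ⊆ [0,1]`. -/
def cutDistKer (K L : unitInterval × unitInterval → Measure ℝ) : ℝ :=
  ⨆ p : {S : Set unitInterval // MeasurableSet S} ×
        {T : Set unitInterval // MeasurableSet T},
    levyProkhorovDist (graphonInt K (p.1.1 ×ˢ p.2.1)) (graphonInt L (p.1.1 ×ˢ p.2.1))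

/-- The unlabelled cut distance `δ_□`: infimum of `d_□(K, L∘(φ×φ))` over
Lebesgue-measure-preserving bijections `φ` of `[0,1]`. -/
def unlabCutDist (K L : unitInterval × unitInterval → Measure ℝ) : ℝ :=
  ⨅ φ : {φ : unitInterval ≃ᵐ unitInterval //
          MeasurePreserving φ (volume : Measure unitInterval) volume},
    cutDistKer K fun x => L (φ.1 x.1, φ.1 x.2)

/-- A P-variable on `[0,1] × [0,1] × Ω₂` (with Lebesgue measure on `[0,1]`),
bundled as a `PVar`. -/
def PVar.ofUnitInterval {Ω₂ : Type*} [MeasurableSpace Ω₂] (P₂ : Measure Ω₂)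
    [h₂ : IsProbabilityMeasure P₂] (W : unitInterval × unitInterval × Ω₂ → ℝ)
    (hW : Measurable W) : PVar :=
  ⟨unitInterval, Ω₂, (volume : Measure unitInterval), P₂, inferInstance, h₂, W, hW⟩

/-! ### Interval exchanges -/

/-- Interval exchange of `ℝ` permuting cells of length `1/n`. -/
def iex (n : ℕ) (σ : Equiv.Perm ℤ) (x : ℝ) : ℝ := x + ((σ ⌊n * x⌋ : ℝ) - ⌊n * x⌋) / n

lemma iex_floor {n : ℕ} (hn : 0 < n) (σ : Equiv.Perm ℤ) (x : ℝ) :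
    ⌊n * iex n σ x⌋ = σ ⌊n * x⌋ := by
  have hn' : (n : ℝ) ≠ 0 := by positivity
  have : (n : ℝ) * iex n σ x = Int.fract (n * x) + (σ ⌊n * x⌋ : ℤ) := by
    unfold iex
    rw [mul_add, mul_div_cancel₀ _ hn', Int.fract]; ring
  rw [this, Int.floor_add_intCast, Int.floor_fract]; simp

lemma iex_inv {n : ℕ} (hn : 0 < n) (σ : Equiv.Perm ℤ) (x : ℝ) :
    iex n σ⁻¹ (iex n σ x) = x := by
  rw [iex, iex_floor hn]
  simp [iex]
  ring

lemma iex_measurable (n : ℕ) (σ : Equiv.Perm ℤ) : Measurable (iex n σ) := by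
  unfold iex
  have h1 : Measurable fun x : ℝ => ⌊n * x⌋ := Int.measurable_floor.comp (measurable_const_mul _)
  have h2 : Measurable fun z : ℤ => ((σ z : ℝ) - z) / n := measurable_of_countable _
  exact measurable_id.add (h2.comp h1)

lemma iex_mp {n : ℕ} (hn : 0 < n) (σ : Equiv.Perm ℤ) :
    MeasurePreserving (iex n σ) (volume : Measure ℝ) volume := by
  refine ⟨iex_measurable n σ, ?_⟩
  ext s hs
  rw [Measure.map_apply (iex_measurable n σ) hs]
  let J : ℤ → Set ℝ := fun i => {x | ⌊n * x⌋ = i}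
  have hm : Measurable fun x : ℝ => ⌊n * x⌋ := Int.measurable_floor.comp (measurable_const_mul _)
  have hJ : ∀ i, MeasurableSet (J i) := fun i => hm (measurableSet_singleton i)
  have key : ∀ t : Set ℝ, MeasurableSet t → volume t = ∑' i, volume (t ∩ J i) := by
    intro t ht
    rw [← measure_iUnion]
    · congr 1
      ext x; simp [J]
    · intro i j hij
      rw [Function.onFun, Set.disjoint_left]
      rintro x ⟨-, hx⟩ ⟨-, hx'⟩
      exact hij (hx.symm.trans hx')
    · exact fun i => ht.inter (hJ i)
  rw [key _ (iex_measurable n σ hs), key s hs,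
    ← Equiv.tsum_eq σ (fun i => volume (s ∩ J i))]
  congr 1
  ext i
  have : iex n σ ⁻¹' s ∩ J i = (fun x => x + (((σ i : ℤ) : ℝ) - i) / n) ⁻¹' (s ∩ J (σ i)) := by
    ext x
    simp only [J, mem_inter_iff, mem_preimage, mem_ofPred_eq]
    have hn' : (n : ℝ) ≠ 0 := by positivity
    have e : ⌊n * (x + (((σ i : ℤ) : ℝ) - i) / n)⌋ = ⌊n * x⌋ + (σ i - i) := by
      rw [mul_add, mul_div_cancel₀ _ hn', ← Int.cast_sub, Int.floor_add_intCast]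
    rw [e]
    constructor
    · rintro ⟨h1, h2⟩
      refine ⟨?_, by omega⟩
      rw [iex, h2] at h1
      exact h1
    · rintro ⟨h1, h2⟩
      have h3 : ⌊n * x⌋ = i := by omega
      refine ⟨?_, h3⟩
      rw [iex, h3]
      exact h1
  rw [this, measure_preimage_add_right]

lemma iex_mem {n : ℕ} (hn : 0 < n) (σ : Equiv.Perm ℤ)
    (hσ : ∀ i : ℤ, 0 ≤ i → i < n → 0 ≤ σ i ∧ σ i < n) (hσ' : σ n = n) (x : ℝ)
    (hx : x ∈ Icc (0 : ℝ) 1) : iex n σ x ∈ Icc (0 : ℝ) 1 := by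
  have hn' : (0 : ℝ) < n := by positivity
  rcases eq_or_lt_of_le hx.2 with h | h
  · subst h
    simp [iex, hσ']
  · have h0 : 0 ≤ ⌊n * x⌋ := Int.floor_nonneg.2 (mul_nonneg hn'.le hx.1)
    have h1 : ⌊n * x⌋ < n := by
      rw [Int.floor_lt]; push_cast; nlinarith
    obtain ⟨h2, h3⟩ := hσ _ h0 h1
    rw [← iex_floor hn] at h2 h3
    rw [Int.floor_nonneg] at h2
    rw [Int.floor_lt] at h3
    push_cast at h3
    constructor
    · exact nonneg_of_mul_nonneg_right h2 hn'
    · nlinarith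

/-- The interval exchange on the unit interval. -/
def iexI {n : ℕ} (hn : 0 < n) (σ : Equiv.Perm ℤ)
    (hσ : ∀ i : ℤ, 0 ≤ i → i < n → 0 ≤ σ i ∧ σ i < n)
    (hσi : ∀ i : ℤ, 0 ≤ i → i < n → 0 ≤ σ⁻¹ i ∧ σ⁻¹ i < n) (hσ' : σ n = n) :
    unitInterval ≃ᵐ unitInterval where
  toFun x := ⟨iex n σ x, iex_mem hn σ hσ hσ' x x.2⟩
  invFun x := ⟨iex n σ⁻¹ x, iex_mem hn σ⁻¹ hσi (by rw [Equiv.Perm.inv_eq_iff_eq, hσ']) x x.2⟩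
  left_inv x := Subtype.ext (iex_inv hn σ x)
  right_inv x := Subtype.ext (by simpa using iex_inv hn σ⁻¹ x)
  measurable_toFun := ((iex_measurable n σ).comp measurable_subtype_coe).subtype_mk
  measurable_invFun := ((iex_measurable n σ⁻¹).comp measurable_subtype_coe).subtype_mk

lemma vol_image (s : Set unitInterval) : volume s = volume (Subtype.val '' s : Set ℝ) := by
  rw [Measure.Subtype.volume_def]
  exact comap_subtype_coe_apply measurableSet_Icc _ _

lemma iexI_mp {n : ℕ} (hn : 0 < n) (σ : Equiv.Perm ℤ)
    (hσ : ∀ i : ℤ, 0 ≤ i → i < n → 0 ≤ σ i ∧ σ i < n)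
    (hσi : ∀ i : ℤ, 0 ≤ i → i < n → 0 ≤ σ⁻¹ i ∧ σ⁻¹ i < n) (hσ' : σ n = n) :
    MeasurePreserving (iexI hn σ hσ hσi hσ') (volume : Measure unitInterval) volume := by
  refine ⟨(iexI hn σ hσ hσi hσ').measurable, ?_⟩
  ext s hs
  rw [Measure.map_apply (iexI hn σ hσ hσi hσ').measurable hs, vol_image, vol_image s]
  have hs' : MeasurableSet (Subtype.val '' s : Set ℝ) := measurableSet_Icc.subtype_image hs
  rw [← (iex_mp hn σ).measure_preimage hs'.nullMeasurableSet]
  congr 1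
  ext x
  constructor
  · rintro ⟨y, hy, rfl⟩
    exact ⟨_, hy, rfl⟩
  · rintro ⟨y, hy, hyx⟩
    have hx : x = iex n σ⁻¹ y := by rw [hyx, iex_inv hn]
    have hx1 : x ∈ Icc (0 : ℝ) 1 := by
      rw [hx]
      exact iex_mem hn σ⁻¹ hσi (by rw [Equiv.Perm.inv_eq_iff_eq, hσ']) y y.2
    refine ⟨⟨x, hx1⟩, ?_, rfl⟩
    have : iexI hn σ hσ hσi hσ' ⟨x, hx1⟩ = y := Subtype.ext hyx.symm
    simpa [this] using hy

/-- Combinatorial matching. -/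
lemma perm_match (n k : ℕ) (d d' : Fin n → ℕ) (hd : ∀ i, d i < k) :
    ∃ σ : Equiv.Perm (Fin n), ((Finset.univ.filter fun i => d i ≠ d' (σ i)).card : ℝ) ≤
      ∑ a ∈ Finset.range k, |((Finset.univ.filter fun i => d i = a).card : ℝ) -
        ((Finset.univ.filter fun i => d' i = a).card : ℝ)| := by
  obtain ⟨σ, -, hσ⟩ := Finset.exists_max_image (Finset.univ : Finset (Equiv.Perm (Fin n)))
    (fun σ => (Finset.univ.filter fun i => d i = d' (σ i)).card) ⟨1, Finset.mem_univ _⟩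
  refine ⟨σ, ?_⟩
  have h1 : (Finset.univ.filter fun i => d i ≠ d' (σ i)).card =
      ∑ a ∈ Finset.range k, (Finset.univ.filter fun i => d i ≠ d' (σ i) ∧ d i = a).card := by
    rw [Finset.card_eq_sum_card_fiberwise (f := d) (t := Finset.range k)]
    · simp [Finset.filter_filter]
    · intro i _
      simpa using hd i
  rw [h1]
  push_cast
  refine Finset.sum_le_sum fun a _ => ?_
  by_cases hM : ∃ i, d i ≠ d' (σ i) ∧ d i = a
  · obtain ⟨i, hi, hia⟩ := hM
    -- then every j with d' (σ j) = a is matched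
    have hall : ∀ j, d' (σ j) = a → d j = a := by
      intro j hj
      by_contra hja
      have hij : i ≠ j := by rintro rfl; exact hja hia
      have := hσ (σ * Equiv.swap i j) (Finset.mem_univ _)
      refine absurd this (not_le.2 (Finset.card_lt_card ?_))
      rw [Finset.ssubset_iff_of_subset]
      · refine ⟨i, Finset.mem_filter.2 ⟨Finset.mem_univ _, by simp [hia, hj]⟩,
          fun h => hi (Finset.mem_filter.1 h).2⟩
      · intro l hl
        simp only [Finset.mem_filter, Finset.mem_univ, true_and] at hl ⊢
        have hli : l ≠ i := by rintro rfl; exact hi hl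
        have hlj : l ≠ j := by rintro rfl; exact hja (hl.trans hj)
        simp [Equiv.swap_apply_of_ne_of_ne hli hlj, hl]
    have hb : (Finset.univ.filter fun i => d' i = a).card =
        (Finset.univ.filter fun i => d' (σ i) = a).card := by
      refine (Finset.card_bij (fun i _ => σ i) ?_ ?_ ?_).symm
      · simp
      · simp
      · intro b hb
        exact ⟨σ.symm b, by simpa using hb, by simp⟩
    have hc : (Finset.univ.filter fun i => d i = a).card =
        (Finset.univ.filter fun i => d i ≠ d' (σ i) ∧ d i = a).card +
        (Finset.univ.filter fun i => d' (σ i) = a).card := by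
      rw [← Finset.card_union_of_disjoint]
      · congr 1
        ext l
        simp only [Finset.mem_filter, Finset.mem_univ, true_and, Finset.mem_union]
        constructor
        · intro h
          by_cases hh : d' (σ l) = a
          · exact Or.inr hh
          · exact Or.inl ⟨by rw [h]; exact fun e => hh e.symm, h⟩
        · rintro (h | h)
          · exact h.2
          · exact hall l h
      · rw [Finset.disjoint_left]
        intro l hl hl'
        simp only [Finset.mem_filter, Finset.mem_univ, true_and] at hl hl'
        exact hl.1 (hl.2.trans hl'.symm)
    rw [hb, hc]
    push_cast
    rw [add_sub_cancel_right]
    exact le_abs_self _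
  · have : (Finset.univ.filter fun i => d i ≠ d' (σ i) ∧ d i = a) = ∅ := by
      ext l
      simp only [Finset.mem_filter, Finset.mem_univ, true_and, Finset.notMem_empty, iff_false]
      exact fun h => hM ⟨l, h⟩
    rw [this]
    simp

/-! ### Approximation by step functions and matching of partitions -/

lemma floor_refine (n m : ℕ) (hm : 0 < m) (x : ℝ) :
    ⌊(n : ℝ) * x⌋ = ⌊((n * m : ℕ) : ℝ) * x⌋ / (m : ℤ) := by
  rw [← Int.floor_div_natCast]
  congr 1
  have : (m : ℝ) ≠ 0 := by positivity
  push_cast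
  field_simp

/-- Sets that are unions of cells. -/
def cellAlg : Set (Set unitInterval) :=
  {A | ∃ n : ℕ, 0 < n ∧ ∃ Z : Set ℤ, A = {x : unitInterval | ⌊(n : ℝ) * (x : ℝ)⌋ ∈ Z}}

lemma meas_floor (n : ℕ) : Measurable fun x : unitInterval => ⌊(n : ℝ) * (x : ℝ)⌋ :=
  Int.measurable_floor.comp ((measurable_const_mul _).comp measurable_subtype_coe)

lemma cellAlg_refine {n : ℕ} (m : ℕ) (hm : 0 < m) (Z : Set ℤ) :
    {x : unitInterval | ⌊(n : ℝ) * (x : ℝ)⌋ ∈ Z} =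
    {x : unitInterval | ⌊((n * m : ℕ) : ℝ) * (x : ℝ)⌋ ∈ {z : ℤ | z / (m : ℤ) ∈ Z}} := by
  ext x
  simp only [mem_ofPred_eq]
  rw [floor_refine n m hm]

lemma cellAlg_isSetAlgebra : IsSetAlgebra cellAlg where
  empty_mem := ⟨1, one_pos, ∅, by simp⟩
  compl_mem := by
    rintro s ⟨n, hn, Z, rfl⟩
    exact ⟨n, hn, Zᶜ, by ext; simp⟩
  union_mem := by
    rintro s t ⟨n, hn, Z, rfl⟩ ⟨m, hm, Z', rfl⟩
    rw [cellAlg_refine m hm Z, cellAlg_refine n hn Z', mul_comm m n]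
    exact ⟨n * m, by positivity, {z : ℤ | z / (m : ℤ) ∈ Z} ∪ {z : ℤ | z / (n : ℤ) ∈ Z'}, by ext; simp⟩

lemma cellAlg_gen : (inferInstance : MeasurableSpace unitInterval) =
    MeasurableSpace.generateFrom cellAlg := by
  apply le_antisymm
  · have : (inferInstance : MeasurableSpace unitInterval) = borel unitInterval :=
      BorelSpace.measurable_eq
    rw [this, borel_eq_generateFrom_Ici]
    apply MeasurableSpace.generateFrom_le
    rintro _ ⟨a, rfl⟩
    have : Ici a = ⋂ n : ℕ, {x : unitInterval | ⌊((n + 1 : ℕ) : ℝ) * (x : ℝ)⌋ ∈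
        {z : ℤ | ⌊((n + 1 : ℕ) : ℝ) * (a : ℝ)⌋ ≤ z}} := by
      ext x
      simp only [mem_Ici, mem_iInter, mem_ofPred_eq]
      constructor
      · intro h n
        have : (a : ℝ) ≤ x := h
        gcongr
      · intro h
        by_contra hlt
        have hlt' : (x : ℝ) < a := not_le.1 hlt
        obtain ⟨n, hn⟩ := exists_nat_gt (1 / ((a : ℝ) - x))
        have hpos : 0 < (a : ℝ) - x := sub_pos.2 hlt'
        rw [div_lt_iff₀ hpos] at hn
        have h1 := h n
        have h2 : ((n + 1 : ℕ) : ℝ) * (x : ℝ) + 1 ≤ ((n + 1 : ℕ) : ℝ) * (a : ℝ) := by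
          push_cast; nlinarith
        have h3 := Int.floor_mono h2
        rw [Int.floor_add_one] at h3
        omega
    rw [this]
    exact MeasurableSet.iInter fun n => MeasurableSpace.measurableSet_generateFrom
      ⟨n + 1, Nat.succ_pos _, _, rfl⟩
  · apply MeasurableSpace.generateFrom_le
    rintro _ ⟨n, hn, Z, rfl⟩
    exact meas_floor n (MeasurableSet.of_discrete (s := Z))

lemma step_approx_set (A : Set unitInterval) (hA : MeasurableSet A) (ε : ℝ) (hε : 0 < ε) :
    ∃ n : ℕ, 0 < n ∧ ∃ Z : Set ℤ,
      volume.real (symmDiff A {x : unitInterval | ⌊(n : ℝ) * (x : ℝ)⌋ ∈ Z}) ≤ ε := by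
  obtain ⟨t, ⟨n, hn, Z, rfl⟩, h⟩ :=
    (Measure.MeasureDense.of_generateFrom_isSetAlgebra_finite
      (volume : Measure unitInterval) cellAlg_isSetAlgebra cellAlg_gen).approx A hA
      (measure_ne_top _ _) ε hε
  exact ⟨n, hn, Z, ENNReal.toReal_le_of_le_ofReal hε.le h.le⟩

lemma step_approx {k : ℕ} (c : unitInterval → ℕ) (hc : Measurable c) (hck : ∀ x, c x < k)
    (ε : ℝ) (hε : 0 < ε) :
    ∃ n : ℕ, 0 < n ∧ ∃ d : ℤ → ℕ, (∀ z, d z < k) ∧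
      volume.real {x : unitInterval | c x ≠ d ⌊(n : ℝ) * (x : ℝ)⌋} ≤ ε := by
  have hk : 0 < k := lt_of_le_of_lt (Nat.zero_le _) (hck 0)
  have hk' : (0 : ℝ) < k := by positivity
  have h1 : ∀ a : ℕ, ∃ n : ℕ, 0 < n ∧ ∃ Z : Set ℤ,
      volume.real (symmDiff {x | c x = a} {x : unitInterval | ⌊(n : ℝ) * (x : ℝ)⌋ ∈ Z}) ≤ ε / k :=
    fun a => step_approx_set _ (hc (measurableSet_singleton a)) _ (by positivity)
  choose n hn Z hZ using h1
  let N := ∏ a ∈ Finset.range k, n a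
  have hN : 0 < N := Finset.prod_pos fun a _ => hn a
  have h2 : ∀ a, ∃ Z' : Set ℤ, a ∈ Finset.range k →
      volume.real (symmDiff {x | c x = a} {x : unitInterval | ⌊(N : ℝ) * (x : ℝ)⌋ ∈ Z'}) ≤ ε / k := by
    intro a
    by_cases ha : a ∈ Finset.range k
    · obtain ⟨m, hm⟩ := Finset.dvd_prod_of_mem n ha
      have hm' : N = n a * m := hm
      have hmpos : 0 < m := by
        rcases Nat.eq_zero_or_pos m with h | h
        · rw [h] at hm'; omega
        · exact h
      refine ⟨{z : ℤ | z / (m : ℤ) ∈ Z a}, fun _ => ?_⟩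
      rw [hm', ← cellAlg_refine m hmpos]
      exact hZ a
    · exact ⟨∅, fun h => absurd h ha⟩
  choose Z' hZ' using h2
  classical
  let d : ℤ → ℕ := fun z => if h : ∃ a, a < k ∧ z ∈ Z' a then h.choose else 0
  have hd : ∀ z, d z < k := by
    intro z
    by_cases h : ∃ a, a < k ∧ z ∈ Z' a
    · simp only [d, dif_pos h]
      exact h.choose_spec.1
    · simp only [d, dif_neg h]
      exact hk
  refine ⟨N, hN, d, hd, ?_⟩
  calc volume.real {x : unitInterval | c x ≠ d ⌊(N : ℝ) * (x : ℝ)⌋}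
      ≤ volume.real (⋃ a ∈ Finset.range k,
        symmDiff {x | c x = a} {x : unitInterval | ⌊(N : ℝ) * (x : ℝ)⌋ ∈ Z' a}) := by
        apply measureReal_mono
        · intro x hx
          by_contra hcon
          simp only [mem_iUnion, not_exists, Finset.mem_range] at hcon
          have hmem : ∀ a < k, (c x = a ↔ ⌊(N : ℝ) * (x : ℝ)⌋ ∈ Z' a) := by
            intro a ha
            have := hcon a ha
            rw [Set.mem_symmDiff] at this
            simp only [mem_ofPred_eq] at this
            tauto
          have hex : ∃ a, a < k ∧ ⌊(N : ℝ) * (x : ℝ)⌋ ∈ Z' a :=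
            ⟨c x, hck x, (hmem _ (hck x)).1 rfl⟩
          apply hx
          have : d ⌊(N : ℝ) * (x : ℝ)⌋ = hex.choose := by simp only [d, dif_pos hex]
          rw [this]
          exact (hmem _ hex.choose_spec.1).2 hex.choose_spec.2
        · exact measure_ne_top _ _
    _ ≤ ∑ a ∈ Finset.range k, volume.real
        (symmDiff {x | c x = a} {x : unitInterval | ⌊(N : ℝ) * (x : ℝ)⌋ ∈ Z' a}) :=
        measureReal_biUnion_finset_le _ _
    _ ≤ ∑ a ∈ Finset.range k, ε / k := Finset.sum_le_sum fun a ha => hZ' a ha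
    _ = ε := by simp; field_simp

lemma vol_cell {n : ℕ} (hn : 0 < n) (i : ℕ) (hi : i < n) :
    volume.real {x : unitInterval | ⌊(n : ℝ) * (x : ℝ)⌋ = (i : ℤ)} = 1 / n := by
  have hn' : (0 : ℝ) < n := by positivity
  rw [measureReal_def, vol_image]
  have : (Subtype.val '' {x : unitInterval | ⌊(n : ℝ) * (x : ℝ)⌋ = (i : ℤ)} : Set ℝ) =
      Ico ((i : ℝ) / n) ((i + 1) / n) := by
    ext y
    have hy : ⌊(n : ℝ) * y⌋ = (i : ℤ) ↔ y ∈ Ico ((i : ℝ) / n) ((i + 1) / n) := by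
      rw [Int.floor_eq_iff, mem_Ico, div_le_iff₀ hn', lt_div_iff₀ hn']
      push_cast
      rw [mul_comm]
    rw [← hy]
    constructor
    · rintro ⟨x, hx, rfl⟩
      exact hx
    · intro h
      refine ⟨⟨y, ?_⟩, h, rfl⟩
      rw [hy] at h
      have hi' : ((i : ℝ) + 1) ≤ n := by exact_mod_cast hi
      constructor
      · exact le_trans (by positivity) h.1
      · exact h.2.le.trans ((div_le_one hn').2 hi')
  rw [this, Real.volume_Ico, ENNReal.toReal_ofReal]
  · ring
  · rw [← sub_div]; simp

lemma vol_cells {n : ℕ} (hn : 0 < n) (p : ℤ → Prop) [DecidablePred p] :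
    volume.real {x : unitInterval | p ⌊(n : ℝ) * (x : ℝ)⌋} =
      ((Finset.univ.filter fun i : Fin n => p (i : ℕ)).card : ℝ) / n := by
  have hn' : (0 : ℝ) < n := by positivity
  have e : ({x : unitInterval | p ⌊(n : ℝ) * (x : ℝ)⌋} : Set unitInterval) =ᵐ[volume]
      (⋃ i ∈ (Finset.univ.filter fun i : Fin n => p (i : ℕ)),
        {x : unitInterval | ⌊(n : ℝ) * (x : ℝ)⌋ = ((i : ℕ) : ℤ)} : Set unitInterval) := by
    have h1 : ∀ᵐ x : unitInterval, x ≠ 1 := by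
      rw [ae_iff]; simp
    filter_upwards [h1] with x hx
    have hx1 : (x : ℝ) < 1 := lt_of_le_of_ne x.2.2 fun h => hx (Subtype.ext h)
    have h0 : 0 ≤ ⌊n * (x : ℝ)⌋ := Int.floor_nonneg.2 (mul_nonneg hn'.le x.2.1)
    have h1 : ⌊n * (x : ℝ)⌋ < n := by
      rw [Int.floor_lt]; push_cast; nlinarith
    obtain ⟨j, hj⟩ := Int.eq_ofNat_of_zero_le h0
    apply propext
    change p ⌊(n : ℝ) * (x : ℝ)⌋ ↔ x ∈ (⋃ i ∈ (Finset.univ.filter fun i : Fin n => p (i : ℕ)),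
        {x : unitInterval | ⌊(n : ℝ) * (x : ℝ)⌋ = ((i : ℕ) : ℤ)} : Set unitInterval)
    simp only [mem_iUnion, Finset.mem_filter, Finset.mem_univ, true_and, mem_ofPred_eq, exists_prop]
    constructor
    · intro h
      refine ⟨⟨j, by omega⟩, ?_, hj⟩
      rw [hj] at h
      exact h
    · rintro ⟨i, hi, hi'⟩
      rw [hi']; exact hi
  rw [measureReal_congr e, measureReal_biUnion_finset]
  · rw [Finset.sum_congr rfl fun (i : Fin n) _ => vol_cell hn (i : ℕ) i.2]
    simp
    ring
  · intro i _ j _ hij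
    rw [Function.onFun, Set.disjoint_left]
    intro x hx hx'
    apply hij
    have : ((i : ℕ) : ℤ) = (j : ℕ) := (Eq.symm hx).trans hx'
    exact Fin.ext (by exact_mod_cast this)
  · intro i _
    exact meas_floor n (measurableSet_singleton _)

/-- The cells index set as a subtype of `ℤ`. -/
def finEquivZ (n : ℕ) : Fin n ≃ {z : ℤ // 0 ≤ z ∧ z < n} where
  toFun i := ⟨(i : ℕ), by omega, by have := i.2; omega⟩
  invFun z := ⟨z.1.toNat, by have := z.2; omega⟩
  left_inv i := by ext; simp
  right_inv z := by
    apply Subtype.ext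
    have := z.2.1
    simp [this]

lemma exists_iexI {n : ℕ} (hn : 0 < n) (τ : Equiv.Perm (Fin n)) :
    ∃ φ : unitInterval ≃ᵐ unitInterval, MeasurePreserving φ (volume : Measure unitInterval) volume ∧
      ∃ σ : Equiv.Perm ℤ, (∀ i : Fin n, σ (i : ℕ) = ((τ i : ℕ) : ℤ)) ∧
        ∀ x : unitInterval, ⌊(n : ℝ) * (φ x : ℝ)⌋ = σ ⌊(n : ℝ) * (x : ℝ)⌋ := by
  let σ : Equiv.Perm ℤ := τ.extendDomain (finEquivZ n)
  have hσ : ∀ i : Fin n, σ (i : ℕ) = ((τ i : ℕ) : ℤ) := fun i =>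
    Equiv.Perm.extendDomain_apply_image τ (finEquivZ n) i
  have hσi : ∀ i : Fin n, σ⁻¹ (i : ℕ) = ((τ⁻¹ i : ℕ) : ℤ) := by
    intro i
    rw [Equiv.Perm.inv_eq_iff_eq, hσ]; simp
  have aux : ∀ (s : Equiv.Perm ℤ) (t : Equiv.Perm (Fin n)),
      (∀ i : Fin n, s (i : ℕ) = ((t i : ℕ) : ℤ)) →
      ∀ i : ℤ, 0 ≤ i → i < n → 0 ≤ s i ∧ s i < n := by
    intro s t h i h0 h1
    have := h ⟨i.toNat, by omega⟩
    simp only [Int.toNat_of_nonneg h0] at this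
    rw [this]
    have := (t ⟨i.toNat, by omega⟩).2
    omega
  have hσn : σ n = n := by
    apply Equiv.Perm.extendDomain_apply_not_subtype
    omega
  refine ⟨iexI hn σ (aux _ _ hσ) (aux _ _ hσi) hσn, iexI_mp hn σ _ _ _, σ, hσ, fun x => ?_⟩
  exact iex_floor hn σ x

lemma matching {k : ℕ} (c c' : unitInterval → ℕ) (hc : Measurable c) (hck : ∀ x, c x < k)
    (hc' : Measurable c') (hck' : ∀ x, c' x < k) (ε η : ℝ) (hη : 0 < η)
    (h : ∀ a < k, |volume.real {x | c x = a} - volume.real {x | c' x = a}| ≤ ε) :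
    ∃ φ : unitInterval ≃ᵐ unitInterval,
      MeasurePreserving φ (volume : Measure unitInterval) volume ∧
      volume.real {x | c x ≠ c' (φ x)} ≤ k * ε + η := by
  let η' := η / (2 * k + 2)
  have hη' : 0 < η' := by positivity
  have hηη : (2 * k + 2) * η' = η := by simp only [η']; field_simp
  obtain ⟨n₁, hn₁, d₁, hd₁, h₁⟩ := step_approx c hc hck η' hη'
  obtain ⟨n₂, hn₂, d₂, hd₂, h₂⟩ := step_approx c' hc' hck' η' hη'
  let n := n₁ * n₂
  have hn : 0 < n := Nat.mul_pos hn₁ hn₂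
  have hn' : (0 : ℝ) < n := by positivity
  let e₁ : ℤ → ℕ := fun z => d₁ (z / n₂)
  let e₂ : ℤ → ℕ := fun z => d₂ (z / n₁)
  have h₁' : volume.real {x : unitInterval | c x ≠ e₁ ⌊(n : ℝ) * (x : ℝ)⌋} ≤ η' := by
    simp only [e₁, n]
    simp_rw [← floor_refine n₁ n₂ hn₂]
    exact h₁
  have h₂' : volume.real {x : unitInterval | c' x ≠ e₂ ⌊(n : ℝ) * (x : ℝ)⌋} ≤ η' := by
    simp only [e₂, n]
    simp_rw [mul_comm n₁ n₂, ← floor_refine n₂ n₁ hn₁]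
    exact h₂
  obtain ⟨τ, hτ⟩ := perm_match n k (fun i => e₁ (i : ℕ)) (fun i => e₂ (i : ℕ)) (fun i => hd₁ _)
  obtain ⟨φ, hφ, σ, hστ, hφσ⟩ := exists_iexI hn τ
  refine ⟨φ, hφ, ?_⟩
  have hdiff : ∀ (f g : unitInterval → ℕ) (a : ℕ), volume.real {x | f x = a} ≤
      volume.real {x | g x = a} + volume.real {x | f x ≠ g x} := by
    intro f g a
    refine le_trans (measureReal_mono ?_ (measure_ne_top _ _)) (measureReal_union_le _ _)
    intro x hx
    by_cases hh : f x = g x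
    · left; exact hh.symm.trans hx
    · right; exact hh
  have hsym : ∀ f g : unitInterval → ℕ, {x | f x ≠ g x} = {x | g x ≠ f x} := by
    intro f g; ext x; exact ne_comm
  have hterm : ∀ a < k, |((Finset.univ.filter fun i : Fin n => e₁ (i : ℕ) = a).card : ℝ) -
      ((Finset.univ.filter fun i : Fin n => e₂ (i : ℕ) = a).card : ℝ)| ≤ n * (ε + 2 * η') := by
    intro a ha
    have v₁ := vol_cells hn (fun z => e₁ z = a)
    have v₂ := vol_cells hn (fun z => e₂ z = a)
    rw [eq_div_iff hn'.ne'] at v₁ v₂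
    rw [← v₁, ← v₂, ← sub_mul, abs_mul, abs_of_pos hn', mul_comm]
    gcongr
    have a1 := hdiff c (fun x => e₁ ⌊(n : ℝ) * (x : ℝ)⌋) a
    have a2 := hdiff (fun x => e₁ ⌊(n : ℝ) * (x : ℝ)⌋) c a
    have a3 := hdiff c' (fun x => e₂ ⌊(n : ℝ) * (x : ℝ)⌋) a
    have a4 := hdiff (fun x => e₂ ⌊(n : ℝ) * (x : ℝ)⌋) c' a
    rw [hsym] at a2 a4
    have a5 := abs_le.1 (h a ha)
    rw [abs_le]
    constructor <;> linarith [a5.1, a5.2]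
  have hmis : volume.real {x : unitInterval | e₁ ⌊(n : ℝ) * (x : ℝ)⌋ ≠
      e₂ ⌊(n : ℝ) * (φ x : ℝ)⌋} ≤ k * (ε + 2 * η') := by
    simp_rw [hφσ]
    have := vol_cells hn (fun z => e₁ z ≠ e₂ (σ z))
    rw [this, div_le_iff₀ hn']
    simp_rw [hστ]
    refine hτ.trans ?_
    calc _ ≤ ∑ a ∈ Finset.range k, n * (ε + 2 * η') :=
          Finset.sum_le_sum fun a ha => hterm a (Finset.mem_range.1 ha)
      _ = _ := by simp; ring
  have h₃ : volume.real {x : unitInterval | c' (φ x) ≠ e₂ ⌊(n : ℝ) * (φ x : ℝ)⌋} ≤ η' := by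
    have hms : MeasurableSet {x : unitInterval | c' x ≠ e₂ ⌊(n : ℝ) * (x : ℝ)⌋} := by
      have : Measurable fun x : unitInterval => e₂ ⌊(n : ℝ) * (x : ℝ)⌋ :=
        (Measurable.of_discrete (f := e₂)).comp (meas_floor n)
      exact (measurableSet_eq_fun hc' this).compl
    have := hφ.measure_preimage hms.nullMeasurableSet
    rw [measureReal_def] at h₂' ⊢
    rw [← this] at h₂'
    exact h₂'
  calc volume.real {x | c x ≠ c' (φ x)}
      ≤ volume.real (({x : unitInterval | c x ≠ e₁ ⌊(n : ℝ) * (x : ℝ)⌋} ∪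
        {x : unitInterval | c' (φ x) ≠ e₂ ⌊(n : ℝ) * (φ x : ℝ)⌋}) ∪
        {x : unitInterval | e₁ ⌊(n : ℝ) * (x : ℝ)⌋ ≠ e₂ ⌊(n : ℝ) * (φ x : ℝ)⌋}) := by
        refine measureReal_mono ?_ (measure_ne_top _ _)
        intro x hx
        by_contra hcon
        simp only [mem_union, mem_ofPred_eq, not_or, not_not] at hcon
        obtain ⟨⟨b1, b2⟩, b3⟩ := hcon
        exact hx (b1.trans (b3.trans b2.symm))
    _ ≤ (η' + η') + k * (ε + 2 * η') := by
        refine (measureReal_union_le _ _).trans (add_le_add ?_ hmis)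
        exact (measureReal_union_le _ _).trans (add_le_add h₁' h₃)
    _ = k * ε + η := by rw [← hηη]; ring

/-! ### The base measure, graphon integrals, and the easy direction -/

/-- The product measure on `[0,1] × [0,1] × Ω₂`. -/
abbrev muX {Ω₂ : Type*} [MeasurableSpace Ω₂] (P₂ : Measure Ω₂) :
    Measure (unitInterval × unitInterval × Ω₂) :=
  (volume : Measure unitInterval).prod ((volume : Measure unitInterval).prod P₂)

lemma measurable_assocGraphon {Ω₂ : Type*} [MeasurableSpace Ω₂] (P₂ : Measure Ω₂)
    [IsProbabilityMeasure P₂] (W : unitInterval × unitInterval × Ω₂ → ℝ) (hW : Measurable W) :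
    Measurable (assocGraphon P₂ W) := by
  refine Measure.measurable_of_measurable_coe _ fun s hs => ?_
  have h1 : ∀ x : unitInterval × unitInterval, Measurable fun ω => W (x.1, x.2, ω) := fun x =>
    hW.comp (by fun_prop)
  have h2 : ∀ x : unitInterval × unitInterval, assocGraphon P₂ W x s =
      P₂ (Prod.mk x ⁻¹' {z : (unitInterval × unitInterval) × Ω₂ | W (z.1.1, z.1.2, z.2) ∈ s}) := by
    intro x
    rw [assocGraphon, Measure.map_apply (h1 x) hs]
    rfl
  simp_rw [h2]
  refine measurable_measure_prodMk_left ?_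
  have h3 : Measurable fun z : (unitInterval × unitInterval) × Ω₂ => W (z.1.1, z.1.2, z.2) :=
    hW.comp (by fun_prop)
  exact h3 hs

lemma graphonInt_apply {Ω₂ : Type*} [MeasurableSpace Ω₂] (P₂ : Measure Ω₂)
    [IsProbabilityMeasure P₂] (W : unitInterval × unitInterval × Ω₂ → ℝ) (hW : Measurable W)
    {S T : Set unitInterval} (hS : MeasurableSet S) (hT : MeasurableSet T)
    {B : Set ℝ} (hB : MeasurableSet B) :
    graphonInt (assocGraphon P₂ W) (S ×ˢ T) B =
      muX P₂ {x | x.1 ∈ S ∧ x.2.1 ∈ T ∧ W x ∈ B} := by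
  have h1 : ∀ x : unitInterval × unitInterval, Measurable fun ω => W (x.1, x.2, ω) := fun x =>
    hW.comp (by fun_prop)
  have hE : MeasurableSet {x : unitInterval × unitInterval × Ω₂ |
      x.1 ∈ S ∧ x.2.1 ∈ T ∧ W x ∈ B} :=
    (measurable_fst hS).inter (((measurable_fst.comp measurable_snd) hT).inter (hW hB))
  have hp := measurePreserving_prodAssoc (volume : Measure unitInterval)
    (volume : Measure unitInterval) P₂
  rw [graphonInt, Measure.bind_apply hB (measurable_assocGraphon P₂ W hW).aemeasurable,
    ← hp.measure_preimage hE.nullMeasurableSet, Measure.prod_apply (hp.measurable hE),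
    ← lintegral_indicator (hS.prod hT)]
  refine lintegral_congr fun x => ?_
  by_cases hx : x ∈ S ×ˢ T
  · rw [indicator_of_mem hx, assocGraphon, Measure.map_apply (h1 x) hB]
    congr 1
    ext ω
    simp [MeasurableEquiv.prodAssoc, hx.1, hx.2]
  · rw [indicator_of_notMem hx]
    symm
    convert measure_empty (μ := P₂)
    ext ω
    simp only [MeasurableEquiv.prodAssoc, mem_preimage, mem_ofPred_eq, mem_empty_iff_false, iff_false]
    rintro ⟨h2, h3, -⟩
    exact hx ⟨h2, h3⟩

lemma sVec_measurable {Ω₁ Ω₂ : Type*} [MeasurableSpace Ω₁] [MeasurableSpace Ω₂] {k : ℕ}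
    {f : Fin k → Ω₁ → ℝ} (hf : ∀ i, Measurable (f i)) {W : Ω₁ × Ω₁ × Ω₂ → ℝ}
    (hW : Measurable W) : Measurable (sVec k f W) := by
  refine (WithLp.measurable_toLp 2 (Fin (2 * k + 1) → ℝ)).comp (measurable_pi_lambda _ fun i => ?_)
  by_cases h : (i : ℕ) < 2 * k
  · by_cases h2 : (i : ℕ) % 2 = 0
    · simp only [h, h2, dif_pos, if_pos]
      exact (hf _).comp measurable_fst
    · simp only [h, h2, dif_pos, if_false]
      exact (hf _).comp (measurable_fst.comp measurable_snd)
  · simp only [h, dif_neg, not_false_iff]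
    exact hW

lemma sVec_close {Ω₁ Ω₂ Ω₂' : Type*} {k : ℕ} (f g : Fin k → Ω₁ → ℝ)
    (W : Ω₁ × Ω₁ × Ω₂ → ℝ) (U : Ω₁ × Ω₁ × Ω₂' → ℝ) (x : Ω₁ × Ω₁ × Ω₂) (y : Ω₁ × Ω₁ × Ω₂')
    (r : ℝ) (h1 : ∀ i, |f i x.1 - g i y.1| ≤ r) (h2 : ∀ i, |f i x.2.1 - g i y.2.1| ≤ r)
    (h3 : |W x - U y| ≤ r) : dist (sVec k f W x) (sVec k g U y) ≤ (2 * k + 1) * r := by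
  have hr : 0 ≤ r := (abs_nonneg _).trans h3
  rw [EuclideanSpace.dist_eq]
  apply Real.sqrt_le_iff.2 ⟨by positivity, ?_⟩
  have hi : ∀ i : Fin (2 * k + 1), dist (sVec k f W x i) (sVec k g U y i) ^ 2 ≤ r ^ 2 := by
    intro i
    have : dist (sVec k f W x i) (sVec k g U y i) ≤ r := by
      rw [Real.dist_eq]
      unfold sVec
      simp only [WithLp.equiv_symm_apply_ofLp]
      split_ifs
      · exact h1 _
      · exact h2 _
      · exact h3
    gcongr
  calc _ ≤ ∑ i : Fin (2 * k + 1), r ^ 2 := Finset.sum_le_sum fun i _ => hi i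
    _ = (2 * k + 1) * r ^ 2 := by simp
    _ ≤ ((2 * k + 1) * r) ^ 2 := by
      have : (0 : ℝ) ≤ k := by positivity
      rw [mul_pow]
      gcongr
      nlinarith

lemma lp_le {X : Type*} [MeasurableSpace X] [PseudoEMetricSpace X] (μ ν : Measure X)
    (ε : ℝ) (hε : 0 < ε)
    (h1 : ∀ B, MeasurableSet B → μ B ≤ ν (Metric.thickening ε B) + ENNReal.ofReal ε)
    (h2 : ∀ B, MeasurableSet B → ν B ≤ μ (Metric.thickening ε B) + ENNReal.ofReal ε) :
    levyProkhorovEDist μ ν ≤ ENNReal.ofReal ε := by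
  refine sInf_le fun B hB => ?_
  rw [ENNReal.toReal_ofReal hε.le]
  exact ⟨h1 B hB, h2 B hB⟩

lemma S_close_one {Ω₂ : Type*} [MeasurableSpace Ω₂] (P₂ : Measure Ω₂)
    [IsProbabilityMeasure P₂] (k : ℕ) (ε : ℝ) (hε : 0 < ε) :
    ∃ δ > (0 : ℝ), ∀ W U : unitInterval × unitInterval × Ω₂ → ℝ, Measurable W → Measurable U →
      (∀ S T, MeasurableSet S → MeasurableSet T →
        levyProkhorovEDist (graphonInt (assocGraphon P₂ W) (S ×ˢ T))
          (graphonInt (assocGraphon P₂ U) (S ×ˢ T)) < ENNReal.ofReal δ) →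
      ∀ f : Fin k → unitInterval → ℝ, (∀ i, Measurable (f i)) → (∀ i x, f i x ∈ Icc (-1 : ℝ) 1) →
      ∀ B, MeasurableSet B → Smeasure volume P₂ f W B ≤
        Smeasure volume P₂ f U (Metric.thickening ε B) + ENNReal.ofReal ε := by
  let η : ℝ := ε / (4 * (2 * k + 1))
  have hη : 0 < η := by positivity
  have hηe : (2 * k + 1) * (2 * η) < ε := by
    have : (2 * (k : ℝ) + 1) * (2 * η) = ε / 2 := by simp only [η]; field_simp; ring
    rw [this]; linarith
  obtain ⟨M, hM⟩ := exists_nat_gt (1 / η + 1)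
  let 𝒞 : Finset (Fin k → ℤ) := Fintype.piFinset fun _ => Finset.Icc (-(M : ℤ)) M
  let N : ℕ := (𝒞 ×ˢ 𝒞).card
  let δ : ℝ := min η (ε / (N + 1))
  have hδ : 0 < δ := lt_min hη (by positivity)
  refine ⟨δ, hδ, ?_⟩
  intro W U hW hU hWU f hf hf1 B hB
  let c : unitInterval → (Fin k → ℤ) := fun x i => ⌊f i x / η⌋
  have hc : Measurable c := measurable_pi_lambda _ fun i =>
    Int.measurable_floor.comp ((hf i).div_const η)
  have hc𝒞 : ∀ x, c x ∈ 𝒞 := by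
    intro x
    simp only [𝒞, Fintype.mem_piFinset, Finset.mem_Icc]
    intro i
    have h1 : -(1 / η) ≤ f i x / η := by rw [← neg_div]; gcongr; exact (hf1 i x).1
    have h2 : f i x / η ≤ 1 / η := by gcongr; exact (hf1 i x).2
    constructor
    · rw [Int.le_floor]; push_cast; linarith
    · have : (⌊f i x / η⌋ : ℝ) ≤ M := (Int.floor_le _).trans (by linarith)
      exact_mod_cast this
  have hcc : ∀ x y, c x = c y → ∀ i, |f i x - f i y| ≤ η := by
    intro x y hxy i
    have h1 : ⌊f i x / η⌋ = ⌊f i y / η⌋ := congrFun hxy i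
    have h2 := Int.abs_sub_lt_one_of_floor_eq_floor h1
    rw [← sub_div, abs_div, abs_of_pos hη, div_lt_one hη] at h2
    exact h2.le
  let D : (Fin k → ℤ) × (Fin k → ℤ) → Set ℝ := fun p =>
    {w | ∃ x : unitInterval × unitInterval × Ω₂, c x.1 = p.1 ∧ c x.2.1 = p.2 ∧
      sVec k f W x ∈ B ∧ |w - W x| < η}
  have hD : ∀ p, MeasurableSet (D p) := by
    intro p
    have : D p = ⋃ x ∈ {x : unitInterval × unitInterval × Ω₂ | c x.1 = p.1 ∧ c x.2.1 = p.2 ∧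
      sVec k f W x ∈ B}, Metric.ball (W x) η := by
      ext w
      simp [D, Real.dist_eq, and_assoc]
    rw [this]
    exact (isOpen_biUnion fun x _ => Metric.isOpen_ball).measurableSet
  have hcp : ∀ a, MeasurableSet {x | c x = a} := fun a => hc (measurableSet_singleton a)
  rw [Smeasure, Smeasure, Measure.map_apply (sVec_measurable hf hW) hB,
    Measure.map_apply (sVec_measurable hf hU) Metric.isOpen_thickening.measurableSet]
  have step1 : sVec k f W ⁻¹' B ⊆ ⋃ p ∈ 𝒞 ×ˢ 𝒞,
      {x : unitInterval × unitInterval × Ω₂ | x.1 ∈ {x | c x = p.1} ∧ x.2.1 ∈ {x | c x = p.2} ∧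
        W x ∈ D p} := by
    intro x hx
    simp only [mem_iUnion, exists_prop]
    refine ⟨(c x.1, c x.2.1), Finset.mem_product.2 ⟨hc𝒞 _, hc𝒞 _⟩, rfl, rfl, x, rfl, rfl, hx, ?_⟩
    simpa using hη
  have step2 : (⋃ p ∈ 𝒞 ×ˢ 𝒞,
      {x : unitInterval × unitInterval × Ω₂ | x.1 ∈ {x | c x = p.1} ∧ x.2.1 ∈ {x | c x = p.2} ∧
        U x ∈ Metric.thickening δ (D p)}) ⊆ sVec k f U ⁻¹' Metric.thickening ε B := by
    intro y hy
    simp only [mem_iUnion, exists_prop] at hy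
    obtain ⟨p, -, hy1, hy2, hy3⟩ := hy
    obtain ⟨w, ⟨x, hx1, hx2, hxB, hxw⟩, hw⟩ := Metric.mem_thickening_iff.1 hy3
    refine Metric.mem_thickening_iff.2 ⟨_, hxB, lt_of_le_of_lt ?_ hηe⟩
    rw [Real.dist_eq] at hw
    refine sVec_close f f U W y x (2 * η) (fun i => ?_) (fun i => ?_) ?_
    · exact (hcc _ _ (Eq.trans hy1 hx1.symm) i).trans (by linarith)
    · exact (hcc _ _ (Eq.trans hy2 hx2.symm) i).trans (by linarith)
    · have h1 : δ ≤ η := min_le_left _ _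
      calc |U y - W x| = |(U y - w) + (w - W x)| := by ring_nf
        _ ≤ |U y - w| + |w - W x| := abs_add_le _ _
        _ ≤ 2 * η := by linarith
  calc muX P₂ (sVec k f W ⁻¹' B)
      ≤ ∑ p ∈ 𝒞 ×ˢ 𝒞, muX P₂ {x : unitInterval × unitInterval × Ω₂ |
        x.1 ∈ {x | c x = p.1} ∧ x.2.1 ∈ {x | c x = p.2} ∧ W x ∈ D p} :=
        (measure_mono step1).trans (measure_biUnion_finset_le _ _)
    _ ≤ ∑ p ∈ 𝒞 ×ˢ 𝒞, (muX P₂ {x : unitInterval × unitInterval × Ω₂ |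
        x.1 ∈ {x | c x = p.1} ∧ x.2.1 ∈ {x | c x = p.2} ∧ U x ∈ Metric.thickening δ (D p)} +
        ENNReal.ofReal δ) := by
        refine Finset.sum_le_sum fun p _ => ?_
        rw [← graphonInt_apply P₂ W hW (hcp _) (hcp _) (hD p), ← graphonInt_apply P₂ U hU (hcp _)
          (hcp _) Metric.isOpen_thickening.measurableSet]
        have := left_measure_le_of_levyProkhorovEDist_lt (hWU _ _ (hcp p.1) (hcp p.2)) (hD p)
        rwa [ENNReal.toReal_ofReal hδ.le] at this
    _ = muX P₂ (⋃ p ∈ 𝒞 ×ˢ 𝒞, {x : unitInterval × unitInterval × Ω₂ |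
        x.1 ∈ {x | c x = p.1} ∧ x.2.1 ∈ {x | c x = p.2} ∧ U x ∈ Metric.thickening δ (D p)}) +
        N * ENNReal.ofReal δ := by
        rw [Finset.sum_add_distrib, measure_biUnion_finset]
        · simp [N]
        · intro p _ q _ hpq
          rw [Function.onFun, Set.disjoint_left]
          rintro x ⟨h1, h2, -⟩ ⟨h3, h4, -⟩
          exact hpq (Prod.ext (Eq.trans (Eq.symm h1) h3) (Eq.trans (Eq.symm h2) h4))
        · intro p _
          exact (measurable_fst (hcp _)).inter (((measurable_fst.comp measurable_snd) (hcp _)).inter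
            (hU Metric.isOpen_thickening.measurableSet))
    _ ≤ muX P₂ (sVec k f U ⁻¹' Metric.thickening ε B) + ENNReal.ofReal ε := by
        refine add_le_add (measure_mono step2) ?_
        have : (N : ℝ≥0∞) = ENNReal.ofReal N := by simp
        rw [this, ← ENNReal.ofReal_mul (by positivity)]
        apply ENNReal.ofReal_le_ofReal
        have h1 : δ ≤ ε / (N + 1) := min_le_right _ _
        calc (N : ℝ) * δ ≤ N * (ε / (N + 1)) := by gcongr
          _ ≤ ε := by
            rw [mul_div_assoc', div_le_iff₀ (by positivity)]
            nlinarith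

/-! ### Profiles and `dM` -/

lemma S_close {Ω₂ : Type*} [MeasurableSpace Ω₂] (P₂ : Measure Ω₂)
    [IsProbabilityMeasure P₂] (k : ℕ) (ε : ℝ) (hε : 0 < ε) :
    ∃ δ > (0 : ℝ), ∀ W U : unitInterval × unitInterval × Ω₂ → ℝ, Measurable W → Measurable U →
      (∀ S T, MeasurableSet S → MeasurableSet T →
        levyProkhorovEDist (graphonInt (assocGraphon P₂ W) (S ×ˢ T))
          (graphonInt (assocGraphon P₂ U) (S ×ˢ T)) < ENNReal.ofReal δ) →
      ∀ f : Fin k → unitInterval → ℝ, (∀ i, Measurable (f i)) → (∀ i x, f i x ∈ Icc (-1 : ℝ) 1) →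
      levyProkhorovEDist (Smeasure volume P₂ f W) (Smeasure volume P₂ f U) ≤ ENNReal.ofReal ε := by
  obtain ⟨δ, hδ, h⟩ := S_close_one P₂ k ε hε
  refine ⟨δ, hδ, fun W U hW hU hWU f hf hf1 => lp_le _ _ ε hε ?_ ?_⟩
  · exact h W U hW hU hWU f hf hf1
  · refine h U W hU hW (fun S T hS hT => ?_) f hf hf1
    rw [levyProkhorovEDist_comm]
    exact hWU S T hS hT

/-- Relabelling of a P-variable. -/
def relabel {Ω₂ : Type*} (φ : unitInterval → unitInterval)
    (W : unitInterval × unitInterval × Ω₂ → ℝ) : unitInterval × unitInterval × Ω₂ → ℝ :=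
  fun x => W (φ x.1, φ x.2.1, x.2.2)

lemma relabel_mp {Ω₂ : Type*} [MeasurableSpace Ω₂] (P₂ : Measure Ω₂) [IsProbabilityMeasure P₂]
    {φ : unitInterval → unitInterval}
    (hφ : MeasurePreserving φ (volume : Measure unitInterval) volume) :
    MeasurePreserving (fun x : unitInterval × unitInterval × Ω₂ => (φ x.1, φ x.2.1, x.2.2))
      (muX P₂) (muX P₂) :=
  hφ.prod (hφ.prod (MeasurePreserving.id P₂))

lemma relabel_measurable {Ω₂ : Type*} [MeasurableSpace Ω₂] {φ : unitInterval → unitInterval}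
    (hφ : Measurable φ) {W : unitInterval × unitInterval × Ω₂ → ℝ} (hW : Measurable W) :
    Measurable (relabel φ W) := by
  unfold relabel
  exact hW.comp (by fun_prop)

lemma Smeasure_relabel {Ω₂ : Type*} [MeasurableSpace Ω₂] (P₂ : Measure Ω₂)
    [IsProbabilityMeasure P₂] {φ : unitInterval → unitInterval}
    (hφ : MeasurePreserving φ (volume : Measure unitInterval) volume)
    {W : unitInterval × unitInterval × Ω₂ → ℝ} (hW : Measurable W) {k : ℕ}
    {f : Fin k → unitInterval → ℝ} (hf : ∀ i, Measurable (f i)) :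
    Smeasure volume P₂ (fun i x => f i (φ x)) (relabel φ W) = Smeasure volume P₂ f W := by
  have e := congrArg (Measure.map (sVec k f W)) (relabel_mp P₂ hφ).map_eq
  rw [Measure.map_map (sVec_measurable hf hW) (relabel_mp P₂ hφ).measurable] at e
  exact e

lemma dHLP_nonneg {X : Type*} [MeasurableSpace X] [PseudoEMetricSpace X]
    (A B : Set (Measure X)) : 0 ≤ dHLP A B := ENNReal.toReal_nonneg

lemma graphonInt_univ_le {Ω₂ : Type*} [MeasurableSpace Ω₂] (P₂ : Measure Ω₂)
    [IsProbabilityMeasure P₂] (W : unitInterval × unitInterval × Ω₂ → ℝ) (hW : Measurable W)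
    {S T : Set unitInterval} (hS : MeasurableSet S) (hT : MeasurableSet T) :
    graphonInt (assocGraphon P₂ W) (S ×ˢ T) univ ≤ 1 := by
  rw [graphonInt_apply P₂ W hW hS hT MeasurableSet.univ]
  exact prob_le_one

lemma lp_graphon_le_one {Ω₂ : Type*} [MeasurableSpace Ω₂] (P₂ : Measure Ω₂)
    [IsProbabilityMeasure P₂] (W U : unitInterval × unitInterval × Ω₂ → ℝ) (hW : Measurable W)
    (hU : Measurable U) {S T : Set unitInterval} (hS : MeasurableSet S) (hT : MeasurableSet T) :
    levyProkhorovEDist (graphonInt (assocGraphon P₂ W) (S ×ˢ T))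
          (graphonInt (assocGraphon P₂ U) (S ×ˢ T)) ≤ 1 :=
  (levyProkhorovEDist_le_max_measure_univ _ _).trans
    (max_le (graphonInt_univ_le P₂ W hW hS hT) (graphonInt_univ_le P₂ U hU hS hT))

lemma exists_phi_of_unlab {Ω₂ : Type*} [MeasurableSpace Ω₂] (P₂ : Measure Ω₂)
    [IsProbabilityMeasure P₂] (W U : unitInterval × unitInterval × Ω₂ → ℝ) (hW : Measurable W)
    (hU : Measurable U) (δ : ℝ)
    (h : unlabCutDist (assocGraphon P₂ W) (assocGraphon P₂ U) < δ) :
    ∃ φ : unitInterval ≃ᵐ unitInterval,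
      MeasurePreserving φ (volume : Measure unitInterval) volume ∧
      ∀ S T, MeasurableSet S → MeasurableSet T →
        levyProkhorovEDist (graphonInt (assocGraphon P₂ W) (S ×ˢ T))
          (graphonInt (assocGraphon P₂ (relabel φ U)) (S ×ˢ T)) < ENNReal.ofReal δ := by
  haveI : Nonempty {φ : unitInterval ≃ᵐ unitInterval //
          MeasurePreserving φ (volume : Measure unitInterval) volume} :=
    ⟨⟨MeasurableEquiv.refl _, MeasurePreserving.id _⟩⟩
  obtain ⟨⟨φ, hφ⟩, h1⟩ := exists_lt_of_ciInf_lt h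
  refine ⟨φ, hφ, fun S T hS hT => ?_⟩
  have hU' := relabel_measurable hφ.measurable hU
  have hle : levyProkhorovDist (graphonInt (assocGraphon P₂ W) (S ×ˢ T))
      (graphonInt (assocGraphon P₂ (relabel φ U)) (S ×ˢ T)) < δ := by
    refine lt_of_le_of_lt ?_ h1
    refine le_ciSup (f := fun p : {S : Set unitInterval // MeasurableSet S} ×
        {T : Set unitInterval // MeasurableSet T} =>
        levyProkhorovDist (graphonInt (assocGraphon P₂ W) (p.1.1 ×ˢ p.2.1))
      (graphonInt (assocGraphon P₂ (relabel φ U)) (p.1.1 ×ˢ p.2.1))) ?_ ⟨⟨S, hS⟩, ⟨T, hT⟩⟩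
    refine ⟨1, ?_⟩
    rintro _ ⟨p, rfl⟩
    exact ENNReal.toReal_le_of_le_ofReal zero_le_one
      (by simpa using lp_graphon_le_one P₂ W _ hW hU' p.1.2 p.2.2)
  have hfin := lp_graphon_le_one P₂ W _ hW hU' hS hT
  rw [levyProkhorovDist] at hle
  exact (ENNReal.lt_ofReal_iff_toReal_lt (ne_top_of_le_ne_top ENNReal.one_ne_top hfin)).2 hle

lemma eHaus_le_of_unlab {Ω₂ : Type*} [MeasurableSpace Ω₂] (P₂ : Measure Ω₂)
    [IsProbabilityMeasure P₂] (k : ℕ) (ε : ℝ) (hε : 0 < ε) :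
    ∃ δ > (0 : ℝ), ∀ W U : unitInterval × unitInterval × Ω₂ → ℝ, Measurable W → Measurable U →
      unlabCutDist (assocGraphon P₂ W) (assocGraphon P₂ U) < δ →
      eHausLP (SkSet volume P₂ k W) (SkSet volume P₂ k U) ≤ ENNReal.ofReal ε := by
  obtain ⟨δ, hδ, h⟩ := S_close P₂ k ε hε
  refine ⟨δ, hδ, fun W U hW hU hWU => ?_⟩
  obtain ⟨φ, hφ, hL⟩ := exists_phi_of_unlab P₂ W U hW hU δ hWU
  have h' := h W (relabel φ U) hW (relabel_measurable hφ.measurable hU) hL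
  refine max_le (iSup₂_le ?_) (iSup₂_le ?_)
  · rintro _ ⟨f, hf, hf1, rfl⟩
    have hg : ∀ i, Measurable fun x => f i (φ.symm x) := fun i => (hf i).comp φ.symm.measurable
    refine iInf₂_le_of_le (Smeasure volume P₂ (fun i x => f i (φ.symm x)) U)
      ⟨_, hg, fun i x => hf1 _ _, rfl⟩ ?_
    have e := Smeasure_relabel P₂ hφ hU hg
    simp only [MeasurableEquiv.symm_apply_apply] at e
    rw [← e]
    exact h' f hf hf1
  · rintro _ ⟨g, hg, hg1, rfl⟩
    have hf : ∀ i, Measurable fun x => g i (φ x) := fun i => (hg i).comp φ.measurable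
    refine iInf₂_le_of_le (Smeasure volume P₂ (fun i x => g i (φ x)) W)
      ⟨_, hf, fun i x => hg1 _ _, rfl⟩ ?_
    rw [← Smeasure_relabel P₂ hφ hU hg]
    exact h' _ hf fun i x => hg1 _ _

lemma eHaus_le_one {Ω₂ : Type*} [MeasurableSpace Ω₂] (P₂ : Measure Ω₂)
    [IsProbabilityMeasure P₂] (k : ℕ) (W U : unitInterval × unitInterval × Ω₂ → ℝ) :
    eHausLP (SkSet volume P₂ k W) (SkSet volume P₂ k U) ≤ 1 := by
  have hprob : ∀ (f : Fin k → unitInterval → ℝ) (W : unitInterval × unitInterval × Ω₂ → ℝ),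
      Smeasure volume P₂ f W univ ≤ 1 := by
    intro f W
    rw [Smeasure]
    by_cases h : AEMeasurable (sVec k f W) (muX P₂)
    · rw [Measure.map_apply_of_aemeasurable h MeasurableSet.univ]
      exact prob_le_one
    · rw [Measure.map_of_not_aemeasurable h]
      simp
  have h0 : ∀ W : unitInterval × unitInterval × Ω₂ → ℝ,
      Smeasure volume P₂ (fun _ _ => 0) W ∈ SkSet volume P₂ k W := fun W =>
    ⟨_, fun i => measurable_const, fun i x => by simp, rfl⟩
  refine max_le (iSup₂_le ?_) (iSup₂_le ?_)
  · rintro _ ⟨f, hf, hf1, rfl⟩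
    exact iInf₂_le_of_le _ (h0 U) ((levyProkhorovEDist_le_max_measure_univ _ _).trans
      (max_le (hprob _ _) (hprob _ _)))
  · rintro _ ⟨f, hf, hf1, rfl⟩
    exact iInf₂_le_of_le _ (h0 W) ((levyProkhorovEDist_le_max_measure_univ _ _).trans
      (max_le (hprob _ _) (hprob _ _)))

lemma dHLP_le_one {Ω₂ : Type*} [MeasurableSpace Ω₂] (P₂ : Measure Ω₂)
    [IsProbabilityMeasure P₂] (k : ℕ) (W U : unitInterval × unitInterval × Ω₂ → ℝ) :
    dHLP (SkSet volume P₂ k W) (SkSet volume P₂ k U) ≤ 1 :=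
  ENNReal.toReal_le_of_le_ofReal zero_le_one (by simpa using eHaus_le_one P₂ k W U)

lemma summable_half : Summable fun k : ℕ => (2 : ℝ)⁻¹ ^ (k + 1) := by
  have : Summable fun k : ℕ => (2 : ℝ)⁻¹ ^ k := summable_geometric_of_lt_one (by norm_num) (by norm_num)
  exact (summable_nat_add_iff 1).2 this

lemma dM_easy {Ω₂ : Type*} [MeasurableSpace Ω₂] (P₂ : Measure Ω₂) [IsProbabilityMeasure P₂]
    (W : ℕ → unitInterval × unitInterval × Ω₂ → ℝ) (hW : ∀ n, Measurable (W n))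
    (h : ∀ ε > (0 : ℝ), ∃ N : ℕ, ∀ m ≥ N, ∀ n ≥ N,
      unlabCutDist (assocGraphon P₂ (W m)) (assocGraphon P₂ (W n)) < ε) :
    ∀ ε > (0 : ℝ), ∃ N : ℕ, ∀ m ≥ N, ∀ n ≥ N,
      dM (PVar.ofUnitInterval P₂ (W m) (hW m))
         (PVar.ofUnitInterval P₂ (W n) (hW n)) < ε := by
  intro ε hε
  have key : Filter.Tendsto (fun p : ℕ × ℕ => ∑' k : ℕ, (2 : ℝ)⁻¹ ^ (k + 1) *
      dHLP (SkSet volume P₂ (k + 1) (W p.1)) (SkSet volume P₂ (k + 1) (W p.2))) Filter.atTop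
      (nhds (∑' _k : ℕ, (0 : ℝ))) := by
    refine tendsto_tsum_of_dominated_convergence summable_half (fun k => ?_) ?_
    · rw [← mul_zero ((2 : ℝ)⁻¹ ^ (k + 1))]
      refine Filter.Tendsto.const_mul _ ?_
      rw [Metric.tendsto_atTop]
      intro η hη
      obtain ⟨δ, hδ, h1⟩ := eHaus_le_of_unlab P₂ (k + 1) (η / 2) (by positivity)
      obtain ⟨N, hN⟩ := h δ hδ
      refine ⟨(N, N), fun p hp => ?_⟩
      have := h1 _ _ (hW p.1) (hW p.2) (hN p.1 hp.1 p.2 hp.2)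
      rw [Real.dist_eq, sub_zero, abs_of_nonneg (dHLP_nonneg _ _)]
      exact lt_of_le_of_lt (ENNReal.toReal_le_of_le_ofReal (by positivity) this) (by linarith)
    · refine Filter.Eventually.of_forall fun p k => ?_
      rw [Real.norm_eq_abs, abs_of_nonneg (mul_nonneg (by positivity) (dHLP_nonneg _ _))]
      exact mul_le_of_le_one_right (by positivity) (dHLP_le_one P₂ _ _ _)
  rw [tsum_zero, Metric.tendsto_atTop] at key
  obtain ⟨N, hN⟩ := key ε hε
  refine ⟨max N.1 N.2, fun m hm n hn => ?_⟩
  have := hN (m, n) ⟨(le_max_left _ _).trans hm, (le_max_right _ _).trans hn⟩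
  rw [Real.dist_eq, sub_zero] at this
  exact lt_of_le_of_lt (le_abs_self _) this

lemma exists_of_dM {Ω₂ : Type*} [MeasurableSpace Ω₂] (P₂ : Measure Ω₂) [IsProbabilityMeasure P₂]
    (W U : unitInterval × unitInterval × Ω₂ → ℝ) (hW : Measurable W) (hU : Measurable U)
    (δ : ℝ) (hδ : 0 < δ)
    (h : dM (PVar.ofUnitInterval P₂ W hW) (PVar.ofUnitInterval P₂ U hU) < δ / 2)
    (f : Fin 1 → unitInterval → ℝ) (hf : ∀ i, Measurable (f i))
    (hf1 : ∀ i x, f i x ∈ Icc (-1 : ℝ) 1) :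
    ∃ g : Fin 1 → unitInterval → ℝ, (∀ i, Measurable (g i)) ∧
      levyProkhorovEDist (Smeasure volume P₂ f W) (Smeasure volume P₂ g U) < ENNReal.ofReal δ := by
  have hnn : ∀ k : ℕ, 0 ≤ (2 : ℝ)⁻¹ ^ (k + 1) *
      dHLP (SkSet volume P₂ (k + 1) W) (SkSet volume P₂ (k + 1) U) := fun k =>
    mul_nonneg (by positivity) (dHLP_nonneg _ _)
  have hsum : Summable fun k : ℕ => (2 : ℝ)⁻¹ ^ (k + 1) *
      dHLP (SkSet volume P₂ (k + 1) W) (SkSet volume P₂ (k + 1) U) :=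
    Summable.of_nonneg_of_le hnn
      (fun k => mul_le_of_le_one_right (by positivity) (dHLP_le_one P₂ _ _ _)) summable_half
  have h1 : (2 : ℝ)⁻¹ ^ (0 + 1) * dHLP (SkSet volume P₂ (0 + 1) W) (SkSet volume P₂ (0 + 1) U) < δ / 2 :=
    lt_of_le_of_lt (hsum.le_tsum 0 fun k _ => hnn k) h
  have h2 : dHLP (SkSet volume P₂ 1 W) (SkSet volume P₂ 1 U) < δ := by
    simp only [zero_add, pow_one] at h1
    linarith
  have h3 : eHausLP (SkSet volume P₂ 1 W) (SkSet volume P₂ 1 U) < ENNReal.ofReal δ :=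
    (ENNReal.lt_ofReal_iff_toReal_lt
      (ne_top_of_le_ne_top ENNReal.one_ne_top (eHaus_le_one P₂ 1 W U))).2 h2
  have h4 : ⨅ ν ∈ SkSet volume P₂ 1 U, levyProkhorovEDist (Smeasure volume P₂ f W) ν <
      ENNReal.ofReal δ :=
    lt_of_le_of_lt (le_iSup₂ (f := fun μ (_ : μ ∈ SkSet volume P₂ 1 W) =>
      ⨅ ν ∈ SkSet volume P₂ 1 U, levyProkhorovEDist μ ν) (Smeasure volume P₂ f W)
      ⟨f, hf, hf1, rfl⟩) (lt_of_le_of_lt (le_max_left _ _) h3)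
  simp only [iInf_lt_iff] at h4
  obtain ⟨_, ⟨g, hg, -, rfl⟩, h5⟩ := h4
  exact ⟨g, hg, h5⟩

/-! ### Transfer of integrals between P-variables -/

lemma bdd_integrable {X : Type*} [MeasurableSpace X] {μ : Measure X} [IsFiniteMeasure μ]
    {G : X → ℝ} (hG : Measurable G) {M : ℝ} (hM : ∀ x, |G x| ≤ M) : Integrable G μ :=
  Integrable.of_bound hG.aestronglyMeasurable M (Filter.Eventually.of_forall hM)

lemma integral_compare_nonneg {X Y : Type*} [MeasurableSpace X] [MeasurableSpace Y]
    (μ : Measure X) (ν : Measure Y) [IsProbabilityMeasure μ] [IsProbabilityMeasure ν]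
    (G : X → ℝ) (G' : Y → ℝ) (hG : Measurable G) (hG' : Measurable G') (M ε δ : ℝ)
    (hM : 0 ≤ M) (hε : 0 ≤ ε) (h0 : ∀ x, 0 ≤ G x) (h1 : ∀ x, G x ≤ M) (h0' : ∀ x, 0 ≤ G' x)
    (h1' : ∀ x, G' x ≤ M)
    (h : ∀ t, μ.real {x | t ≤ G x} ≤ ν.real {x | t ≤ G' x + ε} + δ) :
    ∫ x, G x ∂μ ≤ ∫ x, G' x ∂ν + ε + M * δ := by
  have iG : Integrable G μ :=
    bdd_integrable hG (M := M) fun x => abs_le.2 ⟨by linarith [h0 x], h1 x⟩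
  have iG' : Integrable G' ν :=
    bdd_integrable hG' (M := M) fun x => abs_le.2 ⟨by linarith [h0' x], h1' x⟩
  have iG'' : Integrable (fun x => G' x + ε) ν := iG'.add (integrable_const _)
  have e1 := iG.integral_eq_integral_Ioc_meas_le (M := M)
    (Filter.Eventually.of_forall h0) (Filter.Eventually.of_forall h1)
  have e2 := iG''.integral_eq_integral_Ioc_meas_le (M := M + ε)
    (Filter.Eventually.of_forall fun x => add_nonneg (h0' x) hε)
    (Filter.Eventually.of_forall fun x => by linarith [h1' x])
  rw [integral_add iG' (integrable_const _)] at e2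
  simp only [integral_const, probReal_univ, one_smul] at e2
  have a1 : Antitone fun t : ℝ => μ.real {x | t ≤ G x} := fun s t hst =>
    measureReal_mono fun x (hx : t ≤ G x) => hst.trans hx
  have a2 : Antitone fun t : ℝ => ν.real {x | t ≤ G' x + ε} := fun s t hst =>
    measureReal_mono fun x (hx : t ≤ G' x + ε) => hst.trans hx
  have i1 : IntegrableOn (fun t : ℝ => μ.real {x | t ≤ G x}) (Ioc 0 M) :=
    ((a1.antitoneOn _).integrableOn_isCompact isCompact_Icc).mono_set Ioc_subset_Icc_self
  have i2 : IntegrableOn (fun t : ℝ => ν.real {x | t ≤ G' x + ε}) (Ioc 0 (M + ε)) :=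
    ((a2.antitoneOn _).integrableOn_isCompact isCompact_Icc).mono_set Ioc_subset_Icc_self
  have hsub : Ioc 0 M ⊆ Ioc 0 (M + ε) := Ioc_subset_Ioc_right (by linarith)
  have i2' := i2.mono_set hsub
  have i3 : IntegrableOn (fun _ : ℝ => δ) (Ioc 0 M) := integrableOn_const (by simp) (by simp)
  rw [e1, e2]
  calc ∫ t in Ioc 0 M, μ.real {x | t ≤ G x}
      ≤ ∫ t in Ioc 0 M, (ν.real {x | t ≤ G' x + ε} + δ) :=
        integral_mono i1 (i2'.add i3) fun t => h t
    _ = (∫ t in Ioc 0 M, ν.real {x | t ≤ G' x + ε}) + M * δ := by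
        rw [integral_add i2' i3]
        simp [hM]
    _ ≤ _ := by
        exact add_le_add_left (setIntegral_mono_set i2
          (Filter.Eventually.of_forall fun t => measureReal_nonneg) hsub.eventuallyLE) _

lemma integral_compare {X Y : Type*} [MeasurableSpace X] [MeasurableSpace Y]
    (μ : Measure X) (ν : Measure Y) [IsProbabilityMeasure μ] [IsProbabilityMeasure ν]
    (G : X → ℝ) (G' : Y → ℝ) (hG : Measurable G) (hG' : Measurable G') (M ε δ : ℝ)
    (hM : 0 ≤ M) (hε : 0 ≤ ε) (h1 : ∀ x, |G x| ≤ M) (h1' : ∀ x, |G' x| ≤ M)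
    (h : ∀ t, μ.real {x | t ≤ G x} ≤ ν.real {x | t ≤ G' x + ε} + δ) :
    ∫ x, G x ∂μ ≤ ∫ x, G' x ∂ν + ε + 2 * M * δ := by
  have := integral_compare_nonneg μ ν (fun x => G x + M) (fun x => G' x + M)
    (hG.add_const _) (hG'.add_const _) (2 * M) ε δ (by linarith) hε
    (fun x => by linarith [(abs_le.1 (h1 x)).1]) (fun x => by linarith [(abs_le.1 (h1 x)).2])
    (fun x => by linarith [(abs_le.1 (h1' x)).1]) (fun x => by linarith [(abs_le.1 (h1' x)).2])
    (fun t => by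
      have e1 : {x | t ≤ G x + M} = {x | t - M ≤ G x} := by
        ext x; simp only [mem_ofPred_eq]; constructor <;> intro h <;> linarith
      have e2 : {x | t ≤ G' x + M + ε} = {x | t - M ≤ G' x + ε} := by
        ext x; simp only [mem_ofPred_eq]; constructor <;> intro h <;> linarith
      rw [e1, e2]; exact h _)
  rw [integral_add (bdd_integrable hG h1) (integrable_const _),
    integral_add (bdd_integrable hG' h1') (integrable_const _)] at this
  simp only [integral_const, probReal_univ, one_smul] at this
  linarith

/-- Rounding to the grid `{0, 1/k, …, (k-1)/k}`. -/
def rnd (k : ℕ) (s : ℝ) : ℕ := min ⌊k * s + 1 / 2⌋₊ (k - 1)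

lemma rnd_lt {k : ℕ} (hk : 0 < k) (s : ℝ) : rnd k s < k := by
  unfold rnd
  have := min_le_right ⌊k * s + 1 / 2⌋₊ (k - 1)
  omega

lemma rnd_measurable (k : ℕ) : Measurable (rnd k) := by
  unfold rnd
  have : Measurable fun s : ℝ => ⌊k * s + 1 / 2⌋₊ := Nat.measurable_floor.comp (by fun_prop)
  exact this.min measurable_const

lemma rnd_eq {k i : ℕ} (hi : i < k) {s : ℝ} (hs : |s - i / k| < 1 / (2 * k)) : rnd k s = i := by
  have hk : (0 : ℝ) < k := by exact_mod_cast (Nat.zero_le i).trans_lt hi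
  have h1 : |k * s - i| < 1 / 2 := by
    have : (k : ℝ) * s - i = k * (s - i / k) := by field_simp
    rw [this, abs_mul, abs_of_pos hk]
    calc (k : ℝ) * |s - i / k| < k * (1 / (2 * k)) := by gcongr
      _ = 1 / 2 := by field_simp
  obtain ⟨h2, h3⟩ := abs_lt.1 h1
  have : ⌊k * s + 1 / 2⌋₊ = i := by
    rw [Nat.floor_eq_iff (by have : (0 : ℝ) ≤ i := Nat.cast_nonneg i; linarith)]
    constructor <;> linarith
  rw [rnd, this]
  omega

lemma coord_le {n : ℕ} (v w : RE n) (i : Fin n) : |v i - w i| ≤ dist v w := by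
  have := EuclideanSpace.norm_eq (v - w)
  rw [dist_eq_norm]
  exact PiLp.norm_apply_le (v - w) i

lemma transfer {Ω₂ : Type*} [MeasurableSpace Ω₂] (P₂ : Measure Ω₂) [IsProbabilityMeasure P₂]
    (W U : unitInterval × unitInterval × Ω₂ → ℝ) (hW : Measurable W) (hU : Measurable U)
    (k : ℕ) (hk : 0 < k) (δ : ℝ) (hδ : 0 < δ) (hδk : δ ≤ 1 / (2 * k))
    (h : dM (PVar.ofUnitInterval P₂ W hW) (PVar.ofUnitInterval P₂ U hU) < δ / 2)
    (c : unitInterval → ℕ) (hc : Measurable c) (hck : ∀ x, c x < k) :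
    ∃ c' : unitInterval → ℕ, Measurable c' ∧ (∀ x, c' x < k) ∧
      ∀ G : ℕ → ℕ → ℝ → ℝ, (∀ a b, Measurable (G a b)) → ∀ M ε : ℝ, 0 ≤ M → 0 ≤ ε →
        (∀ a b w, |G a b w| ≤ M) →
        (∀ a b w w', |w - w'| < δ → |G a b w - G a b w'| ≤ ε) →
        |∫ x, G (c x.1) (c x.2.1) (W x) ∂(muX P₂) - ∫ x, G (c' x.1) (c' x.2.1) (U x) ∂(muX P₂)|
          ≤ ε + 2 * M * δ := by
  have hk' : (0 : ℝ) < k := by exact_mod_cast hk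
  let f : Fin 1 → unitInterval → ℝ := fun _ x => (c x : ℝ) / k
  have hf : ∀ i, Measurable (f i) := fun i =>
    ((measurable_from_top (f := fun n : ℕ => (n : ℝ))).comp hc).div_const _
  have hf1 : ∀ i x, f i x ∈ Icc (-1 : ℝ) 1 := fun i x => by
    have h1 : (0 : ℝ) ≤ (c x : ℝ) / k := by positivity
    refine ⟨by show -1 ≤ (c x : ℝ) / k; linarith, ?_⟩
    show (c x : ℝ) / k ≤ 1
    rw [div_le_one hk']
    exact_mod_cast (hck x).le
  obtain ⟨g, hg, hLP⟩ := exists_of_dM P₂ W U hW hU δ hδ h f hf hf1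
  refine ⟨fun x => rnd k (g 0 x), (rnd_measurable k).comp (hg 0), fun x => rnd_lt hk _, ?_⟩
  intro G hG M ε hM hε hGM hGε
  have hGm : Measurable fun p : (ℕ × ℕ) × ℝ => G p.1.1 p.1.2 p.2 :=
    measurable_from_prod_countable_right fun p => hG p.1 p.2
  have hGv : Measurable fun v : RE (2 * 1 + 1) => G (rnd k (v 0)) (rnd k (v 1)) (v 2) := by
    have h3 : Measurable fun v : RE (2 * 1 + 1) => ((rnd k (v 0), rnd k (v 1)), v 2) :=
      (((rnd_measurable k).comp (by fun_prop)).prodMk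
        ((rnd_measurable k).comp (by fun_prop))).prodMk (by fun_prop)
    exact hGm.comp h3
  have e0 : ∀ (f : Fin 1 → unitInterval → ℝ) (W : unitInterval × unitInterval × Ω₂ → ℝ) x,
    sVec 1 f W x 0 = f 0 x.1 := fun f W x => by simp [sVec]
  have e1 : ∀ (f : Fin 1 → unitInterval → ℝ) (W : unitInterval × unitInterval × Ω₂ → ℝ) x,
    sVec 1 f W x 1 = f 0 x.2.1 := fun f W x => by simp [sVec]
  have e2 : ∀ (f : Fin 1 → unitInterval → ℝ) (W : unitInterval × unitInterval × Ω₂ → ℝ) x,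
    sVec 1 f W x 2 = W x := fun f W x => by simp [sVec]
  have hmf := sVec_measurable hf hW
  have hmg := sVec_measurable hg hU
  have hrf : ∀ x (s : ℝ), |s - f 0 x| < δ → rnd k s = c x := fun x s hs =>
    rnd_eq (hck x) (hs.trans_le hδk)
  have hrf0 : ∀ x, rnd k (f 0 x) = c x := fun x => hrf x _ (by simpa using hδ)
  have hmGW : Measurable fun x : unitInterval × unitInterval × Ω₂ =>
      G (c x.1) (c x.2.1) (W x) := by
    have h3 : Measurable fun x : unitInterval × unitInterval × Ω₂ => ((c x.1, c x.2.1), W x) := by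
      fun_prop
    exact hGm.comp h3
  have hmGU : Measurable fun x : unitInterval × unitInterval × Ω₂ =>
      G (rnd k (g 0 x.1)) (rnd k (g 0 x.2.1)) (U x) := by
    have := hGv.comp hmg
    simpa only [Function.comp_def, e0, e1, e2] using this
  have A := integral_compare (muX P₂) (muX P₂) _ _ hmGW hmGU M ε δ hM hε
    (fun x => hGM _ _ _) (fun x => hGM _ _ _) (fun t => by
      let B : Set (RE (2 * 1 + 1)) := {v | v 0 = rnd k (v 0) / k ∧ v 1 = rnd k (v 1) / k ∧
        t ≤ G (rnd k (v 0)) (rnd k (v 1)) (v 2)}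
      have hr : ∀ j : Fin 3, Measurable fun v : RE (2 * 1 + 1) => (rnd k (v j) : ℝ) / k := fun j =>
        ((measurable_from_top (f := fun n : ℕ => (n : ℝ))).comp
          ((rnd_measurable k).comp (by fun_prop))).div_const _
      have hB : MeasurableSet B :=
        (measurableSet_eq_fun (by fun_prop) (hr 0)).inter
          ((measurableSet_eq_fun (by fun_prop) (hr 1)).inter
            (measurableSet_le measurable_const hGv))
      have h5 := left_measure_le_of_levyProkhorovEDist_lt hLP hB
      rw [Smeasure, Smeasure, Measure.map_apply hmf hB,
        Measure.map_apply hmg Metric.isOpen_thickening.measurableSet,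
        ENNReal.toReal_ofReal hδ.le] at h5
      have h6 : muX P₂ {x | t ≤ G (c x.1) (c x.2.1) (W x)} ≤
          muX P₂ {x | t ≤ G (rnd k (g 0 x.1)) (rnd k (g 0 x.2.1)) (U x) + ε}
            + ENNReal.ofReal δ := by
        refine (measure_mono ?_).trans (h5.trans (add_le_add_left (measure_mono ?_) _))
        · intro x hx
          refine ⟨?_, ?_, ?_⟩
          · rw [e0, hrf0]
          · rw [e1, hrf0]
          · rw [e0, e1, e2, hrf0, hrf0]; exact hx
        · intro x hx
          obtain ⟨b, ⟨hb0, hb1, hb2⟩, hd⟩ := Metric.mem_thickening_iff.1 hx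
          have d0 := (coord_le _ _ 0).trans_lt hd
          have d1 := (coord_le _ _ 1).trans_lt hd
          have d2 := (coord_le _ _ 2).trans_lt hd
          rw [e0, hb0] at d0
          rw [e1, hb1] at d1
          rw [e2] at d2
          have r0 := rnd_eq (rnd_lt hk _) (d0.trans_le hδk)
          have r1 := rnd_eq (rnd_lt hk _) (d1.trans_le hδk)
          show t ≤ G (rnd k (g 0 x.1)) (rnd k (g 0 x.2.1)) (U x) + ε
          rw [r0, r1]
          have := (abs_le.1 (hGε (rnd k (b 0)) (rnd k (b 1)) _ _ d2)).1
          linarith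
      have h7 := ENNReal.toReal_mono (by finiteness) h6
      rwa [ENNReal.toReal_add (by finiteness) (by finiteness), ENNReal.toReal_ofReal hδ.le] at h7)
  have A' := integral_compare (muX P₂) (muX P₂) _ _ hmGU hmGW M ε δ hM hε
    (fun x => hGM _ _ _) (fun x => hGM _ _ _) (fun t => by
      let B : Set (RE (2 * 1 + 1)) := {v | t ≤ G (rnd k (v 0)) (rnd k (v 1)) (v 2)}
      have hB : MeasurableSet B := measurableSet_le measurable_const hGv
      have h5 := right_measure_le_of_levyProkhorovEDist_lt hLP hB
      rw [Smeasure, Smeasure, Measure.map_apply hmg hB,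
        Measure.map_apply hmf Metric.isOpen_thickening.measurableSet,
        ENNReal.toReal_ofReal hδ.le] at h5
      have h6 : muX P₂ {x | t ≤ G (rnd k (g 0 x.1)) (rnd k (g 0 x.2.1)) (U x)} ≤
          muX P₂ {x | t ≤ G (c x.1) (c x.2.1) (W x) + ε}
            + ENNReal.ofReal δ := by
        refine (measure_mono ?_).trans (h5.trans (add_le_add_left (measure_mono ?_) _))
        · intro x hx
          show t ≤ _
          rw [e0, e1, e2]; exact hx
        · intro x hx
          obtain ⟨b, hb2, hd⟩ := Metric.mem_thickening_iff.1 hx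
          rw [dist_comm] at hd
          have d0 := (coord_le _ _ 0).trans_lt hd
          have d1 := (coord_le _ _ 1).trans_lt hd
          have d2 := (coord_le _ _ 2).trans_lt hd
          rw [e0] at d0
          rw [e1] at d1
          rw [e2] at d2
          have r0 := hrf _ _ d0
          have r1 := hrf _ _ d1
          have hb3 : t ≤ G (rnd k (b 0)) (rnd k (b 1)) (b 2) := hb2
          rw [r0, r1] at hb3
          show t ≤ G (c x.1) (c x.2.1) (W x) + ε
          have := (abs_le.1 (hGε (c x.1) (c x.2.1) _ _ d2)).2
          linarith
      have h7 := ENNReal.toReal_mono (by finiteness) h6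
      rwa [ENNReal.toReal_add (by finiteness) (by finiteness), ENNReal.toReal_ofReal hδ.le] at h7)
  rw [abs_le]
  constructor <;> linarith

/-! ### Energy -/

/-- Energy density. -/
def enH {ι : Type} [Fintype ι] (g : ι → ℝ → ℝ) (v : ι → ℕ → ℕ → ℝ) (a b : ℕ) (w : ℝ) : ℝ :=
  ∑ j, (2 * v j a b * g j w - v j a b ^ 2)

/-- Energy of a step function approximation. -/
def enPhi {Ω₂ : Type*} [MeasurableSpace Ω₂] (P₂ : Measure Ω₂) {ι : Type} [Fintype ι]
    (g : ι → ℝ → ℝ) (W : unitInterval × unitInterval × Ω₂ → ℝ) (c : unitInterval → ℕ)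
    (v : ι → ℕ → ℕ → ℝ) : ℝ :=
  ∫ x, enH g v (c x.1) (c x.2.1) (W x) ∂(muX P₂)

/-- Admissible step data at level `i`. -/
def enAdm {ι : Type} (i : ℕ) (c : unitInterval → ℕ) (v : ι → ℕ → ℕ → ℝ) : Prop :=
  Measurable c ∧ (∀ x, c x < 4 ^ i) ∧ ∀ j a b, |v j a b| ≤ i

/-- Optimal energy at level `i`. -/
def enE {Ω₂ : Type*} [MeasurableSpace Ω₂] (P₂ : Measure Ω₂) {ι : Type} [Fintype ι]
    (g : ι → ℝ → ℝ) (i : ℕ) (W : unitInterval × unitInterval × Ω₂ → ℝ) : ℝ :=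
  sSup {r | ∃ c v, enAdm i c v ∧ r = enPhi P₂ g W c v}

/-- A finite family of admissible test functions. -/
structure TestFam {ι : Type} (g : ι → ℝ → ℝ) : Prop where
  meas : ∀ j, Measurable (g j)
  nonneg : ∀ j w, 0 ≤ g j w
  le_one : ∀ j w, g j w ≤ 1
  uc : ∀ ε > (0 : ℝ), ∃ δ > (0 : ℝ), ∀ j w w', |w - w'| < δ → |g j w - g j w'| ≤ ε

lemma enAdm_zero {ι : Type} (i : ℕ) : enAdm i (fun _ => 0) (fun (_ : ι) _ _ => 0) :=
  ⟨measurable_const, fun _ => by positivity, fun _ _ _ => by simp⟩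

section
variable {ι : Type} [Fintype ι] {g : ι → ℝ → ℝ}

lemma enH_meas (hg : TestFam g) (v : ι → ℕ → ℕ → ℝ) (a b : ℕ) : Measurable (enH g v a b) := by
  unfold enH
  have := hg.meas
  fun_prop

lemma enH_le (hg : TestFam g) (v : ι → ℕ → ℕ → ℝ) (a b : ℕ) (w : ℝ) :
    enH g v a b w ≤ Fintype.card ι := by
  unfold enH
  calc ∑ j, (2 * v j a b * g j w - v j a b ^ 2) ≤ ∑ _j : ι, (1 : ℝ) := by
        refine Finset.sum_le_sum fun j _ => ?_
        nlinarith [hg.nonneg j w, hg.le_one j w, sq_nonneg (v j a b - g j w)]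
    _ = Fintype.card ι := by simp

lemma enH_abs (hg : TestFam g) (v : ι → ℕ → ℕ → ℝ) (i : ℕ) (hv : ∀ j a b, |v j a b| ≤ i)
    (a b : ℕ) (w : ℝ) : |enH g v a b w| ≤ Fintype.card ι * (2 * i + i ^ 2) := by
  unfold enH
  calc |∑ j, (2 * v j a b * g j w - v j a b ^ 2)|
      ≤ ∑ j, |2 * v j a b * g j w - v j a b ^ 2| := Finset.abs_sum_le_sum_abs _ _
    _ ≤ ∑ _j : ι, (2 * i + i ^ 2 : ℝ) := by
        refine Finset.sum_le_sum fun j _ => ?_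
        have h1 := hg.nonneg j w
        have h2 := hg.le_one j w
        have h3 := hv j a b
        refine (abs_sub _ _).trans ?_
        rw [abs_mul, abs_mul, abs_pow, abs_of_nonneg h1, abs_of_pos (two_pos : (0 : ℝ) < 2)]
        have h4 : |v j a b| * g j w ≤ i * 1 := mul_le_mul h3 h2 h1 (Nat.cast_nonneg i)
        have h5 : |v j a b| ^ 2 ≤ (i : ℝ) ^ 2 := pow_le_pow_left₀ (abs_nonneg _) h3 2
        linarith
    _ = Fintype.card ι * (2 * i + i ^ 2) := by simp [mul_add]

lemma enH_lip (v : ι → ℕ → ℕ → ℝ) (i : ℕ) (hv : ∀ j a b, |v j a b| ≤ i)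
    (a b : ℕ) (w w' ε : ℝ) (h : ∀ j, |g j w - g j w'| ≤ ε) :
    |enH g v a b w - enH g v a b w'| ≤ Fintype.card ι * (2 * i * ε) := by
  unfold enH
  rw [← Finset.sum_sub_distrib]
  calc |∑ j, ((2 * v j a b * g j w - v j a b ^ 2) - (2 * v j a b * g j w' - v j a b ^ 2))|
      ≤ ∑ j, |(2 * v j a b * g j w - v j a b ^ 2) - (2 * v j a b * g j w' - v j a b ^ 2)| :=
        Finset.abs_sum_le_sum_abs _ _
    _ ≤ ∑ _j : ι, (2 * i * ε : ℝ) := by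
        refine Finset.sum_le_sum fun j _ => ?_
        have e : (2 * v j a b * g j w - v j a b ^ 2) - (2 * v j a b * g j w' - v j a b ^ 2)
          = 2 * (v j a b * (g j w - g j w')) := by ring
        rw [e, abs_mul, abs_mul, abs_of_pos (two_pos : (0 : ℝ) < 2), mul_assoc]
        exact mul_le_mul_of_nonneg_left
          (mul_le_mul (hv j a b) (h j) (abs_nonneg _) (Nat.cast_nonneg i)) two_pos.le
    _ = Fintype.card ι * (2 * i * ε) := by simp

variable {Ω₂ : Type*} [MeasurableSpace Ω₂] (P₂ : Measure Ω₂) [IsProbabilityMeasure P₂]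

lemma meas_comp3 {G : ℕ → ℕ → ℝ → ℝ} (hG : ∀ a b, Measurable (G a b))
    {W : unitInterval × unitInterval × Ω₂ → ℝ} (hW : Measurable W) {c : unitInterval → ℕ}
    (hc : Measurable c) :
    Measurable fun x : unitInterval × unitInterval × Ω₂ => G (c x.1) (c x.2.1) (W x) := by
  have hGm : Measurable fun p : (ℕ × ℕ) × ℝ => G p.1.1 p.1.2 p.2 :=
    measurable_from_prod_countable_right fun p => hG p.1 p.2
  have h3 : Measurable fun x : unitInterval × unitInterval × Ω₂ => ((c x.1, c x.2.1), W x) := by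
    fun_prop
  exact hGm.comp h3

lemma enH_integrable (hg : TestFam g) {W : unitInterval × unitInterval × Ω₂ → ℝ}
    (hW : Measurable W) {i : ℕ} {c : unitInterval → ℕ} {v : ι → ℕ → ℕ → ℝ} (h : enAdm i c v) :
    Integrable (fun x : unitInterval × unitInterval × Ω₂ => enH g v (c x.1) (c x.2.1) (W x))
      (muX P₂) :=
  bdd_integrable (meas_comp3 (enH_meas hg v) hW h.1) fun _ => enH_abs hg v i h.2.2 _ _ _

lemma enPhi_le (hg : TestFam g) {W : unitInterval × unitInterval × Ω₂ → ℝ}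
    (hW : Measurable W) {i : ℕ} {c : unitInterval → ℕ} {v : ι → ℕ → ℕ → ℝ} (h : enAdm i c v) :
    enPhi P₂ g W c v ≤ Fintype.card ι := by
  have := integral_mono (enH_integrable P₂ hg hW h) (integrable_const (Fintype.card ι : ℝ))
    fun x => enH_le hg v _ _ _
  simpa [enPhi] using this

lemma enPhi_le_enE (hg : TestFam g) {W : unitInterval × unitInterval × Ω₂ → ℝ}
    (hW : Measurable W) {i : ℕ} {c : unitInterval → ℕ} {v : ι → ℕ → ℕ → ℝ} (h : enAdm i c v) :
    enPhi P₂ g W c v ≤ enE P₂ g i W := by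
  refine le_csSup ⟨Fintype.card ι, ?_⟩ ⟨c, v, h, rfl⟩
  rintro _ ⟨c, v, h, rfl⟩
  exact enPhi_le P₂ hg hW h

lemma enE_nonneg (hg : TestFam g) {W : unitInterval × unitInterval × Ω₂ → ℝ}
    (hW : Measurable W) (i : ℕ) : 0 ≤ enE P₂ g i W := by
  have := enPhi_le_enE P₂ hg hW (enAdm_zero (ι := ι) i)
  simpa [enPhi, enH] using this

lemma enE_le (hg : TestFam g) {W : unitInterval × unitInterval × Ω₂ → ℝ}
    (hW : Measurable W) (i : ℕ) : enE P₂ g i W ≤ Fintype.card ι := by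
  refine csSup_le ⟨_, _, _, enAdm_zero (ι := ι) i, rfl⟩ ?_
  rintro _ ⟨c, v, h, rfl⟩
  exact enPhi_le P₂ hg hW h

lemma enE_near (g : ι → ℝ → ℝ) (W : unitInterval × unitInterval × Ω₂ → ℝ)
    (i : ℕ) {η : ℝ} (hη : 0 < η) : ∃ c v, enAdm i c v ∧ enE P₂ g i W - η < enPhi P₂ g W c v := by
  obtain ⟨_, ⟨c, v, h, rfl⟩, h1⟩ := exists_lt_of_lt_csSup
    (s := {r | ∃ c v, enAdm i c v ∧ r = enPhi P₂ g W c v})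
    ⟨_, _, _, enAdm_zero (ι := ι) i, rfl⟩ (show enE P₂ g i W - η < enE P₂ g i W by linarith)
  exact ⟨c, v, h, h1⟩

lemma en_transfer (hg : TestFam g) (i : ℕ) {η : ℝ} (hη : 0 < η) :
    ∃ δ > (0 : ℝ), ∀ (W U : unitInterval × unitInterval × Ω₂ → ℝ) (hW : Measurable W)
      (hU : Measurable U),
      dM (PVar.ofUnitInterval P₂ W hW) (PVar.ofUnitInterval P₂ U hU) < δ →
      ∀ (c : unitInterval → ℕ) (v : ι → ℕ → ℕ → ℝ), enAdm i c v →
      ∃ c' : unitInterval → ℕ, enAdm i c' v ∧ |enPhi P₂ g W c v - enPhi P₂ g U c' v| ≤ η ∧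
        ∀ a, |(volume : Measure unitInterval).real {x | c x = a} - volume.real {x | c' x = a}| ≤ η := by
  set M : ℝ := Fintype.card ι * (2 * i + i ^ 2) + 1 with hMdef
  have hM : 0 < M := by positivity
  set q : ℝ := Fintype.card ι * (2 * i) + 1 with hq
  have hq0 : 0 < q := by positivity
  obtain ⟨δ₁, hδ₁, huc⟩ := hg.uc (η / (2 * q)) (by positivity)
  set δ : ℝ := min (min δ₁ (1 / (2 * (4 ^ i : ℕ)))) (η / (4 * M)) with hδdef
  have hδ : 0 < δ := by
    refine lt_min (lt_min hδ₁ ?_) (by positivity)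
    push_cast; positivity
  refine ⟨δ / 2, by positivity, fun W U hW hU hd c v hcv => ?_⟩
  obtain ⟨c', hc', hck', hT⟩ := transfer P₂ W U hW hU (4 ^ i) (by positivity) δ hδ
    ((min_le_left _ _).trans (min_le_right _ _)) hd c hcv.1 hcv.2.1
  have hδM : M * δ ≤ η / 4 := by
    calc M * δ ≤ M * (η / (4 * M)) := by gcongr; exact min_le_right _ _
      _ = η / 4 := by field_simp
  refine ⟨c', ⟨hc', hck', hcv.2.2⟩, ?_, fun a => ?_⟩
  · have h1 := hT (enH g v) (enH_meas hg v) M (η / 2) hM.le (by positivity)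
      (fun a b w => (enH_abs hg v i hcv.2.2 a b w).trans (by linarith))
      (fun a b w w' hw => by
        refine (enH_lip v i hcv.2.2 a b w w' (η / (2 * q)) fun j => huc j w w'
          (hw.trans_le ((min_le_left _ _).trans (min_le_left _ _)))).trans ?_
        calc (Fintype.card ι : ℝ) * (2 * i * (η / (2 * q)))
            = (Fintype.card ι * (2 * i)) * (η / (2 * q)) := by ring
          _ ≤ q * (η / (2 * q)) := by gcongr; linarith
          _ = η / 2 := by field_simp)
    refine h1.trans ?_
    linarith
  · have h1 := hT (fun a' _ _ => if a' = a then 1 else 0) (fun _ _ => measurable_const) 1 0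
      zero_le_one le_rfl (fun a' b w => by split_ifs <;> simp)
      (fun _ _ _ _ _ => by simp)
    have key : ∀ c : unitInterval → ℕ, Measurable c →
        ∫ x, (if c x.1 = a then (1 : ℝ) else 0) ∂(muX P₂) =
          (volume : Measure unitInterval).real {x | c x = a} := by
      intro c hc
      have hs : MeasurableSet {x : unitInterval | c x = a} := hc (measurableSet_singleton a)
      have e : (fun x : unitInterval × unitInterval × Ω₂ => if c x.1 = a then (1 : ℝ) else 0) =
          ({x : unitInterval | c x = a} ×ˢ univ).indicator 1 := by
        ext x
        simp [indicator_apply]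
      rw [e, integral_indicator_one (hs.prod MeasurableSet.univ), measureReal_prod_prod]
      simp
    rw [key c hcv.1, key c' hc'] at h1
    refine h1.trans ?_
    have : δ ≤ M * δ := le_mul_of_one_le_left hδ.le (by
      rw [hMdef]
      have : (0 : ℝ) ≤ Fintype.card ι * (2 * i + i ^ 2) := by positivity
      linarith)
    linarith

lemma enE_transfer (hg : TestFam g) (i : ℕ) {η : ℝ} (hη : 0 < η) :
    ∃ δ > (0 : ℝ), ∀ (W U : unitInterval × unitInterval × Ω₂ → ℝ) (hW : Measurable W)
      (hU : Measurable U),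
      dM (PVar.ofUnitInterval P₂ W hW) (PVar.ofUnitInterval P₂ U hU) < δ →
      enE P₂ g i W ≤ enE P₂ g i U + η := by
  obtain ⟨δ, hδ, h⟩ := en_transfer P₂ hg i hη
  refine ⟨δ, hδ, fun W U hW hU hd => ?_⟩
  refine csSup_le ⟨_, _, _, enAdm_zero (ι := ι) i, rfl⟩ ?_
  rintro _ ⟨c, v, hcv, rfl⟩
  obtain ⟨c', hcv', h1, -⟩ := h W U hW hU hd c v hcv
  have := enPhi_le_enE P₂ hg hU hcv'
  have := (abs_le.1 h1).2
  linarith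

lemma en_increment (hg : TestFam g) {W : unitInterval × unitInterval × Ω₂ → ℝ}
    (hW : Measurable W) {i : ℕ} {c : unitInterval → ℕ} {v : ι → ℕ → ℕ → ℝ} (h : enAdm i c v)
    {s : ℝ} (hs : 0 < s) (hs1 : s ≤ 1) (hE : enE P₂ g (i + 1) W - enPhi P₂ g W c v < s ^ 2)
    {S T : Set unitInterval} (hS : MeasurableSet S) (hT : MeasurableSet T) (j : ι) :
    |∫ x in {x : unitInterval × unitInterval × Ω₂ | x.1 ∈ S ∧ x.2.1 ∈ T},
      (g j (W x) - v j (c x.1) (c x.2.1)) ∂(muX P₂)| ≤ s := by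
  classical
  set Q : Set (unitInterval × unitInterval × Ω₂) := {x | x.1 ∈ S ∧ x.2.1 ∈ T} with hQ
  have hQm : MeasurableSet Q := (measurable_fst hS).inter ((measurable_fst.comp measurable_snd) hT)
  set D : ℝ := ∫ x in Q, (g j (W x) - v j (c x.1) (c x.2.1)) ∂(muX P₂) with hD
  have hmD : Measurable fun x : unitInterval × unitInterval × Ω₂ =>
      g j (W x) - v j (c x.1) (c x.2.1) :=
    meas_comp3 (G := fun a b w => g j w - v j a b) (fun a b => (hg.meas j).sub_const _) hW h.1
  have hiD : Integrable (fun x : unitInterval × unitInterval × Ω₂ =>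
      g j (W x) - v j (c x.1) (c x.2.1)) (muX P₂) := by
    refine bdd_integrable hmD (M := 1 + i) fun x => (abs_sub _ _).trans ?_
    rw [abs_of_nonneg (hg.nonneg j _)]
    exact add_le_add (hg.le_one j _) (h.2.2 _ _ _)
  have main : ∀ t : ℝ, |t| ≤ 1 → 2 * t * D - t ^ 2 * (muX P₂).real Q ≤
      enE P₂ g (i + 1) W - enPhi P₂ g W c v := by
    intro t ht
    let c2 : unitInterval → ℕ := fun x =>
      c x + 4 ^ i * ((if x ∈ S then 1 else 0) + 2 * (if x ∈ T then 1 else 0))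
    let v2 : ι → ℕ → ℕ → ℝ := fun j' a b => v j' (a % 4 ^ i) (b % 4 ^ i) +
      if j' = j ∧ (a / 4 ^ i) % 2 = 1 ∧ (b / 4 ^ i) / 2 = 1 then t else 0
    have hp : 0 < 4 ^ i := by positivity
    have hmod : ∀ x, c2 x % 4 ^ i = c x := fun x => by
      simp only [c2, Nat.add_mul_mod_self_left]
      exact Nat.mod_eq_of_lt (h.2.1 x)
    have hdiv : ∀ x, c2 x / 4 ^ i = (if x ∈ S then 1 else 0) + 2 * (if x ∈ T then 1 else 0) :=
      fun x => by
        simp only [c2]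
        rw [Nat.add_mul_div_left _ _ hp, Nat.div_eq_of_lt (h.2.1 x), zero_add]
    have hb1 : ∀ x, (c2 x / 4 ^ i) % 2 = 1 ↔ x ∈ S := fun x => by
      rw [hdiv]; split_ifs <;> simp [*]
    have hb2 : ∀ x, (c2 x / 4 ^ i) / 2 = 1 ↔ x ∈ T := fun x => by
      rw [hdiv]; split_ifs <;> simp [*]
    have hadm : enAdm (i + 1) c2 v2 := by
      refine ⟨?_, fun x => ?_, fun j' a b => ?_⟩
      · refine h.1.add (Measurable.const_mul ?_ _)
        exact (Measurable.ite hS measurable_const measurable_const).add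
          ((Measurable.ite hT measurable_const measurable_const).const_mul 2)
      · have := h.2.1 x
        simp only [c2, pow_succ]
        split_ifs <;> omega
      · have h1 := h.2.2 j' (a % 4 ^ i) (b % 4 ^ i)
        refine (abs_add_le _ _).trans ?_
        push_cast
        refine add_le_add h1 ?_
        split_ifs
        · exact ht
        · simp
    have hpt : ∀ x : unitInterval × unitInterval × Ω₂,
        enH g v2 (c2 x.1) (c2 x.2.1) (W x) = enH g v (c x.1) (c x.2.1) (W x) +
          Q.indicator (fun x => 2 * t * (g j (W x) - v j (c x.1) (c x.2.1)) - t ^ 2) x := by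
      intro x
      unfold enH
      rw [← sub_eq_iff_eq_add', ← Finset.sum_sub_distrib, Finset.sum_eq_single j]
      · simp only [v2, hmod, hb1, hb2, true_and]
        by_cases hx : x ∈ Q
        · rw [indicator_of_mem hx, if_pos (show x.1 ∈ S ∧ x.2.1 ∈ T from hx)]; ring
        · rw [indicator_of_notMem hx, if_neg (show ¬ (x.1 ∈ S ∧ x.2.1 ∈ T) from hx)]; ring
      · intro j' _ hj'
        simp [v2, hmod, hj']
      · simp
    have hi2 : Integrable (fun x => 2 * t * (g j (W x) - v j (c x.1) (c x.2.1)) - t ^ 2)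
      ((muX P₂).restrict Q) := ((hiD.const_mul _).sub (integrable_const _)).integrableOn
    have hPhi : enPhi P₂ g W c2 v2 = enPhi P₂ g W c v +
        (2 * t * D - t ^ 2 * (muX P₂).real Q) := by
      unfold enPhi
      rw [integral_congr_ae (Filter.Eventually.of_forall hpt),
        integral_add (enH_integrable P₂ hg hW h) ((integrable_indicator_iff hQm).2 hi2),
        integral_indicator hQm, integral_sub (hiD.const_mul _).integrableOn (integrable_const _),
        integral_const_mul]
      simp [hD, mul_comm]
    have := enPhi_le_enE P₂ hg hW hadm
    linarith
  have hQ1 : (muX P₂).real Q ≤ 1 := measureReal_le_one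
  have hQ0 : 0 ≤ (muX P₂).real Q := measureReal_nonneg
  by_contra hcon
  push Not at hcon
  rcases lt_abs.1 hcon with h1 | h1
  · have := main s (by rw [abs_of_pos hs]; exact hs1)
    nlinarith
  · have := main (-s) (by rw [abs_neg, abs_of_pos hs]; exact hs1)
    nlinarith
end

/-! ### Cut-closeness for finitely many test functions -/

lemma cut_step {Ω₂ : Type*} [MeasurableSpace Ω₂] (P₂ : Measure Ω₂) [IsProbabilityMeasure P₂]
    {W U : unitInterval × unitInterval × Ω₂ → ℝ} (hW : Measurable W) (hU : Measurable U)
    {g : ℝ → ℝ} (hg : Measurable g) (hg0 : ∀ w, 0 ≤ g w) (hg1 : ∀ w, g w ≤ 1)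
    {c c' : unitInterval → ℕ} (hc : Measurable c) (hc' : Measurable c') {v : ℕ → ℕ → ℝ} {i : ℕ}
    (hv : ∀ a b, |v a b| ≤ i) {s r : ℝ}
    (h1 : ∀ S T, MeasurableSet S → MeasurableSet T →
      |∫ x in {x : unitInterval × unitInterval × Ω₂ | x.1 ∈ S ∧ x.2.1 ∈ T},
        (g (W x) - v (c x.1) (c x.2.1)) ∂(muX P₂)| ≤ s)
    (h2 : ∀ S T, MeasurableSet S → MeasurableSet T →
      |∫ x in {x : unitInterval × unitInterval × Ω₂ | x.1 ∈ S ∧ x.2.1 ∈ T},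
        (g (U x) - v (c' x.1) (c' x.2.1)) ∂(muX P₂)| ≤ s)
    (φ : unitInterval ≃ᵐ unitInterval)
    (hφ : MeasurePreserving φ (volume : Measure unitInterval) volume)
    (hcc : (volume : Measure unitInterval).real {x | c x ≠ c' (φ x)} ≤ r)
    {S T : Set unitInterval} (hS : MeasurableSet S) (hT : MeasurableSet T) :
    |∫ x in {x : unitInterval × unitInterval × Ω₂ | x.1 ∈ S ∧ x.2.1 ∈ T}, g (W x) ∂(muX P₂) -
      ∫ x in {x : unitInterval × unitInterval × Ω₂ | x.1 ∈ S ∧ x.2.1 ∈ T},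
        g (relabel φ U x) ∂(muX P₂)| ≤ 2 * s + 4 * i * r := by
  set Q : Set (unitInterval × unitInterval × Ω₂) := {x | x.1 ∈ S ∧ x.2.1 ∈ T} with hQ
  have A1 := h1 S T hS hT
  have hU' := relabel_measurable φ.measurable hU
  have hmp := relabel_mp P₂ hφ
  have hcφ : Measurable fun x => c' (φ x) := hc'.comp φ.measurable
  have mv : ∀ {c : unitInterval → ℕ}, Measurable c →
      Measurable fun x : unitInterval × unitInterval × Ω₂ => v (c x.1) (c x.2.1) := fun hc =>
    meas_comp3 (G := fun a b _ => v a b) (fun a b => measurable_const) hW hc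
  have iv : ∀ {c : unitInterval → ℕ}, Measurable c →
      Integrable (fun x : unitInterval × unitInterval × Ω₂ => v (c x.1) (c x.2.1)) (muX P₂) :=
    fun hc => bdd_integrable (mv hc) fun x => hv _ _
  have ig : ∀ {W : unitInterval × unitInterval × Ω₂ → ℝ}, Measurable W →
      Integrable (fun x => g (W x)) (muX P₂) := fun hW =>
    bdd_integrable (hg.comp hW) (M := 1) fun x => abs_le.2 ⟨by linarith [hg0 (‹_ → ℝ› x)], hg1 _⟩
  have A2 : |∫ x in Q, (g (relabel φ U x) - v (c' (φ x.1)) (c' (φ x.2.1))) ∂(muX P₂)| ≤ s := by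
    have h3 := h2 (φ.symm ⁻¹' S) (φ.symm ⁻¹' T) (φ.symm.measurable hS) (φ.symm.measurable hT)
    have hm : MeasurableSet {x : unitInterval × unitInterval × Ω₂ |
        x.1 ∈ φ.symm ⁻¹' S ∧ x.2.1 ∈ φ.symm ⁻¹' T} :=
      (measurable_fst (φ.symm.measurable hS)).inter
        ((measurable_fst.comp measurable_snd) (φ.symm.measurable hT))
    have e := setIntegral_map (μ := muX P₂) (f := fun x => g (U x) - v (c' x.1) (c' x.2.1)) hm
      (((hg.comp hU).sub (mv hc')).aestronglyMeasurable) hmp.measurable.aemeasurable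
    rw [hmp.map_eq] at e
    rw [e] at h3
    have eQ : Q = (fun x : unitInterval × unitInterval × Ω₂ => (φ x.1, φ x.2.1, x.2.2)) ⁻¹'
        {x | x.1 ∈ φ.symm ⁻¹' S ∧ x.2.1 ∈ φ.symm ⁻¹' T} := by
      ext x
      simp [hQ]
    rw [← eQ] at h3
    exact h3
  have hbad : (muX P₂).real {x | c x.1 ≠ c' (φ x.1) ∨ c x.2.1 ≠ c' (φ x.2.1)} ≤ 2 * r := by
    have hb : MeasurableSet {x | c x ≠ c' (φ x)} := (measurableSet_eq_fun hc hcφ).compl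
    have e : {x : unitInterval × unitInterval × Ω₂ | c x.1 ≠ c' (φ x.1) ∨ c x.2.1 ≠ c' (φ x.2.1)}
      = ({x | c x ≠ c' (φ x)} ×ˢ univ) ∪ (univ ×ˢ ({x | c x ≠ c' (φ x)} ×ˢ univ)) := by
      ext x; simp
    rw [e]
    refine (measureReal_union_le _ _).trans ?_
    rw [measureReal_prod_prod, measureReal_prod_prod, measureReal_prod_prod]
    simp only [probReal_univ, mul_one, one_mul]
    linarith
  have A3 : |∫ x in Q, (v (c x.1) (c x.2.1) - v (c' (φ x.1)) (c' (φ x.2.1))) ∂(muX P₂)|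
      ≤ 4 * i * r := by
    set Bd : Set (unitInterval × unitInterval × Ω₂) :=
      {x | c x.1 ≠ c' (φ x.1) ∨ c x.2.1 ≠ c' (φ x.2.1)} with hBd
    have hBm : MeasurableSet Bd :=
      ((measurableSet_eq_fun hc hcφ).compl.preimage measurable_fst).union
        ((measurableSet_eq_fun hc hcφ).compl.preimage (measurable_fst.comp measurable_snd))
    have iB : Integrable (Bd.indicator fun _ => (2 * i : ℝ)) (muX P₂) :=
      (integrable_const _).indicator hBm
    have n0 : ∀ x, 0 ≤ Bd.indicator (fun _ => (2 * i : ℝ)) x := fun x =>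
      indicator_nonneg (fun _ _ => by positivity) x
    calc |∫ x in Q, (v (c x.1) (c x.2.1) - v (c' (φ x.1)) (c' (φ x.2.1))) ∂(muX P₂)|
        ≤ ∫ x in Q, Bd.indicator (fun _ => (2 * i : ℝ)) x ∂(muX P₂) := by
          rw [← Real.norm_eq_abs]
          refine norm_integral_le_of_norm_le iB.integrableOn (Filter.Eventually.of_forall fun x => ?_)
          rw [Real.norm_eq_abs]
          by_cases hx : x ∈ Bd
          · rw [indicator_of_mem hx]
            refine (abs_sub _ _).trans ?_
            have := hv (c x.1) (c x.2.1)
            have := hv (c' (φ x.1)) (c' (φ x.2.1))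
            linarith
          · rw [indicator_of_notMem hx]
            have hx' : ¬ (c x.1 ≠ c' (φ x.1) ∨ c x.2.1 ≠ c' (φ x.2.1)) := hx
            push Not at hx'
            rw [hx'.1, hx'.2]
            simp
      _ ≤ ∫ x, Bd.indicator (fun _ => (2 * i : ℝ)) x ∂(muX P₂) :=
          setIntegral_le_integral iB (Filter.Eventually.of_forall n0)
      _ = (muX P₂).real Bd * (2 * i) := by
          rw [integral_indicator hBm]; simp
      _ ≤ (2 * r) * (2 * i) := by gcongr
      _ = 4 * i * r := by ring
  rw [integral_sub (ig hW).integrableOn (iv hc).integrableOn] at A1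
  rw [integral_sub (ig hU').integrableOn (iv hcφ).integrableOn] at A2
  rw [integral_sub (iv hc).integrableOn (iv hcφ).integrableOn] at A3
  rw [abs_le] at A1 A2 A3 ⊢
  constructor <;> linarith [A1.1, A1.2, A2.1, A2.2, A3.1, A3.2]

lemma eventually_pair {p : ℕ → ℕ → Prop} (h : ∃ N : ℕ, ∀ m ≥ N, ∀ n ≥ N, p m n) :
    ∀ᶠ q : ℕ × ℕ in Filter.atTop, p q.1 q.2 := by
  obtain ⟨N, hN⟩ := h
  exact Filter.eventually_atTop.2 ⟨(N, N), fun q hq => hN _ hq.1 _ hq.2⟩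

lemma cut_tests {Ω₂ : Type*} [MeasurableSpace Ω₂] (P₂ : Measure Ω₂) [IsProbabilityMeasure P₂]
    (W : ℕ → unitInterval × unitInterval × Ω₂ → ℝ) (hW : ∀ n, Measurable (W n))
    (h : ∀ ε > (0 : ℝ), ∃ N : ℕ, ∀ m ≥ N, ∀ n ≥ N,
      dM (PVar.ofUnitInterval P₂ (W m) (hW m))
         (PVar.ofUnitInterval P₂ (W n) (hW n)) < ε)
    {ι : Type} [Fintype ι] {g : ι → ℝ → ℝ} (hg : TestFam g) {s : ℝ} (hs : 0 < s) (hs1 : s ≤ 1) :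
    ∃ N : ℕ, ∀ m ≥ N, ∀ n ≥ N, ∃ φ : unitInterval ≃ᵐ unitInterval,
      MeasurePreserving φ (volume : Measure unitInterval) volume ∧
      ∀ S T, MeasurableSet S → MeasurableSet T → ∀ j,
      |∫ x in {x : unitInterval × unitInterval × Ω₂ | x.1 ∈ S ∧ x.2.1 ∈ T},
        g j (W m x) ∂(muX P₂) -
      ∫ x in {x : unitInterval × unitInterval × Ω₂ | x.1 ∈ S ∧ x.2.1 ∈ T},
        g j (relabel φ (W n) x) ∂(muX P₂)| ≤ 3 * s := by
  set η : ℝ := s ^ 2 / 8 with hη'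
  have hη : 0 < η := by positivity
  obtain ⟨I, hI⟩ := exists_nat_gt ((Fintype.card ι : ℝ) / η)
  rw [div_lt_iff₀ hη] at hI
  set ε : ℕ → ℝ := fun i => min η (s / (8 * (i + 1) * 4 ^ i)) with hεdef
  have hε : ∀ i, 0 < ε i := fun i => lt_min hη (by positivity)
  -- uniform closeness of energies
  have c1 : ∀ i, ∀ᶠ q : ℕ × ℕ in Filter.atTop,
      enE P₂ g i (W q.1) ≤ enE P₂ g i (W q.2) + η := fun i => by
    obtain ⟨δ, hδ, h1⟩ := enE_transfer P₂ hg i hη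
    obtain ⟨N, hN⟩ := h δ hδ
    exact eventually_pair (p := fun m n => enE P₂ g i (W m) ≤ enE P₂ g i (W n) + η)
      ⟨N, fun m hm n hn => h1 _ _ _ _ (hN m hm n hn)⟩
  have c2 : ∀ i, ∀ᶠ q : ℕ × ℕ in Filter.atTop,
      ∀ (c : unitInterval → ℕ) (v : ι → ℕ → ℕ → ℝ), enAdm i c v →
      ∃ c' : unitInterval → ℕ, enAdm i c' v ∧
        |enPhi P₂ g (W q.1) c v - enPhi P₂ g (W q.2) c' v| ≤ ε i ∧
        ∀ a, |(volume : Measure unitInterval).real {x | c x = a} - volume.real {x | c' x = a}|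
          ≤ ε i := fun i => by
    obtain ⟨δ, hδ, h1⟩ := en_transfer P₂ hg i (hε i)
    obtain ⟨N, hN⟩ := h δ hδ
    exact Filter.eventually_atTop.2
      ⟨(N, N), fun q hq => h1 _ _ (hW _) (hW _) (hN _ hq.1 _ hq.2)⟩
  have c3 : ∀ᶠ q : ℕ × ℕ in Filter.atTop, ∀ i ∈ Finset.range (I + 1),
      enE P₂ g i (W q.1) ≤ enE P₂ g i (W q.2) + η ∧
      ∀ (c : unitInterval → ℕ) (v : ι → ℕ → ℕ → ℝ), enAdm i c v →
      ∃ c' : unitInterval → ℕ, enAdm i c' v ∧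
        |enPhi P₂ g (W q.1) c v - enPhi P₂ g (W q.2) c' v| ≤ ε i ∧
        ∀ a, |(volume : Measure unitInterval).real {x | c x = a} - volume.real {x | c' x = a}|
          ≤ ε i :=
    (Filter.eventually_all_finset _).2 fun i _ => (c1 i).and (c2 i)
  obtain ⟨N0, hN0⟩ := Filter.eventually_atTop.1 c3
  set N := max N0.1 N0.2 with hNdef
  have hN : ∀ m ≥ N, ∀ n ≥ N, ∀ i ≤ I, enE P₂ g i (W m) ≤ enE P₂ g i (W n) + η ∧
      ∀ (c : unitInterval → ℕ) (v : ι → ℕ → ℕ → ℝ), enAdm i c v →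
      ∃ c' : unitInterval → ℕ, enAdm i c' v ∧
        |enPhi P₂ g (W m) c v - enPhi P₂ g (W n) c' v| ≤ ε i ∧
        ∀ a, |(volume : Measure unitInterval).real {x | c x = a} - volume.real {x | c' x = a}|
          ≤ ε i := fun m hm n hn i hi =>
    hN0 (m, n) ⟨(le_max_left _ _).trans hm, (le_max_right _ _).trans hn⟩ i
      (Finset.mem_range.2 (Nat.lt_succ_of_le hi))
  -- pigeonhole
  obtain ⟨i, hiI, hi⟩ : ∃ i < I, enE P₂ g (i + 1) (W N) - enE P₂ g i (W N) ≤ η := by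
    by_contra hcon
    push Not at hcon
    have h1 : (I : ℝ) * η ≤ ∑ i ∈ Finset.range I, (enE P₂ g (i + 1) (W N) - enE P₂ g i (W N)) := by
      calc (I : ℝ) * η = ∑ _i ∈ Finset.range I, η := by simp
        _ ≤ _ := Finset.sum_le_sum fun i hi => (hcon i (Finset.mem_range.1 hi)).le
    rw [Finset.sum_range_sub (fun i => enE P₂ g i (W N))] at h1
    have h2 := enE_le P₂ hg (hW N) I
    have h3 := enE_nonneg P₂ hg (hW N) 0
    linarith
  refine ⟨N, fun m hm n hn => ?_⟩
  obtain ⟨c, v, hcv, hnear⟩ := enE_near P₂ g (W m) i hη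
  obtain ⟨c', hcv', hPhi, hlev⟩ := (hN m hm n hn i hiI.le).2 c v hcv
  have hPhi' := abs_le.1 (hPhi.trans (min_le_left _ _))
  have b1 := (hN n hn N le_rfl (i + 1) hiI).1
  have b2 := (hN m hm N le_rfl (i + 1) hiI).1
  have b3 := (hN N le_rfl m hm i hiI.le).1
  obtain ⟨φ, hφ, hbad⟩ := matching c c' hcv.1 hcv.2.1 hcv'.1 hcv'.2.1 (ε i)
    (s / (8 * (i + 1))) (by positivity) fun a _ => hlev a
  refine ⟨φ, hφ, fun S T hS hT j => ?_⟩
  have hr : ((4 ^ i : ℕ) : ℝ) * ε i + s / (8 * (i + 1)) ≤ s / (4 * (i + 1)) := by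
    have : ε i ≤ s / (8 * (i + 1) * 4 ^ i) := min_le_right _ _
    push_cast
    calc (4 : ℝ) ^ i * ε i + s / (8 * (i + 1))
        ≤ 4 ^ i * (s / (8 * (i + 1) * 4 ^ i)) + s / (8 * (i + 1)) := by gcongr
      _ = s / (4 * (i + 1)) := by field_simp; norm_num
  have h3 := cut_step P₂ (hW m) (hW n) (hg.meas j) (hg.nonneg j) (hg.le_one j) hcv.1 hcv'.1
    (hcv.2.2 j)
    (fun S T hS hT => en_increment P₂ hg (hW m) hcv hs hs1 (by linarith) hS hT j)
    (fun S T hS hT => en_increment P₂ hg (hW n) hcv' hs hs1 (by linarith) hS hT j)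
    φ hφ (hbad.trans hr) hS hT
  refine h3.trans ?_
  have h4 : 4 * (i : ℝ) * (s / (4 * (i + 1))) ≤ s := by
    rw [← mul_div_assoc, div_le_iff₀ (by positivity)]
    nlinarith
  linarith

/-! ### From test functions to the cut distance -/

/-- Cells of a grid. -/
def cellSet (h : ℝ) (A : Finset ℤ) : Set ℝ := {w | ⌊w / h⌋ ∈ A}

lemma mem_cellSet {h : ℝ} {A : Finset ℤ} {w : ℝ} : w ∈ cellSet h A ↔ ⌊w / h⌋ ∈ A := Iff.rfl

/-- Test functions: thickened indicators of unions of cells. -/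
def cellTest {h : ℝ} (hh : 0 < h) (A : Finset ℤ) (w : ℝ) : ℝ :=
  (thickenedIndicator hh (cellSet h A) w : ℝ≥0)

lemma cellTest_fam {h : ℝ} (hh : 0 < h) (F : Finset (Finset ℤ)) :
    TestFam (fun A : {A // A ∈ F} => cellTest hh A.1) where
  meas A := by
    unfold cellTest
    exact measurable_coe_nnreal_real.comp (thickenedIndicator hh _).continuous.measurable
  nonneg A w := NNReal.coe_nonneg _
  le_one A w := by
    have := thickenedIndicator_le_one hh (cellSet h A.1) w
    exact_mod_cast this
  uc ε hε := by
    refine ⟨ε * h, by positivity, fun A w w' hw => ?_⟩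
    have h1 := (lipschitzWith_thickenedIndicator hh (cellSet h A.1)).dist_le_mul w w'
    rw [NNReal.dist_eq, Real.dist_eq, NNReal.coe_inv, Real.coe_toNNReal _ hh.le] at h1
    refine h1.trans ?_
    rw [inv_mul_le_iff₀ hh]
    linarith

lemma cellTest_one {h : ℝ} (hh : 0 < h) {A : Finset ℤ} {w : ℝ} (hw : w ∈ cellSet h A) :
    cellTest hh A w = 1 := by
  unfold cellTest
  rw [thickenedIndicator_one hh _ hw]
  rfl

lemma cellTest_ne {h : ℝ} (hh : 0 < h) {A : Finset ℤ} {w : ℝ} (hw : cellTest hh A w ≠ 0) :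
    ∃ e ∈ cellSet h A, |w - e| < h := by
  by_contra hcon
  apply hw
  unfold cellTest
  rw [thickenedIndicator_zero hh]
  · rfl
  · intro hw'
    obtain ⟨e, he, hd⟩ := Metric.mem_thickening_iff.1 hw'
    exact hcon ⟨e, he, hd⟩

lemma cell_close {h e b : ℝ} (hh : 0 < h) (hf : ⌊b / h⌋ = ⌊e / h⌋) : |e - b| < h := by
  have := Int.abs_sub_lt_one_of_floor_eq_floor hf
  rw [← sub_div, abs_div, abs_of_pos hh, div_lt_one hh] at this
  rwa [abs_sub_comm]

lemma exists_test {h : ℝ} (hh : 0 < h) (K : ℝ) : ∃ L : ℤ, ∀ B : Set ℝ,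
    ∃ A ∈ (Finset.Icc (-L) L).powerset, (∀ w ∈ B, |w| ≤ K → cellTest hh A w = 1) ∧
      ∀ w, cellTest hh A w ≠ 0 → w ∈ Metric.thickening (2 * h) B := by
  classical
  refine ⟨⌈K / h⌉ + 1, fun B => ⟨(Finset.Icc (-(⌈K / h⌉ + 1)) (⌈K / h⌉ + 1)).filter
    fun n => ∃ b ∈ B, ⌊b / h⌋ = n, Finset.mem_powerset.2 (Finset.filter_subset _ _), ?_, ?_⟩⟩
  · intro w hw hwK
    refine cellTest_one hh (mem_cellSet.2 (Finset.mem_filter.2 ⟨Finset.mem_Icc.2 ?_, w, hw, rfl⟩))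
    obtain ⟨h1, h2⟩ := abs_le.1 hwK
    have h3 : K / h ≤ ⌈K / h⌉ := Int.le_ceil _
    have h4 : w / h ≤ K / h := by gcongr
    have h5 : -(K / h) ≤ w / h := by rw [← neg_div]; gcongr
    constructor
    · rw [Int.le_floor]; push_cast; linarith
    · have : (⌊w / h⌋ : ℝ) ≤ w / h := Int.floor_le _
      have h6 : (⌊w / h⌋ : ℝ) ≤ ((⌈K / h⌉ + 1 : ℤ) : ℝ) := by push_cast; linarith
      exact_mod_cast h6
  · intro w hw
    obtain ⟨e, he, hd⟩ := cellTest_ne hh hw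
    obtain ⟨b, hb, hbe⟩ := (Finset.mem_filter.1 (mem_cellSet.1 he)).2
    refine Metric.mem_thickening_iff.2 ⟨b, hb, ?_⟩
    have := cell_close hh hbe
    rw [Real.dist_eq]
    have := abs_sub_le w e b
    linarith

lemma meas_compare {X : Type*} [MeasurableSpace X] (μ : Measure X) [IsProbabilityMeasure μ]
    {W U : X → ℝ} (hW : Measurable W) (hU : Measurable U) {g : ℝ → ℝ} (hg : Measurable g)
    (g0 : ∀ w, 0 ≤ g w) (g1 : ∀ w, g w ≤ 1) {B B' : Set ℝ} (hB : MeasurableSet B)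
    (hB' : MeasurableSet B') {K s τ : ℝ} (hs : 0 ≤ s) (hτ : 0 ≤ τ)
    (h1 : ∀ w ∈ B, |w| ≤ K → g w = 1) (h2 : ∀ w, g w ≠ 0 → w ∈ B')
    {Q : Set X} (hQ : MeasurableSet Q)
    (h : ∫ x in Q, g (W x) ∂μ ≤ ∫ x in Q, g (U x) ∂μ + s)
    (ht : μ {x | K < |W x|} ≤ ENNReal.ofReal τ) :
    μ (Q ∩ W ⁻¹' B) ≤ μ (Q ∩ U ⁻¹' B') + ENNReal.ofReal (s + τ) := by
  have ig : ∀ {W : X → ℝ}, Measurable W → Integrable (fun x => g (W x)) μ := fun {W} hW =>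
    bdd_integrable (hg.comp hW) (M := 1) fun x => abs_le.2 ⟨by linarith [g0 (W x)], g1 _⟩
  have ht' : μ.real {x | K < |W x|} ≤ τ := ENNReal.toReal_le_of_le_ofReal hτ ht
  have hC : MeasurableSet (W ⁻¹' (B ∩ {w | |w| ≤ K})) :=
    hW (hB.inter (measurableSet_le (by fun_prop) measurable_const))
  have a1 : μ.real (Q ∩ W ⁻¹' B) ≤ μ.real (W ⁻¹' (B ∩ {w | |w| ≤ K}) ∩ Q) + τ := by
    refine le_trans ((measureReal_mono ?_).trans (measureReal_union_le _ _)) (add_le_add_right ht' _)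
    rintro x ⟨hx, hxB⟩
    by_cases hK : |W x| ≤ K
    · exact Or.inl ⟨⟨hxB, hK⟩, hx⟩
    · exact Or.inr (not_le.1 hK)
  have a2 : μ.real (W ⁻¹' (B ∩ {w | |w| ≤ K}) ∩ Q) ≤ ∫ x in Q, g (W x) ∂μ := by
    rw [← measureReal_restrict_apply hC, ← integral_indicator_one hC]
    refine integral_mono ((integrable_const (1 : ℝ)).indicator hC) (ig hW).integrableOn fun x => ?_
    by_cases hx : x ∈ W ⁻¹' (B ∩ {w | |w| ≤ K})
    · rw [indicator_of_mem hx]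
      exact (h1 _ hx.1 hx.2).ge
    · rw [indicator_of_notMem hx]
      exact g0 _
  have a3 : ∫ x in Q, g (U x) ∂μ ≤ μ.real (U ⁻¹' B' ∩ Q) := by
    rw [← measureReal_restrict_apply (hU hB'), ← integral_indicator_one (hU hB')]
    refine integral_mono (ig hU).integrableOn
      ((integrable_const (1 : ℝ)).indicator (hU hB')) fun x => ?_
    by_cases hx : x ∈ U ⁻¹' B'
    · rw [indicator_of_mem hx]
      exact g1 _
    · rw [indicator_of_notMem hx]
      by_contra hcon
      exact hx (h2 _ fun h0 => hcon h0.le)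
  rw [inter_comm _ Q] at a3
  have a4 : μ.real (Q ∩ W ⁻¹' B) ≤ μ.real (Q ∩ U ⁻¹' B') + (s + τ) := by linarith
  rw [← ofReal_measureReal, ← ofReal_measureReal, ← ENNReal.ofReal_add measureReal_nonneg
    (by positivity)]
  exact ENNReal.ofReal_le_ofReal a4

lemma dM_hard {Ω₂ : Type*} [MeasurableSpace Ω₂] (P₂ : Measure Ω₂) [IsProbabilityMeasure P₂]
    (W : ℕ → unitInterval × unitInterval × Ω₂ → ℝ) (hW : ∀ n, Measurable (W n))
    (htight : ∀ ε > (0 : ℝ), ∃ K > (0 : ℝ), ∀ n : ℕ,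
        (muX P₂) {x | K < |W n x|} < ENNReal.ofReal ε)
    (h : ∀ ε > (0 : ℝ), ∃ N : ℕ, ∀ m ≥ N, ∀ n ≥ N,
      dM (PVar.ofUnitInterval P₂ (W m) (hW m))
         (PVar.ofUnitInterval P₂ (W n) (hW n)) < ε) :
    ∀ ε > (0 : ℝ), ∃ N : ℕ, ∀ m ≥ N, ∀ n ≥ N,
      unlabCutDist (assocGraphon P₂ (W m)) (assocGraphon P₂ (W n)) < ε := by
  intro ε' hε'
  set ε : ℝ := ε' / 2 with hεdef
  have hε : 0 < ε := by positivity
  obtain ⟨K, -, hK⟩ := htight (ε / 2) (by positivity)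
  have hh : 0 < ε / 2 := by positivity
  obtain ⟨L, hL⟩ := exists_test hh K
  have hfam := cellTest_fam hh (Finset.Icc (-L) L).powerset
  set s : ℝ := min 1 (ε / 6) with hsdef
  have hs : 0 < s := lt_min one_pos (by positivity)
  have hs6 : s ≤ ε / 6 := min_le_right _ _
  obtain ⟨N, hN⟩ := cut_tests P₂ W hW h hfam hs (min_le_left _ _)
  refine ⟨N, fun m hm n hn => ?_⟩
  obtain ⟨φ, hφ, hcut⟩ := hN m hm n hn
  have hU' := relabel_measurable φ.measurable (hW n)
  have hK' : (muX P₂) {x | K < |relabel φ (W n) x|} < ENNReal.ofReal (ε / 2) := by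
    have hm : MeasurableSet {x | K < |W n x|} :=
      measurableSet_lt measurable_const (hW n).abs
    have := (relabel_mp P₂ hφ).measure_preimage hm.nullMeasurableSet
    refine lt_of_eq_of_lt this (hK n)
  have hLP : ∀ S T, MeasurableSet S → MeasurableSet T →
      levyProkhorovEDist (graphonInt (assocGraphon P₂ (W m)) (S ×ˢ T))
        (graphonInt (assocGraphon P₂ (relabel φ (W n))) (S ×ˢ T)) ≤ ENNReal.ofReal ε := by
    intro S T hS hT
    set Q : Set (unitInterval × unitInterval × Ω₂) := {x | x.1 ∈ S ∧ x.2.1 ∈ T} with hQ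
    have hQm : MeasurableSet Q :=
      (measurable_fst hS).inter ((measurable_fst.comp measurable_snd) hT)
    have eQ : ∀ (V : unitInterval × unitInterval × Ω₂ → ℝ) (B : Set ℝ),
        {x | x.1 ∈ S ∧ x.2.1 ∈ T ∧ V x ∈ B} = Q ∩ V ⁻¹' B := fun V B => by
      ext x; simp [hQ, and_assoc]
    refine lp_le _ _ ε hε ?_ ?_
    · intro B hB
      obtain ⟨A, hA, hA1, hA2⟩ := hL B
      rw [graphonInt_apply P₂ _ (hW m) hS hT hB, graphonInt_apply P₂ _ hU' hS hT
        Metric.isOpen_thickening.measurableSet, eQ, eQ]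
      have hc := abs_le.1 (hcut S T hS hT ⟨A, hA⟩)
      have h3 := meas_compare (muX P₂) (hW m) hU' (hfam.meas ⟨A, hA⟩) (hfam.nonneg ⟨A, hA⟩)
        (hfam.le_one ⟨A, hA⟩) hB (Metric.isOpen_thickening.measurableSet)
        (show 0 ≤ 3 * s by positivity) hh.le hA1 hA2 hQm (by linarith [hc.2]) (hK m).le
      rw [mul_div_cancel₀ ε two_ne_zero] at h3
      refine h3.trans (add_le_add_right (ENNReal.ofReal_le_ofReal (by linarith)) _)
    · intro B hB
      obtain ⟨A, hA, hA1, hA2⟩ := hL B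
      rw [graphonInt_apply P₂ _ hU' hS hT hB, graphonInt_apply P₂ _ (hW m) hS hT
        Metric.isOpen_thickening.measurableSet, eQ, eQ]
      have hc := abs_le.1 (hcut S T hS hT ⟨A, hA⟩)
      have h3 := meas_compare (muX P₂) hU' (hW m) (hfam.meas ⟨A, hA⟩) (hfam.nonneg ⟨A, hA⟩)
        (hfam.le_one ⟨A, hA⟩) hB (Metric.isOpen_thickening.measurableSet)
        (show 0 ≤ 3 * s by positivity) hh.le hA1 hA2 hQm (by linarith [hc.1]) hK'.le
      rw [mul_div_cancel₀ ε two_ne_zero] at h3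
      refine h3.trans (add_le_add_right (ENNReal.ofReal_le_ofReal (by linarith)) _)
  have h1 : unlabCutDist (assocGraphon P₂ (W m)) (assocGraphon P₂ (W n)) ≤
      cutDistKer (assocGraphon P₂ (W m)) (assocGraphon P₂ (relabel φ (W n))) := by
    refine ciInf_le (f := fun φ : {φ : unitInterval ≃ᵐ unitInterval //
          MeasurePreserving φ (volume : Measure unitInterval) volume} =>
      cutDistKer (assocGraphon P₂ (W m)) fun x => assocGraphon P₂ (W n) (φ.1 x.1, φ.1 x.2))
      ⟨0, ?_⟩ ⟨φ, hφ⟩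
    rintro _ ⟨ψ, rfl⟩
    exact Real.iSup_nonneg fun p => ENNReal.toReal_nonneg
  have h2 : cutDistKer (assocGraphon P₂ (W m)) (assocGraphon P₂ (relabel φ (W n))) ≤ ε := by
    have : Nonempty ({S : Set unitInterval // MeasurableSet S} ×
        {T : Set unitInterval // MeasurableSet T}) := ⟨⟨∅, MeasurableSet.empty⟩, ⟨∅, MeasurableSet.empty⟩⟩
    exact ciSup_le fun p => ENNReal.toReal_le_of_le_ofReal hε.le (hLP _ _ p.1.2 p.2.2)
  have : ε < ε' := by linarith
  linarith

/-- A tight sequence of P-variables on `[0,1] × [0,1] × Ω₂` is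
Cauchy for the P-variables metric `d_M` if and only if the associated probability
graphons form a Cauchy sequence for the unlabelled cut distance `δ_□`. -/
theorem dM_cauchy_iff_unlabCutDist_cauchy
    {Ω₂ : Type*} [MeasurableSpace Ω₂] (P₂ : Measure Ω₂) [IsProbabilityMeasure P₂]
    (W : ℕ → unitInterval × unitInterval × Ω₂ → ℝ) (hW : ∀ n, Measurable (W n))
      (htight : ∀ ε > (0 : ℝ), ∃ K > (0 : ℝ), ∀ n : ℕ,
        ((volume : Measure unitInterval).prod
          (((volume : Measure unitInterval)).prod P₂)) {x | K < |W n x|}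
          < ENNReal.ofReal ε) :
    (∀ ε > (0 : ℝ), ∃ N : ℕ, ∀ m ≥ N, ∀ n ≥ N,
      dM (PVar.ofUnitInterval P₂ (W m) (hW m))
         (PVar.ofUnitInterval P₂ (W n) (hW n)) < ε) ↔
    (∀ ε > (0 : ℝ), ∃ N : ℕ, ∀ m ≥ N, ∀ n ≥ N,
      unlabCutDist (assocGraphon P₂ (W m)) (assocGraphon P₂ (W n)) < ε) := by
  exact ⟨dM_hard P₂ W hW htight, dM_easy P₂ W hW⟩

end
end

section
/- For every integer k ≥ 1, every ε > 0, every C > 0 and every p with 1 < p ≤ ∞, there exists δ > 0 such that for any two P-variables U and W with ‖U‖_p ≤ C, ‖W‖_p ≤ C and d_M(U,W) ≤ δ, the sets of balanced fractional k×k averaged quotients satisfy d_{(1,m),H}(AQ_k(U), AQ_k(W)) ≤ ε. -/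
set_option autoImplicit false

open MeasureTheory Set
open scoped ENNReal NNReal

noncomputable section

/-- A balanced fractional function partition of `Ω₁`: `[0,1]`-valued measurable
functions summing pointwise to `1`, each with integral `1/k`. -/
def IsBalancedFracPartition {Ω₁ : Type*} [MeasurableSpace Ω₁] (P₁ : Measure Ω₁)
    {k : ℕ} (v : Fin k → Ω₁ → ℝ) : Prop :=
  (∀ i, Measurable (v i)) ∧ (∀ i x, v i x ∈ Icc (0 : ℝ) 1) ∧
    (∀ x, ∑ i, v i x = 1) ∧ ∀ i, ∫ x, v i x ∂P₁ = 1 / (k : ℝ)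

/-- The set `AQ_k(W)` of balanced fractional `k × k` averaged quotients of a
P-variable. -/
def AQ (V : PVar) (k : ℕ) : Set (Matrix (Fin k) (Fin k) ℝ) :=
  {M | ∃ v : Fin k → V.Ω₁ → ℝ, IsBalancedFracPartition V.P₁ v ∧
    ∀ i j, M i j = ∫ x, V.W x * v i x.1 * v j x.2.1 ∂V.vol}

/-- Entrywise `ℓ¹` distance between `k × k` matrices. -/
def d1m {k : ℕ} (A B : Matrix (Fin k) (Fin k) ℝ) : ℝ := ∑ i, ∑ j, |A i j - B i j|

/-- Hausdorff distance between sets of `k × k` matrices induced by `d1m`. -/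
def d1mH {k : ℕ} (A B : Set (Matrix (Fin k) (Fin k) ℝ)) : ℝ :=
  (max (⨆ M ∈ A, ⨅ M' ∈ B, ENNReal.ofReal (d1m M M'))
       (⨆ M' ∈ B, ⨅ M ∈ A, ENNReal.ofReal (d1m M M'))).toReal

/-! ### Bounded Lipschitz test functions and the Lévy–Prokhorov distance -/

lemma lp_integral_le {X : Type*} [PseudoMetricSpace X] [MeasurableSpace X] [OpensMeasurableSpace X]
    (μ ν : Measure X) [IsProbabilityMeasure μ] [IsProbabilityMeasure ν] {η : ℝ} (hη : 0 < η)
    (h : levyProkhorovEDist μ ν < ENNReal.ofReal η) (φ : X → ℝ) (hc : Continuous φ) (B L : ℝ)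
    (hL0 : 0 ≤ L)
    (h0 : ∀ x, 0 ≤ φ x) (hB : ∀ x, φ x ≤ B) (hL : ∀ x y, |φ x - φ y| ≤ L * dist x y) :
    ∫ x, φ x ∂μ ≤ ∫ x, φ x ∂ν + (L + B) * η := by
  have hne : Nonempty X := by
    by_contra hX
    rw [not_nonempty_iff] at hX
    have := measure_univ (μ := μ)
    simp [Set.univ_eq_empty_iff.2 hX] at this
  have hB0 : 0 ≤ B := (h0 hne.some).trans (hB _)
  have intg : ∀ (ρ : Measure X) [IsProbabilityMeasure ρ], Integrable φ ρ := by
    intro ρ _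
    refine Integrable.of_bound hc.measurable.aestronglyMeasurable B (Filter.Eventually.of_forall ?_)
    intro x
    rw [Real.norm_eq_abs, abs_of_nonneg (h0 x)]; exact hB x
  have anti : ∀ (ρ : Measure X) [IsProbabilityMeasure ρ] (ψ : X → ℝ) (a : ℝ),
      IntegrableOn (fun t : ℝ => ρ.real {x | t ≤ ψ x}) (Ioc 0 a) := by
    intro ρ _ ψ a
    apply Measure.integrableOn_of_bounded (M := 1) measure_Ioc_lt_top.ne
    · apply (Measurable.ennreal_toReal (Antitone.measurable ?_)).aestronglyMeasurable
      exact fun _ _ hst ↦ measure_mono (fun _ h ↦ hst.trans h)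
    · apply Filter.Eventually.of_forall <| fun t ↦ ?_
      simp only [Real.norm_eq_abs, abs_of_nonneg measureReal_nonneg]
      exact measureReal_le_one
  have e1 := (intg μ).integral_eq_integral_Ioc_meas_le (M := B)
    (Filter.Eventually.of_forall h0) (Filter.Eventually.of_forall hB)
  have e2 := ((intg ν).add (integrable_const (L * η))).integral_eq_integral_Ioc_meas_le
    (M := B + L * η)
    (Filter.Eventually.of_forall fun x => by
      have := h0 x; simp only [Pi.zero_apply, Pi.add_apply]; positivity)
    (Filter.Eventually.of_forall fun x => by
      have := hB x; simp only [Pi.add_apply]; linarith)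
  simp only [Pi.add_apply] at e2
  rw [integral_add (intg ν) (integrable_const _)] at e2
  simp only [integral_const, probReal_univ, smul_eq_mul, one_mul] at e2
  have key : ∀ t : ℝ, μ.real {x | t ≤ φ x} ≤ ν.real {x | t ≤ φ x + L * η} + η := by
    intro t
    have h1 := left_measure_le_of_levyProkhorovEDist_lt h (B := {a | t ≤ φ a})
          (hc.measurable measurableSet_Ici)
    rw [ENNReal.toReal_ofReal hη.le] at h1
    have h2 : Metric.thickening η {a | t ≤ φ a} ⊆ {x | t ≤ φ x + L * η} := by
      intro x hx
      rw [Metric.mem_thickening_iff] at hx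
      obtain ⟨z, hz, hd⟩ := hx
      have h3 := (abs_le.1 (hL z x)).2
      rw [dist_comm] at h3
      have : L * dist x z ≤ L * η := by gcongr
      simp only [mem_ofPred_eq] at hz ⊢
      linarith
    have h3 := h1.trans (add_le_add_left (measure_mono h2) _)
    have h4 := ENNReal.toReal_mono (by finiteness) h3
    rw [ENNReal.toReal_add (by finiteness) (by finiteness), ENNReal.toReal_ofReal hη.le] at h4
    exact h4
  rw [e1]
  calc ∫ t in Ioc 0 B, μ.real {a | t ≤ φ a}
      ≤ ∫ t in Ioc 0 B, (ν.real {x | t ≤ φ x + L * η} + η) := by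
        apply setIntegral_mono (anti μ φ B) ((anti ν _ B).add (integrable_const _)) key
    _ = (∫ t in Ioc 0 B, ν.real {x | t ≤ φ x + L * η}) + B * η := by
        rw [integral_add (anti ν _ B) (integrable_const _)]
        simp [hB0]
    _ ≤ (∫ t in Ioc 0 (B + L * η), ν.real {x | t ≤ φ x + L * η}) + B * η := by
        refine add_le_add ?_ le_rfl
        apply setIntegral_mono_set (anti ν _ _)
        · exact Filter.Eventually.of_forall fun t => measureReal_nonneg
        · apply LE.le.eventuallyLE
          apply Ioc_subset_Ioc_right
          have : 0 ≤ L * η := by positivity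
          linarith
    _ = _ := by rw [← e2]; ring

/-- Bounded Lipschitz functions. -/
def IsBL {X : Type*} [PseudoMetricSpace X] (φ : X → ℝ) : Prop :=
  ∃ B L : ℝ, 0 ≤ B ∧ 0 ≤ L ∧ (∀ x, |φ x| ≤ B) ∧ ∀ x y, |φ x - φ y| ≤ L * dist x y

lemma IsBL.continuous {X : Type*} [PseudoMetricSpace X] {φ : X → ℝ} (h : IsBL φ) :
    Continuous φ := by
  obtain ⟨B, L, hB, hL, h1, h2⟩ := h
  have : LipschitzWith ⟨L, hL⟩ φ := LipschitzWith.of_dist_le_mul fun x y => by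
    rw [Real.dist_eq]; exact h2 x y
  exact this.continuous

lemma IsBL.lp {X : Type*} [PseudoMetricSpace X] [MeasurableSpace X] [OpensMeasurableSpace X]
    {φ : X → ℝ} (h : IsBL φ) : ∃ c : ℝ, 0 ≤ c ∧ ∀ (μ ν : Measure X) (_ : IsProbabilityMeasure μ)
      (_ : IsProbabilityMeasure ν) (η : ℝ), 0 < η → levyProkhorovEDist μ ν < ENNReal.ofReal η →
      |∫ x, φ x ∂μ - ∫ x, φ x ∂ν| ≤ c * η := by
  have hc := h.continuous
  obtain ⟨B, L, hB, hL, h1, h2⟩ := h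
  refine ⟨L + 2 * B, by positivity, ?_⟩
  intro μ ν _ _ η hη hlp
  have intg : ∀ (ρ : Measure X) [IsProbabilityMeasure ρ], ∫ x, (φ x + B) ∂ρ = ∫ x, φ x ∂ρ + B := by
    intro ρ _
    rw [integral_add _ (integrable_const _)]
    · simp
    · refine Integrable.of_bound hc.measurable.aestronglyMeasurable B
        (Filter.Eventually.of_forall ?_)
      exact h1
  have a : ∀ (μ ν : Measure X) [IsProbabilityMeasure μ] [IsProbabilityMeasure ν]
      (_ : levyProkhorovEDist μ ν < ENNReal.ofReal η), _ :=
    fun μ ν _ _ hlp => lp_integral_le μ ν hη hlp (fun x => φ x + B) (by fun_prop) (2 * B) L hL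
    (fun x => by linarith [(abs_le.1 (h1 x)).1]) (fun x => by linarith [(abs_le.1 (h1 x)).2])
    (fun x y => by simpa using h2 x y)
  have a1 := a μ ν hlp
  have a2 := a ν μ (by rwa [levyProkhorovEDist_comm])
  rw [intg, intg] at a1 a2
  rw [abs_le]; constructor <;> linarith

lemma IsBL.const {X : Type*} [PseudoMetricSpace X] (a : ℝ) : IsBL (fun _ : X => a) :=
  ⟨|a|, 0, abs_nonneg _, le_rfl, fun _ => le_rfl, fun _ _ => by simp⟩

lemma IsBL.add {X : Type*} [PseudoMetricSpace X] {φ ψ : X → ℝ} (h : IsBL φ) (h' : IsBL ψ) :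
    IsBL (fun x => φ x + ψ x) := by
  obtain ⟨B, L, hB, hL, h1, h2⟩ := h
  obtain ⟨B', L', hB', hL', h1', h2'⟩ := h'
  refine ⟨B + B', L + L', by positivity, by positivity, fun x => ?_, fun x y => ?_⟩
  · exact (abs_add_le _ _).trans (add_le_add (h1 x) (h1' x))
  · have : φ x + ψ x - (φ y + ψ y) = (φ x - φ y) + (ψ x - ψ y) := by ring
    rw [this, add_mul]
    exact (abs_add_le _ _).trans (add_le_add (h2 x y) (h2' x y))

lemma IsBL.mul {X : Type*} [PseudoMetricSpace X] {φ ψ : X → ℝ} (h : IsBL φ) (h' : IsBL ψ) :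
    IsBL (fun x => φ x * ψ x) := by
  obtain ⟨B, L, hB, hL, h1, h2⟩ := h
  obtain ⟨B', L', hB', hL', h1', h2'⟩ := h'
  refine ⟨B * B', B * L' + L * B', by positivity, by positivity, fun x => ?_, fun x y => ?_⟩
  · rw [abs_mul]
    exact mul_le_mul (h1 x) (h1' x) (abs_nonneg _) hB
  · have : φ x * ψ x - (φ y * ψ y) = φ x * (ψ x - ψ y) + (φ x - φ y) * ψ y := by ring
    rw [this]
    refine (abs_add_le _ _).trans ?_
    rw [abs_mul, abs_mul]
    have a1 := mul_le_mul (h1 x) (h2' x y) (abs_nonneg _) hB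
    have a2 := mul_le_mul (h2 x y) (h1' y) (abs_nonneg _) (by positivity)
    linarith

lemma IsBL.neg {X : Type*} [PseudoMetricSpace X] {φ : X → ℝ} (h : IsBL φ) :
    IsBL (fun x => - φ x) := by
  simpa using (IsBL.const (-1)).mul h

lemma IsBL.abs {X : Type*} [PseudoMetricSpace X] {φ : X → ℝ} (h : IsBL φ) :
    IsBL (fun x => |φ x|) := by
  obtain ⟨B, L, hB, hL, h1, h2⟩ := h
  exact ⟨B, L, hB, hL, fun x => by rw [abs_abs]; exact h1 x,
    fun x y => (abs_abs_sub_abs_le_abs_sub _ _).trans (h2 x y)⟩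

lemma IsBL.sum {X ι : Type*} [PseudoMetricSpace X] (s : Finset ι) {φ : ι → X → ℝ}
    (h : ∀ i, IsBL (φ i)) : IsBL (fun x => ∑ i ∈ s, φ i x) := by
  classical
  induction s using Finset.induction_on with
  | empty => simpa using IsBL.const 0
  | insert a s ha ih =>
    simp only [Finset.sum_insert ha]
    exact (h a).add ih

/-- Truncation at level `K`. -/
def clip (K t : ℝ) : ℝ := max (-K) (min t K)

lemma abs_clip_le {K : ℝ} (hK : 0 ≤ K) (t : ℝ) : |clip K t| ≤ K := by
  unfold clip
  rw [abs_le]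
  refine ⟨le_max_left _ _, max_le (by linarith) (min_le_right _ _)⟩

lemma clip_of_abs_le {K t : ℝ} (h : |t| ≤ K) : clip K t = t := by
  unfold clip
  rw [abs_le] at h
  rw [min_eq_left h.2, max_eq_right h.1]

lemma clip_lip (K s t : ℝ) : |clip K s - clip K t| ≤ |s - t| := by
  unfold clip
  refine (abs_max_sub_max_le_max _ _ _ _).trans ?_
  refine max_le (by simp) ?_
  refine (abs_min_sub_min_le_max _ _ _ _).trans ?_
  simp

lemma abs_sub_clip_le {K : ℝ} (hK : 0 ≤ K) (t : ℝ) : |t - clip K t| ≤ |t| := by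
  unfold clip
  rcases le_total t 0 with h | h
  · rw [min_eq_left (by linarith), abs_of_nonpos h, abs_le]
    rcases le_total (-K) t with h' | h'
    · rw [max_eq_right h']; constructor <;> linarith
    · rw [max_eq_left h']; constructor <;> linarith
  · rw [max_eq_right (by rw [le_min_iff]; constructor <;> linarith), abs_of_nonneg h, abs_le]
    rcases le_total K t with h' | h'
    · rw [min_eq_right h']; constructor <;> linarith
    · rw [min_eq_left h']; constructor <;> linarith

lemma clip_tail {K q : ℝ} (hK : 0 < K) (hq : 1 < q) (t : ℝ) :
    |t - clip K t| ≤ K ^ (1 - q) * |t| ^ q := by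
  rcases le_total |t| K with h | h
  · rw [clip_of_abs_le h]; simp; positivity
  · refine (abs_sub_clip_le hK.le t).trans ?_
    have ht : 0 < |t| := hK.trans_le h
    have h1 : |t| ^ (1 - q) ≤ K ^ (1 - q) :=
      Real.rpow_le_rpow_of_nonpos hK h (by linarith)
    calc |t| = |t| ^ (1 - q) * |t| ^ q := by
          rw [← Real.rpow_add ht]; simp
      _ ≤ _ := by gcongr

lemma IsBL.clip_coord {n : ℕ} {K : ℝ} (hK : 0 ≤ K) (i : Fin n) :
    IsBL (fun z : RE n => clip K (z i)) := by
  refine ⟨K, 1, hK, zero_le_one, fun x => abs_clip_le hK _, fun x y => ?_⟩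
  refine (clip_lip _ _ _).trans ?_
  rw [one_mul, dist_eq_norm]
  have := PiLp.norm_apply_le (x - y) i
  simpa using this

/-! ### Coordinates of `sVec` and test integrals -/

instance PVar.instProb₁ (V : PVar) : IsProbabilityMeasure V.P₁ := V.prob₁
instance PVar.instProb₂ (V : PVar) : IsProbabilityMeasure V.P₂ := V.prob₂
instance PVar.instProbVol (V : PVar) : IsProbabilityMeasure V.vol := by
  unfold PVar.vol; infer_instance

lemma sVec_even {Ω₁ Ω₂ : Type*} (k : ℕ) (f : Fin k → Ω₁ → ℝ)
    (W : Ω₁ × Ω₁ × Ω₂ → ℝ) (x : Ω₁ × Ω₁ × Ω₂) (i : Fin k) :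
    sVec k f W x ⟨2 * i, by omega⟩ = f i x.1 := by
  have : 2 * (i : ℕ) < 2 * k := by omega
  simp [sVec]

lemma sVec_odd {Ω₁ Ω₂ : Type*} (k : ℕ) (f : Fin k → Ω₁ → ℝ)
    (W : Ω₁ × Ω₁ × Ω₂ → ℝ) (x : Ω₁ × Ω₁ × Ω₂) (i : Fin k) :
    sVec k f W x ⟨2 * i + 1, by omega⟩ = f i x.2.1 := by
  have h1 : 2 * (i : ℕ) + 1 < 2 * k := by omega
  have h2 : (2 * (i : ℕ) + 1) % 2 = 1 := by omega
  have h3 : (2 * (i : ℕ) + 1) / 2 = i := by omega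
  simp [sVec, h1, h2, h3]

lemma sVec_last {Ω₁ Ω₂ : Type*} (k : ℕ) (f : Fin k → Ω₁ → ℝ)
    (W : Ω₁ × Ω₁ × Ω₂ → ℝ) (x : Ω₁ × Ω₁ × Ω₂) :
    sVec k f W x ⟨2 * k, by omega⟩ = W x := by
  simp [sVec]

lemma measurable_sVec {Ω₁ Ω₂ : Type*} [MeasurableSpace Ω₁] [MeasurableSpace Ω₂]
    (k : ℕ) (f : Fin k → Ω₁ → ℝ) (hf : ∀ i, Measurable (f i))
    (W : Ω₁ × Ω₁ × Ω₂ → ℝ) (hW : Measurable W) : Measurable (sVec k f W) := by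
  unfold sVec
  refine (WithLp.measurable_toLp 2 _).comp ?_
  refine measurable_pi_lambda _ fun i => ?_
  split_ifs
  · exact (hf _).comp measurable_fst
  · exact (hf _).comp (measurable_fst.comp measurable_snd)
  · exact hW

lemma integral_vol_fst (V : PVar) (g : V.Ω₁ → ℝ) : ∫ x, g x.1 ∂V.vol = ∫ x, g x ∂V.P₁ := by
  unfold PVar.vol
  rw [integral_fun_fst]; simp

lemma integral_vol_snd (V : PVar) (g : V.Ω₁ → ℝ) : ∫ x, g x.2.1 ∂V.vol = ∫ x, g x ∂V.P₁ := by
  unfold PVar.vol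
  rw [integral_fun_snd (f := fun y : V.Ω₁ × V.Ω₂ => g y.1), integral_fun_fst]; simp

/-- Defect of a vector from being a probability vector. -/
def defect {k : ℕ} (y : Fin k → ℝ) : ℝ := ∑ i, (|y i| - y i) + |∑ i, y i - 1|

lemma IsBL.transfer {k : ℕ} {φ : RE (2 * k + 1) → ℝ} (h : IsBL φ) : ∃ c : ℝ, 0 ≤ c ∧
    ∀ (U : PVar) (W : PVar) (v : Fin k → U.Ω₁ → ℝ) (f : Fin k → W.Ω₁ → ℝ) (η : ℝ), 0 < η →
      (∀ i, Measurable (v i)) → (∀ i, Measurable (f i)) →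
      levyProkhorovEDist (Smeasure U.P₁ U.P₂ v U.W) (Smeasure W.P₁ W.P₂ f W.W)
        < ENNReal.ofReal η →
      |∫ x, φ (sVec k v U.W x) ∂U.vol - ∫ x, φ (sVec k f W.W x) ∂W.vol| ≤ c * η := by
  obtain ⟨c, hc, H⟩ := h.lp
  refine ⟨c, hc, ?_⟩
  intro U W v f η hη hv hf hlp
  have mU := measurable_sVec k v hv U.W U.meas
  have mW := measurable_sVec k f hf W.W W.meas
  have h1 := H _ _ (Measure.isProbabilityMeasure_map mU.aemeasurable)
    (Measure.isProbabilityMeasure_map mW.aemeasurable) η hη hlp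
  rwa [integral_map mU.aemeasurable h.continuous.measurable.aestronglyMeasurable,
    integral_map mW.aemeasurable h.continuous.measurable.aestronglyMeasurable] at h1

lemma test_consts (k : ℕ) (K : ℝ) (hK : 0 ≤ K) : ∃ c : ℝ, 0 < c ∧
    ∀ (U : PVar) (W : PVar) (v : Fin k → U.Ω₁ → ℝ) (f : Fin k → W.Ω₁ → ℝ) (η : ℝ), 0 < η →
      (∀ i, Measurable (v i)) → (∀ i, Measurable (f i)) →
      (∀ i x, |v i x| ≤ 1) → (∀ i x, |f i x| ≤ 1) →
      levyProkhorovEDist (Smeasure U.P₁ U.P₂ v U.W) (Smeasure W.P₁ W.P₂ f W.W)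
        < ENNReal.ofReal η →
      (∀ i, |∫ x, v i x ∂U.P₁ - ∫ x, f i x ∂W.P₁| ≤ c * η) ∧
      (|∫ x, defect (fun i => v i x) ∂U.P₁ - ∫ x, defect (fun i => f i x) ∂W.P₁| ≤ c * η) ∧
      (∀ i j, |∫ x, clip K (U.W x) * v i x.1 * v j x.2.1 ∂U.vol
        - ∫ x, clip K (W.W x) * f i x.1 * f j x.2.1 ∂W.vol| ≤ c * η) := by
  have b1 : ∀ i : Fin k, IsBL (fun z : RE (2 * k + 1) => clip 1 (z ⟨2 * i, by omega⟩)) :=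
    fun i => IsBL.clip_coord zero_le_one _
  have b1' : ∀ i : Fin k, IsBL (fun z : RE (2 * k + 1) => clip 1 (z ⟨2 * i + 1, by omega⟩)) :=
    fun i => IsBL.clip_coord zero_le_one _
  have b2 : IsBL (fun z : RE (2 * k + 1) =>
      defect (fun i : Fin k => clip 1 (z ⟨2 * i, by omega⟩))) := by
    unfold defect
    exact (IsBL.sum _ fun i => (b1 i).abs.add (b1 i).neg).add
      ((IsBL.sum _ b1).add (IsBL.const (-1))).abs
  have b3 : ∀ p : Fin k × Fin k, IsBL (fun z : RE (2 * k + 1) =>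
      clip K (z ⟨2 * k, by omega⟩) * clip 1 (z ⟨2 * p.1, by omega⟩)
        * clip 1 (z ⟨2 * p.2 + 1, by omega⟩)) := fun p =>
    ((IsBL.clip_coord hK _).mul (b1 p.1)).mul (b1' p.2)
  choose c1 hc1 H1 using fun i => (b1 i).transfer
  obtain ⟨c2, hc2, H2⟩ := b2.transfer
  choose c3 hc3 H3 using fun p => (b3 p).transfer
  have s1 : ∀ i, c1 i ≤ ∑ i, c1 i := fun i =>
    Finset.single_le_sum (fun i _ => hc1 i) (Finset.mem_univ i)
  have s3 : ∀ i, c3 i ≤ ∑ i, c3 i := fun i =>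
    Finset.single_le_sum (fun i _ => hc3 i) (Finset.mem_univ i)
  have t1 : 0 ≤ ∑ i, c1 i := Finset.sum_nonneg fun i _ => hc1 i
  have t3 : 0 ≤ ∑ i, c3 i := Finset.sum_nonneg fun i _ => hc3 i
  refine ⟨∑ i, c1 i + c2 + ∑ p, c3 p + 1, by positivity, ?_⟩
  intro U W v f η hη hv hf hv1 hf1 hlp
  refine ⟨fun i => ?_, ?_, fun i j => ?_⟩
  · have h := H1 i U W v f η hη hv hf hlp
    simp only [sVec_even, clip_of_abs_le (hv1 _ _), clip_of_abs_le (hf1 _ _)] at h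
    rw [integral_vol_fst, integral_vol_fst] at h
    refine h.trans ?_
    gcongr
    linarith [s1 i]
  · have h := H2 U W v f η hη hv hf hlp
    simp only [sVec_even, clip_of_abs_le (hv1 _ _), clip_of_abs_le (hf1 _ _)] at h
    rw [integral_vol_fst U (fun y => defect (fun i => v i y)),
      integral_vol_fst W (fun y => defect (fun i => f i y))] at h
    refine h.trans ?_
    gcongr
    linarith
  · have h := H3 (i, j) U W v f η hη hv hf hlp
    simp only [sVec_even, sVec_odd, sVec_last, clip_of_abs_le (hv1 _ _),
      clip_of_abs_le (hf1 _ _)] at h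
    refine h.trans ?_
    gcongr
    linarith [s3 (i, j)]

/-! ### Correction to a balanced fractional partition -/

/-- Correct a vector to a probability vector. -/
def fixVec {k : ℕ} (y : Fin k → ℝ) (i : Fin k) : ℝ :=
  max (y i) 0 / max (∑ j, max (y j) 0) 1
    + (1 - (∑ j, max (y j) 0) / max (∑ j, max (y j) 0) 1) / k

lemma fixVec_spec {k : ℕ} (hk : 1 ≤ k) (y : Fin k → ℝ) :
    (∀ i, 0 ≤ fixVec y i) ∧ ∑ i, fixVec y i = 1 ∧ ∀ i, |fixVec y i - y i| ≤ 2 * defect y := by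
  have hk' : (1 : ℝ) ≤ k := by exact_mod_cast hk
  unfold fixVec
  set s := ∑ j, max (y j) 0 with hs
  have hm : (1 : ℝ) ≤ max s 1 := le_max_right _ _
  have hsm : s ≤ max s 1 := le_max_left _ _
  have hq : s / max s 1 ≤ 1 := by rw [div_le_one (by linarith)]; exact hsm
  have gi : ∀ i, max (y i) 0 = y i + (|y i| - y i) / 2 := by
    intro i
    rcases le_total (y i) 0 with h | h
    · rw [max_eq_right h, abs_of_nonpos h]; ring
    · rw [max_eq_left h, abs_of_nonneg h]; ring
  refine ⟨fun i => ?_, ?_, fun i => ?_⟩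
  · have : 0 ≤ 1 - s / max s 1 := by linarith
    positivity
  · rw [Finset.sum_add_distrib, ← Finset.sum_div, ← hs]
    simp only [Finset.sum_const, Finset.card_univ, Fintype.card_fin, nsmul_eq_mul]
    field_simp
    ring
  · have d1 : 0 ≤ ∑ i, (|y i| - y i) :=
      Finset.sum_nonneg fun i _ => sub_nonneg.2 (le_abs_self _)
    have d2 : |y i| - y i ≤ ∑ i, (|y i| - y i) :=
      Finset.single_le_sum (f := fun i => |y i| - y i)
        (fun i _ => sub_nonneg.2 (le_abs_self _)) (Finset.mem_univ i)
    have d2' : 0 ≤ |y i| - y i := sub_nonneg.2 (le_abs_self _)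
    have d3 : |s - 1| ≤ defect y := by
      have : s - 1 = (∑ i, y i - 1) + (∑ i, (|y i| - y i)) / 2 := by
        rw [hs, Finset.sum_div, Finset.sum_congr rfl fun i _ => gi i, Finset.sum_add_distrib]
        ring
      rw [this]
      refine (abs_add_le _ _).trans ?_
      rw [abs_of_nonneg (a := (∑ i, (|y i| - y i)) / 2) (by positivity)]
      unfold defect
      linarith
    have d4 : ∑ i, (|y i| - y i) ≤ defect y := by
      unfold defect
      linarith [abs_nonneg (∑ i, y i - 1)]
    have g0 : 0 ≤ max (y i) 0 := le_max_right _ _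
    have gs : max (y i) 0 ≤ s :=
      Finset.single_le_sum (f := fun i => max (y i) 0)
        (fun i _ => le_max_right _ _) (Finset.mem_univ i)
    have d5 : |max (y i) 0 / max s 1 + (1 - s / max s 1) / k - max (y i) 0| ≤ |s - 1| := by
      rcases le_total s 1 with h | h
      · rw [max_eq_right h, abs_of_nonpos (a := s - 1) (by linarith)]
        have h2 : (1 - s) / (k : ℝ) ≤ 1 - s := div_le_self (by linarith) hk'
        have h3 : 0 ≤ (1 - s) / (k : ℝ) := div_nonneg (by linarith) (by linarith)
        simp only [div_one]
        rw [abs_le]; constructor <;> linarith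
      · rw [max_eq_left h, div_self (by linarith), abs_of_nonneg (a := s - 1) (by linarith)]
        simp only [sub_self, zero_div, add_zero]
        have h1 : max (y i) 0 / s ≤ max (y i) 0 := div_le_self g0 h
        rw [abs_of_nonpos (by linarith)]
        have h2 : max (y i) 0 / s * (s - 1) ≤ 1 * (s - 1) := by
          gcongr
          rw [div_le_one (by linarith)]; exact gs
        have h3 : max (y i) 0 / s * s = max (y i) 0 := by
          field_simp
        nlinarith
    have d6 : |max (y i) 0 - y i| ≤ (|y i| - y i) / 2 := by
      rw [gi i]; simp only [add_sub_cancel_left]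
      rw [abs_of_nonneg (by positivity)]
    have := abs_sub_le (max (y i) 0 / max s 1 + (1 - s / max s 1) / k) (max (y i) 0) (y i)
    linarith

lemma balance {Ω : Type*} [MeasurableSpace Ω] (P : Measure Ω) [IsProbabilityMeasure P] {k : ℕ}
    (hk : 1 ≤ k) (h : Fin k → Ω → ℝ) (hm : ∀ i, Measurable (h i)) (h0 : ∀ i x, 0 ≤ h i x)
    (h1 : ∀ x, ∑ i, h i x = 1) (e : ℝ) (he0 : 0 ≤ e) (hke : k * e ≤ 1)
    (he : ∀ i, |∫ x, h i x ∂P - 1 / k| ≤ e) :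
    ∃ v : Fin k → Ω → ℝ, IsBalancedFracPartition P v ∧ ∀ i x, |v i x - h i x| ≤ k * e := by
  have hk' : (1 : ℝ) ≤ k := by exact_mod_cast hk
  have hle : ∀ i x, h i x ≤ 1 := fun i x => by
    rw [← h1 x]
    exact Finset.single_le_sum (f := fun i => h i x) (fun i _ => h0 i x) (Finset.mem_univ i)
  have hint : ∀ i, Integrable (h i) P := fun i =>
    Integrable.of_bound (hm i).aestronglyMeasurable 1 (Filter.Eventually.of_forall fun x => by
      rw [Real.norm_eq_abs, abs_of_nonneg (h0 i x)]; exact hle i x)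
  set b : Fin k → ℝ := fun i => ∫ x, h i x ∂P with hb
  have hbs : ∑ i, b i = 1 := by
    rw [hb]
    simp only
    rw [← integral_finsetSum _ fun i _ => hint i]
    simp [h1]
  set t : ℝ := k * e with ht
  have ht0 : 0 ≤ t := by positivity
  set c : Fin k → ℝ := fun i => 1 / k - (1 - t) * b i with hc
  have hc0 : ∀ i, 0 ≤ c i := by
    intro i
    have h2 := (abs_le.1 (he i)).2
    have h4 : t * (1 / k) = e := by rw [ht]; field_simp
    have h3 : ∫ x, h i x ∂P = b i := rfl
    rw [h3] at h2
    simp only [hc]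
    rcases le_total (b i) (1 / k) with h | h
    · have : 0 ≤ b i := integral_nonneg fun x => h0 i x
      nlinarith
    · nlinarith
  have hcs : ∑ i, c i = t := by
    simp only [hc]
    rw [Finset.sum_sub_distrib, ← Finset.mul_sum, hbs]
    simp only [Finset.sum_const, Finset.card_univ, Fintype.card_fin, nsmul_eq_mul]
    field_simp
    ring
  have hct : ∀ i, c i ≤ t := fun i => by
    rw [← hcs]
    exact Finset.single_le_sum (fun i _ => hc0 i) (Finset.mem_univ i)
  refine ⟨fun i x => (1 - t) * h i x + c i, ⟨fun i => by have := hm i; fun_prop, fun i x => ?_,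
    fun x => ?_, fun i => ?_⟩, fun i x => ?_⟩
  · have a1 := h0 i x
    have a2 := hle i x
    have a3 := hct i
    have a4 := hc0 i
    constructor <;> nlinarith
  · rw [Finset.sum_add_distrib, ← Finset.mul_sum, h1, hcs]; ring
  · rw [integral_add ((hint i).const_mul _) (integrable_const _), integral_const_mul]
    simp [hc, hb]
  · have a1 := h0 i x
    have a2 := hle i x
    have a3 := hct i
    have a4 := hc0 i
    rw [abs_le]; constructor <;> nlinarith

lemma tail_bound {Ω : Type*} [MeasurableSpace Ω] (P : Measure Ω) [IsProbabilityMeasure P]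
    (W : Ω → ℝ) (hW : Measurable W) (q C K : ℝ) (hq : 1 < q) (hC : 0 < C) (hK : 0 < K)
    (h : eLpNorm W (ENNReal.ofReal q) P ≤ ENNReal.ofReal C) :
    Integrable W P ∧ ∫ x, |W x - clip K (W x)| ∂P ≤ K ^ (1 - q) * C ^ q := by
  have hq0 : 0 < q := by linarith
  have hmem : MemLp W (ENNReal.ofReal q) P :=
    ⟨hW.aestronglyMeasurable, h.trans_lt ENNReal.ofReal_lt_top⟩
  have hint : Integrable W P := hmem.integrable (by simpa using hq.le)
  refine ⟨hint, ?_⟩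
  have hpow : Integrable (fun x => |W x| ^ q) P := by
    have := hmem.integrable_norm_rpow (by simpa using hq0) (by simp)
    rw [ENNReal.toReal_ofReal hq0.le] at this
    simpa using this
  have h2 : ∫ x, |W x| ^ q ∂P ≤ C ^ q := by
    rw [hmem.eLpNorm_eq_integral_rpow_norm (by simpa using hq0) (by simp),
      ENNReal.toReal_ofReal hq0.le, ENNReal.ofReal_le_ofReal_iff hC.le] at h
    simp only [Real.norm_eq_abs] at h
    have h0 : 0 ≤ ∫ x, |W x| ^ q ∂P := integral_nonneg fun x => by positivity
    rwa [Real.rpow_inv_le_iff_of_pos h0 hC.le hq0] at h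
  calc ∫ x, |W x - clip K (W x)| ∂P ≤ ∫ x, K ^ (1 - q) * |W x| ^ q ∂P := by
        refine integral_mono_of_nonneg (Filter.Eventually.of_forall fun x => abs_nonneg _)
          (hpow.const_mul _) (Filter.Eventually.of_forall fun x => clip_tail hK hq _)
    _ = K ^ (1 - q) * ∫ x, |W x| ^ q ∂P := integral_const_mul _ _
    _ ≤ _ := by gcongr

/-! ### The one-sided estimate -/

lemma integral_diff_le {Ω : Type*} [MeasurableSpace Ω] (P : Measure Ω) {F G H : Ω → ℝ}
    (hF : Integrable F P) (hG : Integrable G P) (hH : Integrable H P)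
    (h : ∀ x, |F x - G x| ≤ H x) : |∫ x, F x ∂P - ∫ x, G x ∂P| ≤ ∫ x, H x ∂P := by
  rw [← integral_sub hF hG]
  refine (abs_integral_le_integral_abs).trans ?_
  exact integral_mono (hF.sub hG).abs hH h

lemma measurable_clip (K : ℝ) : Measurable (clip K) := by
  unfold clip; fun_prop

lemma trunc_err (V : PVar) (K T : ℝ) (hK : 0 ≤ K) (hV : Integrable V.W V.vol)
    (hT : ∫ x, |V.W x - clip K (V.W x)| ∂V.vol ≤ T) (a b : V.Ω₁ → ℝ) (ha : Measurable a)
    (hb : Measurable b) (ha1 : ∀ x, |a x| ≤ 1) (hb1 : ∀ x, |b x| ≤ 1) :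
    |∫ x, V.W x * a x.1 * b x.2.1 ∂V.vol - ∫ x, clip K (V.W x) * a x.1 * b x.2.1 ∂V.vol| ≤ T := by
  have hm := V.meas
  have hcm := (measurable_clip K).comp V.meas
  have hci : Integrable (fun x => clip K (V.W x)) V.vol :=
    Integrable.of_bound hcm.aestronglyMeasurable K
      (Filter.Eventually.of_forall fun x => abs_clip_le hK _)
  have hab : ∀ g : V.Ω₁ × V.Ω₁ × V.Ω₂ → ℝ, Integrable g V.vol →
      Integrable (fun x => g x * a x.1 * b x.2.1) V.vol := by
    intro g hg
    refine (hg.mul_bdd (c := 1) ?_ ?_).mul_bdd (c := 1) ?_ ?_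
    · exact (ha.comp measurable_fst).aestronglyMeasurable
    · exact Filter.Eventually.of_forall fun x => ha1 _
    · exact (hb.comp (measurable_fst.comp measurable_snd)).aestronglyMeasurable
    · exact Filter.Eventually.of_forall fun x => hb1 _
  refine (integral_diff_le V.vol (hab _ hV) (hab _ hci) (hV.sub hci).abs ?_).trans hT
  intro x
  have : V.W x * a x.1 * b x.2.1 - clip K (V.W x) * a x.1 * b x.2.1
    = (V.W x - clip K (V.W x)) * (a x.1 * b x.2.1) := by ring
  rw [this, abs_mul, abs_mul]
  have : |a x.1| * |b x.2.1| ≤ 1 := mul_le_one₀ (ha1 _) (abs_nonneg _) (hb1 _)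
  exact mul_le_of_le_one_right (abs_nonneg _) this

lemma swap_err (V : PVar) (K : ℝ) (hK : 0 ≤ K) (a b a' b' : V.Ω₁ → ℝ) (ha : Measurable a)
    (hb : Measurable b) (ha1 : ∀ x, |a x| ≤ 1) (hb1 : ∀ x, |b x| ≤ 1) (ha' : Measurable a')
    (hb' : Measurable b') (ha1' : ∀ x, |a' x| ≤ 1) (hb1' : ∀ x, |b' x| ≤ 1) (r : ℝ)
    (hra : ∫ x, |a x - a' x| ∂V.P₁ ≤ r) (hrb : ∫ x, |b x - b' x| ∂V.P₁ ≤ r) :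
    |∫ x, clip K (V.W x) * a x.1 * b x.2.1 ∂V.vol
      - ∫ x, clip K (V.W x) * a' x.1 * b' x.2.1 ∂V.vol| ≤ K * (r + r) := by
  have hm := V.meas
  have hcm := (measurable_clip K).comp V.meas
  have hci : Integrable (fun x => clip K (V.W x)) V.vol :=
    Integrable.of_bound hcm.aestronglyMeasurable K
      (Filter.Eventually.of_forall fun x => abs_clip_le hK _)
  have hab : ∀ (a b : V.Ω₁ → ℝ) (_ : Measurable a) (_ : Measurable b) (_ : ∀ x, |a x| ≤ 1)
      (_ : ∀ x, |b x| ≤ 1),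
      Integrable (fun x => clip K (V.W x) * a x.1 * b x.2.1) V.vol := by
    intro a b ha hb ha1 hb1
    refine (hci.mul_bdd (c := 1) ?_ ?_).mul_bdd (c := 1) ?_ ?_
    · exact (ha.comp measurable_fst).aestronglyMeasurable
    · exact Filter.Eventually.of_forall fun x => ha1 _
    · exact (hb.comp (measurable_fst.comp measurable_snd)).aestronglyMeasurable
    · exact Filter.Eventually.of_forall fun x => hb1 _
  have hd1 : ∀ (a a' : V.Ω₁ → ℝ) (_ : ∀ x, |a x| ≤ 1) (_ : ∀ x, |a' x| ≤ 1) (x : V.Ω₁),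
      ‖|a x - a' x|‖ ≤ 2 := by
    intro a a' h h' x
    rw [Real.norm_eq_abs, abs_abs]
    have := abs_sub (a x) (a' x)
    linarith [h x, h' x]
  have i1 : Integrable (fun x : V.Ω₁ × V.Ω₁ × V.Ω₂ => |a x.1 - a' x.1|) V.vol :=
    Integrable.of_bound (by fun_prop) 2
      (Filter.Eventually.of_forall fun x => hd1 a a' ha1 ha1' _)
  have i2 : Integrable (fun x : V.Ω₁ × V.Ω₁ × V.Ω₂ => |b x.2.1 - b' x.2.1|) V.vol :=
    Integrable.of_bound (by fun_prop) 2
      (Filter.Eventually.of_forall fun x => hd1 b b' hb1 hb1' _)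
  refine (integral_diff_le V.vol (hab a b ha hb ha1 hb1) (hab a' b' ha' hb' ha1' hb1')
    ((i1.add i2).const_mul K) ?_).trans ?_
  · intro x
    have : clip K (V.W x) * a x.1 * b x.2.1 - clip K (V.W x) * a' x.1 * b' x.2.1
      = clip K (V.W x) * ((a x.1 - a' x.1) * b x.2.1 + a' x.1 * (b x.2.1 - b' x.2.1)) := by ring
    rw [this, abs_mul]
    refine mul_le_mul (abs_clip_le hK _) ?_ (abs_nonneg _) hK
    refine (abs_add_le _ _).trans ?_
    rw [abs_mul, abs_mul]
    exact add_le_add (mul_le_of_le_one_right (abs_nonneg _) (hb1 _))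
      (mul_le_of_le_one_left (abs_nonneg _) (ha1' _))
  · rw [integral_const_mul]
    simp only [Pi.add_apply]
    rw [integral_add i1 i2, integral_vol_fst V (fun y => |a y - a' y|),
      integral_vol_snd V (fun y => |b y - b' y|)]
    gcongr

lemma measurable_fixVec {Ω : Type*} [MeasurableSpace Ω] {k : ℕ} (f : Fin k → Ω → ℝ)
    (hf : ∀ i, Measurable (f i)) (i : Fin k) : Measurable fun x => fixVec (fun j => f j x) i := by
  unfold fixVec
  fun_prop

lemma measurable_defect {Ω : Type*} [MeasurableSpace Ω] {k : ℕ} (f : Fin k → Ω → ℝ)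
    (hf : ∀ i, Measurable (f i)) : Measurable fun x => defect (fun j => f j x) := by
  unfold defect
  simp only [← Real.norm_eq_abs]
  fun_prop

lemma defect_nonneg {k : ℕ} (y : Fin k → ℝ) : 0 ≤ defect y :=
  add_nonneg (Finset.sum_nonneg fun i _ => sub_nonneg.2 (le_abs_self _)) (abs_nonneg _)

lemma defect_le {k : ℕ} (y : Fin k → ℝ) (h : ∀ i, |y i| ≤ 1) : defect y ≤ 3 * k + 1 := by
  unfold defect
  have h1 : ∑ i, (|y i| - y i) ≤ ∑ i : Fin k, (2 : ℝ) :=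
    Finset.sum_le_sum fun i _ => by linarith [h i, neg_abs_le (y i)]
  have h2 : |∑ i, y i - 1| ≤ k + 1 := by
    refine (abs_sub _ _).trans ?_
    have : |∑ i, y i| ≤ ∑ i : Fin k, (1 : ℝ) :=
      (Finset.abs_sum_le_sum_abs _ _).trans (Finset.sum_le_sum fun i _ => h i)
    simp at this ⊢
    linarith
  simp only [Finset.sum_const, Finset.card_univ, Fintype.card_fin, nsmul_eq_mul] at h1
  linarith

/-- Turning approximate partitions into balanced ones. -/
lemma exists_balanced (V : PVar) {k : ℕ} (hk : 1 ≤ k) (f : Fin k → V.Ω₁ → ℝ)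
    (hf : ∀ i, Measurable (f i)) (hf1 : ∀ i x, |f i x| ≤ 1) (a : ℝ) (ha0 : 0 ≤ a)
    (hka : k * (3 * a) ≤ 1) (h1 : ∀ i, |∫ x, f i x ∂V.P₁ - 1 / k| ≤ a)
    (h2 : ∫ x, defect (fun i => f i x) ∂V.P₁ ≤ a) :
    ∃ v : Fin k → V.Ω₁ → ℝ, IsBalancedFracPartition V.P₁ v ∧
      ∀ i, ∫ x, |v i x - f i x| ∂V.P₁ ≤ 5 * k * a := by
  have hk' : (1 : ℝ) ≤ k := by exact_mod_cast hk
  set h : Fin k → V.Ω₁ → ℝ := fun i x => fixVec (fun j => f j x) i with hh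
  have hspec := fun x => fixVec_spec hk (fun j => f j x)
  have hm : ∀ i, Measurable (h i) := measurable_fixVec f hf
  have hle : ∀ i x, h i x ≤ 1 := fun i x => by
    rw [← (hspec x).2.1]
    exact Finset.single_le_sum (f := fun i => h i x) (fun i _ => (hspec x).1 i) (Finset.mem_univ i)
  have hint : ∀ i, Integrable (h i) V.P₁ := fun i =>
    Integrable.of_bound (hm i).aestronglyMeasurable 1 (Filter.Eventually.of_forall fun x => by
      rw [Real.norm_eq_abs, abs_of_nonneg ((hspec x).1 i)]; exact hle i x)
  have fint : ∀ i, Integrable (f i) V.P₁ := fun i =>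
    Integrable.of_bound (hf i).aestronglyMeasurable 1 (Filter.Eventually.of_forall fun x => hf1 i x)
  have dint : Integrable (fun x => defect (fun i => f i x)) V.P₁ :=
    Integrable.of_bound (measurable_defect f hf).aestronglyMeasurable (3 * k + 1)
      (Filter.Eventually.of_forall fun x => by
        rw [Real.norm_eq_abs, abs_of_nonneg (defect_nonneg _)]
        exact defect_le _ fun i => hf1 i x)
  have e1 : ∀ i, |∫ x, h i x ∂V.P₁ - ∫ x, f i x ∂V.P₁| ≤ 2 * a := by
    intro i
    refine (integral_diff_le V.P₁ (hint i) (fint i) (dint.const_mul 2)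
      (fun x => (hspec x).2.2 i)).trans ?_
    rw [integral_const_mul]; linarith
  obtain ⟨v, hv, hvh⟩ := balance V.P₁ hk h hm (fun i x => (hspec x).1 i) (fun x => (hspec x).2.1)
    (3 * a) (by positivity) hka (fun i => by
      have := abs_sub_le (∫ x, h i x ∂V.P₁) (∫ x, f i x ∂V.P₁) (1 / k)
      linarith [e1 i, h1 i])
  refine ⟨v, hv, fun i => ?_⟩
  calc ∫ x, |v i x - f i x| ∂V.P₁ ≤ ∫ x, (k * (3 * a) + 2 * defect (fun i => f i x)) ∂V.P₁ := by
        refine integral_mono_of_nonneg (Filter.Eventually.of_forall fun x => abs_nonneg _)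
          ((integrable_const _).add (dint.const_mul _)) (Filter.Eventually.of_forall fun x => ?_)
        have := abs_sub_le (v i x) (h i x) (f i x)
        have a1 := hvh i x
        have a2 : |h i x - f i x| ≤ _ := (hspec x).2.2 i
        simp only
        linarith
    _ = k * (3 * a) + 2 * ∫ x, defect (fun i => f i x) ∂V.P₁ := by
        rw [integral_add (integrable_const _) (dint.const_mul _)]
        rw [integral_const_mul (2 : ℝ) (fun x => defect (fun i => f i x))]
        simp
    _ ≤ 5 * k * a := by nlinarith

lemma exists_level (q C τ : ℝ) (hq : 1 < q) (hC : 0 < C) (hτ : 0 < τ) :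
    ∃ K : ℝ, 0 < K ∧ K ^ (1 - q) * C ^ q ≤ τ := by
  have h1 : Filter.Tendsto (fun K : ℝ => K ^ (-(q - 1)) * C ^ q) Filter.atTop (nhds (0 * C ^ q)) :=
    (tendsto_rpow_neg_atTop (by linarith)).mul_const _
  rw [zero_mul] at h1
  obtain ⟨K, hK, hK0⟩ := ((h1.eventually (gt_mem_nhds hτ)).and
    (Filter.eventually_gt_atTop 0)).exists
  refine ⟨K, hK0, ?_⟩
  rw [neg_sub] at hK
  exact hK.le

lemma one_sided (k : ℕ) (hk : 1 ≤ k) (ε : ℝ) (hε : 0 < ε) (C : ℝ) (hC : 0 < C) (q : ℝ)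
    (hq : 1 < q) : ∃ η : ℝ, 0 < η ∧ ∀ (U : PVar) (W : PVar),
      eLpNorm U.W (ENNReal.ofReal q) U.vol ≤ ENNReal.ofReal C →
      eLpNorm W.W (ENNReal.ofReal q) W.vol ≤ ENNReal.ofReal C →
      (⨆ μ ∈ U.Sk k, ⨅ ν ∈ W.Sk k, levyProkhorovEDist μ ν) < ENNReal.ofReal η →
      ∀ M ∈ AQ U k, ∃ M' ∈ AQ W k, d1m M M' ≤ ε := by
  have hk' : (1 : ℝ) ≤ k := by exact_mod_cast hk
  set τ : ℝ := ε / (4 * k ^ 2) with hτ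
  have hτ0 : 0 < τ := by positivity
  obtain ⟨K, hK, hKτ⟩ := exists_level q C τ hq hC hτ0
  obtain ⟨c, hc, H⟩ := test_consts k K hK.le
  refine ⟨min (1 / (3 * k * c)) (min (τ / c) (τ / (10 * K * k * c))), by positivity, ?_⟩
  set η := min (1 / (3 * k * c)) (min (τ / c) (τ / (10 * K * k * c))) with hηdef
  have hη : 0 < η := by positivity
  have η1 : k * (3 * (c * η)) ≤ 1 := by
    have : η ≤ 1 / (3 * k * c) := min_le_left _ _
    rw [le_div_iff₀ (by positivity)] at this
    linarith
  have η2 : c * η ≤ τ := by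
    have : η ≤ τ / c := (min_le_right _ _).trans (min_le_left _ _)
    rw [le_div_iff₀ (by positivity)] at this
    linarith
  have η3 : K * (5 * k * (c * η) + 5 * k * (c * η)) ≤ τ := by
    have : η ≤ τ / (10 * K * k * c) := (min_le_right _ _).trans (min_le_right _ _)
    rw [le_div_iff₀ (by positivity)] at this
    linarith
  intro U W hU hW hsup M hM
  obtain ⟨v, hv, hMv⟩ := hM
  have hv1 : ∀ i x, |v i x| ≤ 1 := fun i x => by
    have := hv.2.1 i x
    rw [abs_of_nonneg this.1]; exact this.2
  have hmem : Smeasure U.P₁ U.P₂ v U.W ∈ U.Sk k :=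
    ⟨v, hv.1, fun i x => abs_le.1 (hv1 i x), rfl⟩
  have hlt := (le_iSup₂ (f := fun μ (_ : μ ∈ U.Sk k) => ⨅ ν ∈ W.Sk k, levyProkhorovEDist μ ν)
    _ hmem).trans_lt hsup
  simp only [iInf_lt_iff] at hlt
  obtain ⟨ν, ⟨f, hf, hfr, rfl⟩, hlp⟩ := hlt
  have hf1 : ∀ i x, |f i x| ≤ 1 := fun i x => abs_le.2 (hfr i x)
  obtain ⟨T1, T2, T3⟩ := H U W v f η hη hv.1 hf hv1 hf1 hlp
  have hd0 : ∫ x, defect (fun i => v i x) ∂U.P₁ = 0 := by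
    have : ∀ x, defect (fun i => v i x) = 0 := fun x => by
      unfold defect
      rw [hv.2.2.1 x]
      simp [abs_of_nonneg (hv.2.1 _ x).1]
    simp [this]
  rw [hd0, zero_sub, abs_neg] at T2
  obtain ⟨w, hw, hwf⟩ := exists_balanced W hk f hf hf1 (c * η) (by positivity) η1
    (fun i => by rw [← hv.2.2.2 i, abs_sub_comm]; exact T1 i) ((le_abs_self _).trans T2)
  have hw1 : ∀ i x, |w i x| ≤ 1 := fun i x => by
    have := hw.2.1 i x
    rw [abs_of_nonneg this.1]; exact this.2
  refine ⟨fun i j => ∫ x, W.W x * w i x.1 * w j x.2.1 ∂W.vol, ⟨w, hw, fun i j => rfl⟩, ?_⟩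
  obtain ⟨iU, tU⟩ := tail_bound U.vol U.W U.meas q C K hq hC hK hU
  obtain ⟨iW, tW⟩ := tail_bound W.vol W.W W.meas q C K hq hC hK hW
  have entry : ∀ i j, |M i j - ∫ x, W.W x * w i x.1 * w j x.2.1 ∂W.vol| ≤ 4 * τ := by
    intro i j
    rw [hMv i j]
    have a1 := trunc_err U K τ hK.le iU (tU.trans hKτ) (v i) (v j) (hv.1 i) (hv.1 j) (hv1 i) (hv1 j)
    have a2 := trunc_err W K τ hK.le iW (tW.trans hKτ) (w i) (w j) (hw.1 i) (hw.1 j) (hw1 i) (hw1 j)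
    have a3 := swap_err W K hK.le (w i) (w j) (f i) (f j) (hw.1 i) (hw.1 j) (hw1 i) (hw1 j)
      (hf i) (hf j) (hf1 i) (hf1 j) _ (hwf i) (hwf j)
    have a4 := T3 i j
    rw [abs_le] at a1 a2 a3 a4 ⊢
    constructor <;> linarith
  unfold d1m
  calc ∑ i, ∑ j, |M i j - ∫ x, W.W x * w i x.1 * w j x.2.1 ∂W.vol|
      ≤ ∑ i : Fin k, ∑ j : Fin k, 4 * τ :=
        Finset.sum_le_sum fun i _ => Finset.sum_le_sum fun j _ => entry i j
    _ = ε := by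
      simp only [Finset.sum_const, Finset.card_univ, Fintype.card_fin, nsmul_eq_mul]
      rw [hτ]; field_simp

lemma sk_prob (V : PVar) (k : ℕ) {μ : Measure (RE (2 * k + 1))} (h : μ ∈ V.Sk k) :
    IsProbabilityMeasure μ := by
  obtain ⟨f, hf, -, rfl⟩ := h
  exact Measure.isProbabilityMeasure_map (measurable_sVec k f hf V.W V.meas).aemeasurable

lemma sk_nonempty (V : PVar) (k : ℕ) : (V.Sk k).Nonempty :=
  ⟨_, fun _ _ => 0, fun _ => measurable_const, fun _ _ => by simp, rfl⟩

lemma eHausLP_le_one (U V : PVar) (k : ℕ) : eHausLP (U.Sk k) (V.Sk k) ≤ 1 := by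
  have key : ∀ μ ν : Measure (RE (2 * k + 1)), IsProbabilityMeasure μ → IsProbabilityMeasure ν →
      levyProkhorovEDist μ ν ≤ 1 := fun μ ν _ _ => by
    simpa using levyProkhorovEDist_le_max_measure_univ μ ν
  refine max_le (iSup₂_le fun μ hμ => ?_) (iSup₂_le fun ν hν => ?_)
  · obtain ⟨ν, hν⟩ := sk_nonempty V k
    exact (iInf₂_le ν hν).trans (key _ _ (sk_prob U k hμ) (sk_prob V k hν))
  · obtain ⟨μ, hμ⟩ := sk_nonempty U k
    exact (iInf₂_le μ hμ).trans (key _ _ (sk_prob U k hμ) (sk_prob V k hν))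

lemma eHausLP_le_of_dM (U V : PVar) (k : ℕ) (hk : 1 ≤ k) (δ : ℝ) (h : dM U V ≤ δ) :
    eHausLP (U.Sk k) (V.Sk k) ≤ ENNReal.ofReal (2 ^ k * δ) := by
  obtain ⟨n, rfl⟩ : ∃ n, k = n + 1 := ⟨k - 1, by omega⟩
  have hle : ∀ m, dHLP (U.Sk m) (V.Sk m) ≤ 1 := fun m => by
    have := ENNReal.toReal_mono (by simp) (eHausLP_le_one U V m)
    simpa [dHLP] using this
  have h0 : ∀ m, 0 ≤ dHLP (U.Sk m) (V.Sk m) := fun m => ENNReal.toReal_nonneg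
  have hs : Summable fun m : ℕ => (2 : ℝ)⁻¹ ^ (m + 1) * dHLP (U.Sk (m + 1)) (V.Sk (m + 1)) := by
    refine Summable.of_nonneg_of_le (fun m => mul_nonneg (by positivity) (h0 _))
      (fun m => mul_le_of_le_one_right (by positivity) (hle _)) ?_
    exact (summable_nat_add_iff 1).2 (summable_geometric_of_lt_one (by norm_num) (by norm_num))
  have h1 := hs.le_tsum n (fun m _ => mul_nonneg (by positivity) (h0 _))
  have h2 := h1.trans h
  rw [← ENNReal.ofReal_toReal ((eHausLP_le_one U V (n + 1)).trans_lt (by simp)).ne]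
  apply ENNReal.ofReal_le_ofReal
  change dHLP _ _ ≤ _
  rw [inv_pow, inv_mul_le_iff₀ (by positivity)] at h2
  exact h2

lemma exists_exponent (p : ℝ≥0∞) (hp : 1 < p) : ∃ q : ℝ, 1 < q ∧ ENNReal.ofReal q ≤ p := by
  obtain ⟨r, h1, h2⟩ := ENNReal.lt_iff_exists_nnreal_btwn.1 hp
  refine ⟨r, by exact_mod_cast h1, ?_⟩
  rw [ENNReal.ofReal_coe_nnreal]
  exact h2.le

universe u₁ u₂ u₃ u₄

/-- For every `k ≥ 1`, `ε > 0`, `C > 0` and `1 < p ≤ ∞` there exists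
`δ > 0` such that any two P-variables `U, W` with `‖U‖_p ≤ C`, `‖W‖_p ≤ C` and
`d_M(U, W) ≤ δ` satisfy `d_{(1,m),H}(AQ_k(U), AQ_k(W)) ≤ ε`. -/
theorem averagedQuotients_close_of_dM_close :
    ∀ k : ℕ, 1 ≤ k → ∀ ε > (0 : ℝ), ∀ C > (0 : ℝ), ∀ p : ℝ≥0∞, 1 < p →
      ∃ δ > (0 : ℝ), ∀ (U : PVar.{u₁, u₂}) (W : PVar.{u₃, u₄}),
        eLpNorm U.W p U.vol ≤ ENNReal.ofReal C →
        eLpNorm W.W p W.vol ≤ ENNReal.ofReal C →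
        dM U W ≤ δ → d1mH (AQ U k) (AQ W k) ≤ ε := by
  intro k hk ε hε C hC p hp
  obtain ⟨q, hq, hqp⟩ := exists_exponent p hp
  obtain ⟨η₁, hη₁, H₁⟩ := one_sided.{u₁, u₂, u₃, u₄} k hk ε hε C hC q hq
  obtain ⟨η₂, hη₂, H₂⟩ := one_sided.{u₃, u₄, u₁, u₂} k hk ε hε C hC q hq
  refine ⟨min η₁ η₂ / (2 * 2 ^ k), by positivity, ?_⟩
  intro U W hU hW hd
  have hU' := (eLpNorm_le_eLpNorm_of_exponent_le hqp U.meas.aestronglyMeasurable).trans hU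
  have hW' := (eLpNorm_le_eLpNorm_of_exponent_le hqp W.meas.aestronglyMeasurable).trans hW
  have hm : 0 < min η₁ η₂ := by positivity
  have hH := eHausLP_le_of_dM U W k hk _ hd
  have hlt : ∀ η, min η₁ η₂ ≤ η →
      ENNReal.ofReal (2 ^ k * (min η₁ η₂ / (2 * 2 ^ k))) < ENNReal.ofReal η := by
    intro η h
    rw [ENNReal.ofReal_lt_ofReal_iff (by linarith)]
    have : (2 : ℝ) ^ k * (min η₁ η₂ / (2 * 2 ^ k)) = min η₁ η₂ / 2 := by field_simp
    rw [this]; linarith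
  have A₁ := H₁ U W hU' hW' (((le_max_left _ _).trans hH).trans_lt (hlt _ (min_le_left _ _)))
  have A₂ := H₂ W U hW' hU' (by
    refine lt_of_le_of_lt ?_ (((le_max_right _ _).trans hH).trans_lt (hlt _ (min_le_right _ _)))
    simp only [levyProkhorovEDist_comm]
    exact le_rfl)
  unfold d1mH
  refine ENNReal.toReal_le_of_le_ofReal hε.le (max_le ?_ ?_)
  · refine iSup₂_le fun M hM => ?_
    obtain ⟨M', hM', h⟩ := A₁ M hM
    exact (iInf₂_le M' hM').trans (ENNReal.ofReal_le_ofReal h)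
  · refine iSup₂_le fun M hM => ?_
    obtain ⟨M', hM', h⟩ := A₂ M hM
    refine (iInf₂_le M' hM').trans (ENNReal.ofReal_le_ofReal ?_)
    unfold d1m at h ⊢
    simpa only [abs_sub_comm] using h

end
end
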